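/- arXiv:2008.09595 — 3 statements merged into one kernel-verified Lean document; each statement's English description precedes it below -/
import Mathlib

section
/- Let n ≥ 2 be an integer, α > −1, λ > 0, and set cₙ = n (n²/(n−1))^{n−1}. Define v_λ(x) = log( cₙ (α+1)ⁿ λⁿ / (1 + λ^{n/(n−1)} |x|^{n(α+1)/(n−1)})ⁿ ) for x ∈ ℝⁿ. Then v_λ is C¹ on ℝⁿ \ {0}, v_λ is a weak solution of −Δₙ v_λ = |x|^{nα} e^{v_λ} on ℝⁿ \ {0}, and ∫_{ℝⁿ} |x|^{nα} e^{v_λ} dx = cₙ (α+1)^{n−1} ωₙ. -/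
open MeasureTheory Metric Filter Topology Real Set
open scoped InnerProductSpace

/-- The Lebesgue volume of the unit ball in `ℝⁿ`. -/
noncomputable def omegaN (n : ℕ) : ℝ :=
  (volume (ball (0 : EuclideanSpace ℝ (Fin n)) 1)).toReal

/-- `c_γ = sign γ * (|γ| / (n ωₙ))^{1/(n-1)}`. -/
noncomputable def cgamma (n : ℕ) (γ : ℝ) : ℝ :=
  Real.sign γ * (|γ| / ((n : ℝ) * omegaN n)) ^ ((1 : ℝ) / ((n : ℝ) - 1))

/-- `u` is a weak solution of `-Δₙ u = f` on `U`. -/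
def IsWeakNSol (n : ℕ) (U : Set (EuclideanSpace ℝ (Fin n)))
    (u f : EuclideanSpace ℝ (Fin n) → ℝ) : Prop :=
  ∀ φ : EuclideanSpace ℝ (Fin n) → ℝ, ContDiff ℝ 1 φ → HasCompactSupport φ →
    tsupport φ ⊆ U →
    ∫ x in U, ‖gradient u x‖ ^ (n - 2) * ⟪gradient u x, gradient φ x⟫_ℝ
      = ∫ x in U, f x * φ x

/-- Euler's identity, integrated: the dilation field has divergence `n`. -/
theorem integral_fderiv_apply_self {n : ℕ} {ψ : EuclideanSpace ℝ (Fin n) → ℝ}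
    (hψ : ContDiff ℝ 1 ψ) (hc : HasCompactSupport ψ) :
    ∫ x, fderiv ℝ ψ x x = -(n * ∫ x, ψ x) := by
  have hd : Continuous (fderiv ℝ ψ) := hψ.continuous_fderiv one_ne_zero
  have hint (i : Fin n) : Integrable (fun x : EuclideanSpace ℝ (Fin n) =>
      x i * fderiv ℝ ψ x (EuclideanSpace.single i 1)) := by
    apply Continuous.integrable_of_hasCompactSupport
    · fun_prop
    · exact (hc.fderiv_apply (𝕜 := ℝ) _).mul_left
  have hparts (i : Fin n) : ∫ x : EuclideanSpace ℝ (Fin n),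
      x i * fderiv ℝ ψ x (EuclideanSpace.single i 1) = -∫ x, ψ x := by
    have hproj (x : EuclideanSpace ℝ (Fin n)) :
        fderiv ℝ (fun y : EuclideanSpace ℝ (Fin n) => y i) x (EuclideanSpace.single i 1) = 1 := by
      have := (EuclideanSpace.proj i : EuclideanSpace ℝ (Fin n) →L[ℝ] ℝ).hasFDerivAt (x := x)
      have h2 : fderiv ℝ (fun y : EuclideanSpace ℝ (Fin n) => y i) x = EuclideanSpace.proj i :=
        this.fderiv
      rw [h2]; simp
    rw [integral_mul_fderiv_eq_neg_fderiv_mul_of_integrable]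
    · simp [hproj]
    · simpa [hproj] using hψ.continuous.integrable_of_hasCompactSupport hc
    · exact hint i
    · exact (by fun_prop : Continuous fun x : EuclideanSpace ℝ (Fin n) => x i * ψ x)
        |>.integrable_of_hasCompactSupport hc.mul_left
    · exact fun x _ => by fun_prop
    · exact fun x _ => hψ.differentiable one_ne_zero x
  have hsum (x : EuclideanSpace ℝ (Fin n)) : fderiv ℝ ψ x x =
      ∑ i, x i * fderiv ℝ ψ x (EuclideanSpace.single i 1) := by
    have h := congrArg (fderiv ℝ ψ x) ((EuclideanSpace.basisFun (Fin n) ℝ).sum_repr x)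
    rw [← h]
    simp
  simp_rw [hsum]
  rw [integral_finsetSum _ fun i _ => hint i]
  simp [hparts]

theorem hasFDerivAt_norm_of_ne_zero {E : Type*} [NormedAddCommGroup E] [InnerProductSpace ℝ E]
    {x : E} (hx : x ≠ 0) :
    HasFDerivAt (fun y : E => ‖y‖) (‖x‖⁻¹ • innerSL ℝ x) x := by
  have h := (hasStrictFDerivAt_norm_sq x).hasFDerivAt.sqrt (by positivity)
  simp only [Real.sqrt_sq (norm_nonneg _)] at h
  convert h using 1
  ext y
  simp
  field_simp

theorem HasDerivAt.hasFDerivAt_comp_norm {E : Type*} [NormedAddCommGroup E]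
    [InnerProductSpace ℝ E] {V : ℝ → ℝ} {V' : ℝ} {x : E} (hV : HasDerivAt V V' ‖x‖)
    (hx : x ≠ 0) :
    HasFDerivAt (fun y : E => V ‖y‖) ((V' / ‖x‖) • innerSL ℝ x) x := by
  refine (hV.comp_hasFDerivAt x (hasFDerivAt_norm_of_ne_zero hx)).congr_fderiv ?_
  rw [smul_smul, div_eq_mul_inv]

theorem HasDerivAt.hasGradientAt_comp_norm {E : Type*} [NormedAddCommGroup E]
    [InnerProductSpace ℝ E] [CompleteSpace E] {V : ℝ → ℝ} {V' : ℝ} {x : E}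
    (hV : HasDerivAt V V' ‖x‖) (hx : x ≠ 0) :
    HasGradientAt (fun y : E => V ‖y‖) ((V' / ‖x‖) • x) x := by
  rw [hasGradientAt_iff_hasFDerivAt]
  refine (hV.hasFDerivAt_comp_norm hx).congr_fderiv ?_
  ext y
  simp

theorem ContDiffOn.contDiffAt_comp_norm {E : Type*} [NormedAddCommGroup E]
    [InnerProductSpace ℝ E] {g : ℝ → ℝ} {m : WithTop ℕ∞} (hg : ContDiffOn ℝ m g (Ioi 0))
    {x : E} (hx : x ≠ 0) : ContDiffAt ℝ m (fun y : E => g ‖y‖) x :=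
  (hg.contDiffAt (Ioi_mem_nhds (norm_pos_iff.2 hx))).comp x (contDiffAt_norm ℝ hx)

/-- A radial function whose flux `(r |V' r|)^(n-1)` has derivative `r^(n-1) g r` solves
`-Δₙ V = g` weakly away from the origin. -/
theorem isWeakNSol_of_radial {n : ℕ} (hn : 2 ≤ n) {V W g : ℝ → ℝ}
    (hV : ∀ r > 0, HasDerivAt V (-W r) r) (hW0 : ∀ r > 0, 0 ≤ W r)
    (hWc : ContDiffOn ℝ 1 W (Ioi 0))
    (hW : ∀ r > 0, HasDerivAt (fun s => (s * W s) ^ (n - 1)) (r ^ (n - 1) * g r) r)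
    (hg : ContinuousOn g (Ioi 0)) :
    IsWeakNSol n {(0 : EuclideanSpace ℝ (Fin n))}ᶜ (fun x => V ‖x‖) (fun x => g ‖x‖) := by
  intro φ hφ hφc hφ0
  have h0 : (0 : EuclideanSpace ℝ (Fin n)) ∉ tsupport φ := fun h => hφ0 h rfl
  have hφz : φ 0 = 0 := image_eq_zero_of_notMem_tsupport h0
  have hne {x : EuclideanSpace ℝ (Fin n)} (hx : x ∈ tsupport φ) : x ≠ 0 := hφ0 hx
  obtain ⟨k, rfl⟩ := Nat.exists_eq_add_of_le' hn
  simp only [show k + 2 - 1 = k + 1 by omega, show k + 2 - 2 = k by omega] at *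
  set κ : ℝ → ℝ := fun s => (s * W s) ^ (k + 1) / s ^ (k + 2) with hκ
  have hκc : ContDiffOn ℝ 1 κ (Ioi 0) := by
    refine ((contDiffOn_id.mul hWc).pow _).div (contDiffOn_id.pow _) fun s hs => ?_
    exact pow_ne_zero _ (ne_of_gt hs)
  have hκd (r : ℝ) (hr : 0 < r) : HasDerivAt κ ((g r - (k + 2) * κ r) / r) r := by
    refine ((hW r hr).div (hasDerivAt_pow (k + 2) r) (by positivity)).congr_deriv ?_
    simp only [hκ, show k + 2 - 1 = k + 1 by omega]
    push_cast
    field_simp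
    ring
  set ψ : EuclideanSpace ℝ (Fin (k + 2)) → ℝ := fun x => φ x * κ ‖x‖ with hψ
  have hψC : ContDiff ℝ 1 ψ := by
    refine contMDiff_iff_contDiff.1 (contMDiff_of_tsupport fun x hx => ContDiffAt.contMDiffAt ?_)
    exact hφ.contDiffAt.mul (hκc.contDiffAt_comp_norm (hne (tsupport_mul_subset_left hx)))
  have hψc : HasCompactSupport ψ := hφc.mul_right
  have hbC : Continuous fun x => g ‖x‖ * φ x := by
    refine continuous_of_tsupport fun x hx => ?_
    have hx0 := hne (tsupport_mul_subset_right hx)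
    exact (((hg.continuousAt (Ioi_mem_nhds (norm_pos_iff.2 hx0))).comp
      continuous_norm.continuousAt)).mul hφ.continuous.continuousAt
  have hbI : Integrable fun x => g ‖x‖ * φ x :=
    hbC.integrable_of_hasCompactSupport hφc.mul_left
  have hψI : Integrable ψ := hψC.continuous.integrable_of_hasCompactSupport hψc
  have hdI : Integrable fun x => fderiv ℝ ψ x x := by
    refine Continuous.integrable_of_hasCompactSupport ?_ ?_
    · exact (hψC.continuous_fderiv one_ne_zero).clm_apply continuous_id
    · refine (hψc.fderiv (𝕜 := ℝ)).mono fun x hx h => hx ?_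
      simp [h]
  have hgrad : gradient φ 0 = 0 := by
    have : fderiv ℝ φ 0 = 0 := by
      by_contra h
      exact h0 (support_fderiv_subset ℝ h)
    simp [gradient, this]
  have key (x : EuclideanSpace ℝ (Fin (k + 2))) :
      ‖gradient (fun y => V ‖y‖) x‖ ^ k * ⟪gradient (fun y => V ‖y‖) x, gradient φ x⟫_ℝ
        = g ‖x‖ * φ x - (k + 2) * ψ x - fderiv ℝ ψ x x := by
    rcases eq_or_ne x 0 with rfl | hx
    · simp [hgrad, hφz, hψ]
    have hr : 0 < ‖x‖ := norm_pos_iff.2 hx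
    have hφd : HasFDerivAt φ (fderiv ℝ φ x) x :=
      (hφ.differentiable one_ne_zero x).hasFDerivAt
    have hψd : HasFDerivAt ψ _ x := hφd.mul ((hκd _ hr).hasFDerivAt_comp_norm hx)
    have hin : ⟪x, gradient φ x⟫_ℝ = fderiv ℝ φ x x := by
      rw [real_inner_comm, gradient, InnerProductSpace.toDual_symm_apply]
    rw [((hV _ hr).hasGradientAt_comp_norm hx).gradient, hψd.fderiv, inner_smul_left, hin,
      norm_smul, norm_div, norm_neg, norm_norm, Real.norm_of_nonneg (hW0 _ hr),
      div_mul_cancel₀ _ hr.ne']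
    simp only [hψ, hκ, add_apply, smul_apply,
      innerSL_apply_apply, real_inner_self_eq_norm_sq, smul_eq_mul, conj_trivial]
    field_simp
    ring
  have hz1 : ∀ x ∉ ({0}ᶜ : Set (EuclideanSpace ℝ (Fin (k + 2)))),
      ‖gradient (fun y => V ‖y‖) x‖ ^ k * ⟪gradient (fun y => V ‖y‖) x, gradient φ x⟫_ℝ = 0 := by
    intro x hx
    obtain rfl : x = 0 := by simpa using hx
    simp [hgrad]
  have hz2 : ∀ x ∉ ({0}ᶜ : Set (EuclideanSpace ℝ (Fin (k + 2)))), g ‖x‖ * φ x = 0 := by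
    intro x hx
    obtain rfl : x = 0 := by simpa using hx
    simp [hφz]
  rw [setIntegral_eq_integral_of_forall_compl_eq_zero hz1,
    setIntegral_eq_integral_of_forall_compl_eq_zero hz2]
  simp_rw [key]
  have hsub : Integrable fun x => g ‖x‖ * φ x - (k + 2) * ψ x := hbI.sub (hψI.const_mul _)
  rw [integral_sub hsub hdI, integral_sub hbI (hψI.const_mul _),
    integral_const_mul, integral_fderiv_apply_self hψC hψc]
  push_cast
  ring

theorem hasDerivAt_rpow_div_one_add {b L r : ℝ} (hL : 0 < L) (hr : 0 < r) :
    HasDerivAt (fun s : ℝ => s ^ b / (1 + L * s ^ b))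
      (b * r ^ (b - 1) / (1 + L * r ^ b) ^ 2) r := by
  have hD : 0 < 1 + L * r ^ b := by positivity
  have h := Real.hasDerivAt_rpow_const (p := b) (Or.inl hr.ne')
  refine (h.div ((h.const_mul L).const_add 1) hD.ne').congr_deriv ?_
  congr 1
  ring

theorem tendsto_rpow_div_one_add {b L : ℝ} (hb : 0 < b) (hL : 0 < L) :
    Tendsto (fun s : ℝ => s ^ b / (1 + L * s ^ b)) atTop (𝓝 L⁻¹) := by
  have h := ((tendsto_rpow_neg_atTop hb).add_const L).inv₀ (by simpa using hL.ne')
  rw [zero_add] at h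
  refine h.congr' ?_
  filter_upwards [eventually_gt_atTop 0] with s hs
  rw [Real.rpow_neg hs.le]
  field_simp

/-- The integral over `ℝⁿ` of a radial function whose weighted profile has antiderivative `F`. -/
theorem integral_comp_norm_of_hasDerivAt_flux {n : ℕ} (hn : n ≠ 0) {F g : ℝ → ℝ} {m : ℝ}
    (hF0 : F 0 = 0) (hFc : ContinuousWithinAt F (Ici 0) 0)
    (hF : ∀ r > 0, HasDerivAt F (r ^ (n - 1) * g r) r) (hg : ∀ r > 0, 0 ≤ g r)
    (hm : Tendsto F atTop (𝓝 m)) :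
    ∫ x : EuclideanSpace ℝ (Fin n), g ‖x‖ = n * omegaN n * m := by
  have : Nonempty (Fin n) := ⟨⟨0, Nat.pos_of_ne_zero hn⟩⟩
  rw [integral_fun_norm_addHaar]
  have h := integral_Ioi_of_hasDerivAt_of_nonneg hFc (fun r hr => hF r hr)
    (fun r hr => mul_nonneg (pow_nonneg (le_of_lt hr) _) (hg r hr)) hm
  simp only [finrank_euclideanSpace, Fintype.card_fin, smul_eq_mul, nsmul_eq_mul, h, hF0,
    sub_zero, omegaN, Measure.real]
  ring

theorem radial_family_weighted_n_Liouville
    (n : ℕ) (hn : 2 ≤ n) (α : ℝ) (hα : α > -1) (lam : ℝ) (hlam : 0 < lam) :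
    let cn : ℝ := n * ((n : ℝ) ^ 2 / ((n : ℝ) - 1)) ^ (n - 1)
    let v : EuclideanSpace ℝ (Fin n) → ℝ := fun x =>
      Real.log (cn * (α + 1) ^ n * lam ^ n /
        (1 + lam ^ ((n : ℝ) / ((n : ℝ) - 1)) *
          ‖x‖ ^ ((n : ℝ) * (α + 1) / ((n : ℝ) - 1))) ^ n)
    ContDiffOn ℝ 1 v {(0 : EuclideanSpace ℝ (Fin n))}ᶜ ∧
    IsWeakNSol n {(0 : EuclideanSpace ℝ (Fin n))}ᶜ v
      (fun x => ‖x‖ ^ ((n : ℝ) * α) * Real.exp (v x)) ∧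
    (∫ x : EuclideanSpace ℝ (Fin n), ‖x‖ ^ ((n : ℝ) * α) * Real.exp (v x))
      = cn * (α + 1) ^ (n - 1) * omegaN n := by
  intro cn v
  obtain ⟨k, rfl⟩ := Nat.exists_eq_add_of_le' hn
  have hk : (0 : ℝ) < k + 1 := by positivity
  have hcast : ((k + 2 : ℕ) : ℝ) = k + 2 := by push_cast; ring
  have hcast1 : ((k + 2 : ℕ) : ℝ) - 1 = k + 1 := by push_cast; ring
  have ha : 0 < α + 1 := by linarith
  set b : ℝ := ((k + 2 : ℕ) : ℝ) * (α + 1) / (((k + 2 : ℕ) : ℝ) - 1) with hb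
  set L : ℝ := lam ^ (((k + 2 : ℕ) : ℝ) / (((k + 2 : ℕ) : ℝ) - 1)) with hL
  rw [hcast1, hcast] at hb hL
  have hb0 : 0 < b := by rw [hb]; positivity
  have hL0 : 0 < L := Real.rpow_pos_of_pos hlam _
  have hLpow : L ^ (k + 1) = lam ^ (k + 2) := by
    rw [hL, ← Real.rpow_natCast, ← Real.rpow_mul hlam.le, ← Real.rpow_natCast]
    congr 1
    push_cast
    field_simp
  have hcn : cn = (k + 2) * (((k + 2 : ℝ)) ^ 2 / (k + 1)) ^ (k + 1) := by
    simp only [cn]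
    rw [hcast1, hcast, show k + 2 - 1 = k + 1 by omega]
  have hcn0 : 0 < cn := by rw [hcn]; positivity
  set C : ℝ := cn * (α + 1) ^ (k + 2) * lam ^ (k + 2) with hC
  have hC0 : 0 < C := by positivity
  set V : ℝ → ℝ := fun r => Real.log (C / (1 + L * r ^ b) ^ (k + 2)) with hVdef
  set S : ℝ → ℝ := fun s => s ^ b / (1 + L * s ^ b) with hS
  set c : ℝ := (k + 2) * L * b with hc
  have hc0 : 0 < c := by positivity
  set g : ℝ → ℝ := fun r => r ^ (((k + 2 : ℕ) : ℝ) * α) * Real.exp (V r) with hgdef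
  have hD (r : ℝ) (hr : 0 ≤ r) : 0 < 1 + L * r ^ b := by
    have := Real.rpow_nonneg hr b
    positivity
  have hVC : ContDiffOn ℝ 1 V (Ioi 0) := by
    intro r hr
    have hr' : 0 < r := hr
    have hDr := hD r hr'.le
    refine ContDiffAt.contDiffWithinAt ?_
    refine ContDiffAt.log (contDiffAt_const.div ?_ (by positivity)) (by positivity)
    exact (contDiffAt_const.add
      (contDiffAt_const.mul (Real.contDiffAt_rpow_const (Or.inl hr'.ne')))).pow _
  have hSC : ContDiffOn ℝ 1 S (Ioi 0) := by
    intro r hr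
    have hr' : 0 < r := hr
    have h := Real.contDiffAt_rpow_const (n := 1) (p := b) (Or.inl hr'.ne')
    exact (h.div (contDiffAt_const.add (contDiffAt_const.mul h)) (hD r hr'.le).ne').contDiffWithinAt
  have hV (r : ℝ) (hr : r > 0) : HasDerivAt V (-(c * S r / r)) r := by
    have hDr := hD r hr.le
    have h := (((Real.hasDerivAt_rpow_const (p := b) (Or.inl hr.ne')).const_mul L).const_add 1)
    have hpow : HasDerivAt (fun s => (1 + L * s ^ b) ^ (k + 2)) _ r := h.pow (k + 2)
    have hdiv : HasDerivAt (fun s => C / (1 + L * s ^ b) ^ (k + 2)) _ r :=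
      (hasDerivAt_const r C).div hpow (by positivity)
    refine (hdiv.log (by positivity)).congr_deriv ?_
    simp only [hS, hc, Real.rpow_sub hr, Real.rpow_one, show k + 2 - 1 = k + 1 by omega]
    push_cast
    field_simp
    ring
  have hflux (r : ℝ) (hr : r > 0) :
      HasDerivAt (fun s => (c * S s) ^ (k + 1)) (r ^ (k + 1) * g r) r := by
    have hDr := hD r hr.le
    refine (((hasDerivAt_rpow_div_one_add (b := b) hL0 hr).const_mul c).pow (k + 1)).congr_deriv ?_
    have hpow : r ^ (k + 1) * r ^ (((k + 2 : ℕ) : ℝ) * α) = (r ^ b) ^ k * r ^ (b - 1) := by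
      rw [← Real.rpow_natCast, ← Real.rpow_natCast, ← Real.rpow_mul hr.le,
        ← Real.rpow_add hr, ← Real.rpow_add hr]
      congr 1
      rw [hb]
      push_cast
      field_simp
      ring
    have hconst : C = c ^ (k + 1) * (k + 1) * b := by
      rw [hC, hc, hcn, ← hLpow, hb]
      simp only [mul_pow, div_pow, ← pow_mul]
      field_simp
      ring
    simp only [hgdef, hVdef]
    rw [Real.exp_log (by positivity), ← mul_assoc (r ^ (k + 1)), hpow, hconst]
    simp only [show k + 1 - 1 = k by omega, mul_pow, div_pow]
    push_cast
    field_simp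
    ring
  have hgc : ContinuousOn g (Ioi 0) := by
    have hexp : ContinuousOn (fun r => Real.exp (V r)) (Ioi 0) :=
      Real.continuous_exp.comp_continuousOn hVC.continuousOn
    refine ContinuousOn.mul (fun r hr => ?_) hexp
    exact (Real.continuousAt_rpow_const r _ (Or.inl (ne_of_gt hr))).continuousWithinAt
  have hv : v = fun x => V ‖x‖ := rfl
  rw [hv]
  refine ⟨fun x hx => (hVC.contDiffAt_comp_norm hx).contDiffWithinAt, ?_, ?_⟩
  · refine isWeakNSol_of_radial hn hV (fun r hr => ?_) ?_ (fun r hr => ?_) hgc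
    · have := hD r hr.le
      simp only [hS]
      positivity
    · exact (contDiffOn_const.mul hSC).div contDiffOn_id fun s hs => ne_of_gt hs
    · refine (hflux r hr).congr_of_eventuallyEq ?_
      filter_upwards [eventually_ne_nhds hr.ne'] with s hs
      rw [mul_div_cancel₀ _ hs, show k + 2 - 1 = k + 1 by omega]
  · have hS0 : ContinuousAt S 0 := by
      have h := Real.continuousAt_rpow_const 0 b (Or.inr hb0.le)
      exact h.div (continuousAt_const.add (continuousAt_const.mul h)) (hD 0 le_rfl).ne'
    have hmass := integral_comp_norm_of_hasDerivAt_flux (n := k + 2) (by omega)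
      (F := fun s => (c * S s) ^ (k + 1)) (g := g)
      (by simp [hS, Real.zero_rpow hb0.ne'])
      ((continuousAt_const.mul hS0).pow _).continuousWithinAt hflux
      (fun r hr => by simp only [hgdef]; positivity)
      (((tendsto_rpow_div_one_add hb0 hL0).const_mul c).pow (k + 1))
    refine hmass.trans ?_
    rw [hcn, hc, hb, show k + 2 - 1 = k + 1 by omega, hcast]
    simp only [mul_pow, div_pow, inv_pow, ← pow_mul]
    field_simp
    ring
end

section
/- Let n ≥ 2 be an integer, α ∈ ℝ, and let Ω ⊆ ℝⁿ be an open set containing the closed unit ball. Let u ∈ C¹(Ω \ {0}) be a weak solution of −Δₙu = |x|^{nα} e^{u} on Ω \ {0} with ∫_Ω |x|^{nα} e^{u} dx < ∞. Then there exists C > 0 such that u(x) ≤ C − n(α+1) log|x| for all x with 0 < |x| < 1. -/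
open MeasureTheory Metric Filter Topology Real Set
open scoped InnerProductSpace

/-- Strong monotonicity of the vector field `a ↦ ‖a‖ ^ (n - 2) • a`. -/
lemma norm_sub_pow_le_inner {E : Type*} [NormedAddCommGroup E] [InnerProductSpace ℝ E]
    {n : ℕ} (hn : 2 ≤ n) (a b : E) :
    ‖a - b‖ ^ n ≤ 2 ^ (n - 1) * (‖a‖ ^ (n - 2) * ⟪a, a - b⟫_ℝ - ‖b‖ ^ (n - 2) * ⟪b, a - b⟫_ℝ) := by
  obtain ⟨m, rfl⟩ := Nat.exists_eq_add_of_le hn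
  have e1 : 2 + m - 1 = m + 1 := by omega
  have e2 : 2 + m - 2 = m := by omega
  rw [e1, e2]
  have hpow : ‖a - b‖ ^ m ≤ 2 ^ m * (‖a‖ ^ m + ‖b‖ ^ m) := by
    have h1 : ‖a - b‖ ≤ 2 * max ‖a‖ ‖b‖ :=
      (norm_sub_le a b).trans (by linarith [le_max_left ‖a‖ ‖b‖, le_max_right ‖a‖ ‖b‖])
    calc ‖a - b‖ ^ m ≤ (2 * max ‖a‖ ‖b‖) ^ m := by gcongr
      _ = 2 ^ m * (max ‖a‖ ‖b‖) ^ m := mul_pow _ _ _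
      _ ≤ _ := by
        gcongr
        rcases max_cases ‖a‖ ‖b‖ with h | h <;> rw [h.1] <;>
          linarith [pow_nonneg (norm_nonneg a) m, pow_nonneg (norm_nonneg b) m]
  have hmono : 0 ≤ (‖a‖ ^ m - ‖b‖ ^ m) * (‖a‖ ^ 2 - ‖b‖ ^ 2) := by
    rcases le_total ‖a‖ ‖b‖ with h | h
    · exact mul_nonneg_of_nonpos_of_nonpos
        (sub_nonpos.2 (by gcongr)) (sub_nonpos.2 (by gcongr))
    · exact mul_nonneg (sub_nonneg.2 (by gcongr)) (sub_nonneg.2 (by gcongr))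
  have hsq : ‖a - b‖ ^ 2 = ‖a‖ ^ 2 - 2 * ⟪a, b⟫_ℝ + ‖b‖ ^ 2 := norm_sub_sq_real a b
  have ha : ⟪a, a - b⟫_ℝ = ‖a‖ ^ 2 - ⟪a, b⟫_ℝ := by
    rw [inner_sub_right, real_inner_self_eq_norm_sq]
  have hb : ⟪b, a - b⟫_ℝ = ⟪a, b⟫_ℝ - ‖b‖ ^ 2 := by
    rw [inner_sub_right, real_inner_self_eq_norm_sq, real_inner_comm]
  have key : (‖a‖ ^ m + ‖b‖ ^ m) * ‖a - b‖ ^ 2 ≤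
      2 * (‖a‖ ^ m * ⟪a, a - b⟫_ℝ - ‖b‖ ^ m * ⟪b, a - b⟫_ℝ) := by
    rw [ha, hb, hsq]; nlinarith
  calc ‖a - b‖ ^ (2 + m) = ‖a - b‖ ^ m * ‖a - b‖ ^ 2 := by rw [← pow_add, add_comm]
    _ ≤ 2 ^ m * (‖a‖ ^ m + ‖b‖ ^ m) * ‖a - b‖ ^ 2 := by gcongr
    _ = 2 ^ m * ((‖a‖ ^ m + ‖b‖ ^ m) * ‖a - b‖ ^ 2) := by ring
    _ ≤ 2 ^ m * (2 * (‖a‖ ^ m * ⟪a, a - b⟫_ℝ - ‖b‖ ^ m * ⟪b, a - b⟫_ℝ)) := by gcongr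
    _ = _ := by ring

/-- A function which is continuous on an open set and vanishes off a compact subset is continuous. -/
lemma ContinuousOn.continuous_of_eq_zero {X : Type*} [TopologicalSpace X] {U K : Set X}
    (hU : IsOpen U) (hK : IsClosed K) (hKU : K ⊆ U) {F : X → ℝ} (hF : ContinuousOn F U)
    (h0 : ∀ x ∉ K, F x = 0) : Continuous F := by
  rw [continuous_iff_continuousAt]
  intro x
  by_cases hx : x ∈ K
  · exact hF.continuousAt (hU.mem_nhds (hKU hx))
  · have : F =ᶠ[𝓝 x] fun _ => 0 := by
      filter_upwards [hK.isOpen_compl.mem_nhds hx] with y hy using h0 y hy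
    exact continuousAt_const.congr this.symm

lemma hasDerivAt_max_zero_sq (s : ℝ) :
    HasDerivAt (fun s : ℝ => max s 0 ^ 2) (2 * max s 0) s := by
  rcases lt_trichotomy s 0 with h | rfl | h
  · rw [max_eq_right h.le, mul_zero]
    refine (hasDerivAt_const s (0 : ℝ)).congr_of_eventuallyEq ?_
    filter_upwards [Iio_mem_nhds h] with y hy
    simp [max_eq_right (le_of_lt (mem_Iio.1 hy))]
  · rw [max_self, mul_zero, hasDerivAt_iff_isLittleO_nhds_zero]
    have : (fun h : ℝ => max (0 + h) 0 ^ 2 - max (0 : ℝ) 0 ^ 2 - h • 0) =O[𝓝 0] fun h => h ^ 2 := by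
      refine Asymptotics.IsBigO.of_bound 1 (Eventually.of_forall fun h => ?_)
      have h1 : max h 0 ^ 2 ≤ h ^ 2 := by
        rcases max_cases h 0 with h1 | h1 <;> rw [h1.1]
        simpa using sq_nonneg h
      simpa using h1
    exact this.trans_isLittleO (Asymptotics.isLittleO_pow_id (by norm_num))
  · rw [max_eq_left h.le]
    have h2 := hasDerivAt_pow 2 s
    simp only [Nat.cast_ofNat, Nat.add_one_sub_one, pow_one] at h2
    refine h2.congr_of_eventuallyEq ?_
    filter_upwards [Ioi_mem_nhds h] with y hy
    simp [max_eq_left (le_of_lt (mem_Ioi.1 hy))]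

lemma contDiff_max_zero_sq : ContDiff ℝ 1 (fun s : ℝ => max s 0 ^ 2) := by
  rw [contDiff_one_iff_deriv]
  refine ⟨fun s => (hasDerivAt_max_zero_sq s).differentiableAt, ?_⟩
  have : deriv (fun s : ℝ => max s 0 ^ 2) = fun s => 2 * max s 0 :=
    funext fun s => (hasDerivAt_max_zero_sq s).deriv
  rw [this]
  fun_prop

lemma max_sub_eq_zero {X : Type*} {K : Set X} {g : X → ℝ} {t : ℝ} (h0 : ∀ x ∉ K, g x < 0)
    (ht : 0 ≤ t) {x : X} (hx : x ∉ K) : max (g x - t) 0 = 0 :=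
  max_eq_right (by linarith [h0 x hx])

lemma hasCompactSupport_max_sub {X : Type*} [TopologicalSpace X] [R1Space X] {K : Set X}
    {g : X → ℝ} {t : ℝ} (hK : IsCompact K) (h0 : ∀ x ∉ K, g x < 0) (ht : 0 ≤ t) :
    HasCompactSupport fun x => max (g x - t) 0 :=
  HasCompactSupport.intro hK fun _ hx => max_sub_eq_zero h0 ht hx

section Truncation

variable {E : Type*} [NormedAddCommGroup E] [InnerProductSpace ℝ E]
  {U K : Set E} {g : E → ℝ} {t : ℝ}

lemma continuous_max_sub (hU : IsOpen U) (hK : IsClosed K) (hKU : K ⊆ U)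
    (hg : ContDiffOn ℝ 1 g U) (h0 : ∀ x ∉ K, g x < 0) (ht : 0 ≤ t) :
    Continuous fun x => max (g x - t) 0 :=
  ContinuousOn.continuous_of_eq_zero hU hK hKU
    ((hg.continuousOn.sub continuousOn_const).sup continuousOn_const)
    fun _ hx => max_sub_eq_zero h0 ht hx

lemma contDiff_max_sub_sq (hU : IsOpen U) (hK : IsClosed K) (hKU : K ⊆ U)
    (hg : ContDiffOn ℝ 1 g U) (h0 : ∀ x ∉ K, g x < 0) (ht : 0 ≤ t) :
    ContDiff ℝ 1 fun x => max (g x - t) 0 ^ 2 := by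
  rw [contDiff_iff_contDiffAt]
  intro x
  by_cases hx : x ∈ K
  · exact contDiff_max_zero_sq.contDiffAt.comp x
      ((hg.contDiffAt (hU.mem_nhds (hKU hx))).sub contDiffAt_const)
  · refine (contDiffAt_const (c := (0 : ℝ))).congr_of_eventuallyEq ?_
    filter_upwards [hK.isOpen_compl.mem_nhds hx] with y hy
    simp [max_sub_eq_zero h0 ht hy]

variable [CompleteSpace E]

lemma hasGradientAt_max_sub_sq (hU : IsOpen U) (hK : IsClosed K) (hKU : K ⊆ U)
    (hg : ContDiffOn ℝ 1 g U) (h0 : ∀ x ∉ K, g x < 0) (ht : 0 ≤ t) (x : E) :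
    HasGradientAt (fun x => max (g x - t) 0 ^ 2) ((2 * max (g x - t) 0) • gradient g x) x := by
  by_cases hx : x ∈ K
  · have h1 : HasGradientAt g (gradient g x) x :=
      ((hg.contDiffAt (hU.mem_nhds (hKU hx))).differentiableAt one_ne_zero).hasGradientAt
    rw [hasGradientAt_iff_hasFDerivAt] at h1 ⊢
    have h2 := (hasDerivAt_max_zero_sq (g x - t)).comp_hasFDerivAt x (h1.sub_const t)
    rw [map_smul]
    exact h2
  · rw [max_sub_eq_zero h0 ht hx, mul_zero, zero_smul]
    refine (hasGradientAt_const x (0 : ℝ)).congr_of_eventuallyEq ?_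
    filter_upwards [hK.isOpen_compl.mem_nhds hx] with y hy
    simp [max_sub_eq_zero h0 ht hy]

lemma ContDiffOn.continuousOn_gradient (hU : IsOpen U) (hg : ContDiffOn ℝ 1 g U) :
    ContinuousOn (gradient g) U :=
  (InnerProductSpace.toDual ℝ E).symm.continuous.comp_continuousOn
    (hg.continuousOn_fderiv_of_isOpen hU le_rfl)

end Truncation

/-- The Gagliardo-Nirenberg-Sobolev inequality for `p = 1`, in terms of Bochner integrals. -/
lemma exists_integral_rpow_le_integral_norm_gradient_rpow {n : ℕ} (hn : 2 ≤ n) :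
    ∃ C : ℝ, 0 ≤ C ∧ ∀ φ : EuclideanSpace ℝ (Fin n) → ℝ, ContDiff ℝ 1 φ → HasCompactSupport φ →
      (∀ x, 0 ≤ φ x) →
      ∫ x, φ x ^ ((n : ℝ).conjExponent) ≤ C * (∫ x, ‖gradient φ x‖) ^ ((n : ℝ).conjExponent) := by
  have hn1 : (1 : ℝ) < n := by exact_mod_cast hn
  have hp := Real.HolderConjugate.conjExponent hn1
  set p := (n : ℝ).conjExponent
  have hp' : Real.HolderConjugate (Module.finrank ℝ (EuclideanSpace ℝ (Fin n))) p := by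
    simpa using hp
  refine ⟨(lintegralPowLePowLIntegralFDerivConst
    (volume : Measure (EuclideanSpace ℝ (Fin n))) p : NNReal), NNReal.coe_nonneg _, ?_⟩
  intro φ hφ hc h0
  have hgi : Integrable fun x => ‖gradient φ x‖ := by
    have h1 : Continuous fun x => ‖fderiv ℝ φ x‖ := (hφ.continuous_fderiv one_ne_zero).norm
    have h2 : HasCompactSupport fun x => ‖fderiv ℝ φ x‖ := (hc.fderiv ℝ).norm
    simpa [gradient] using h1.integrable_of_hasCompactSupport h2
  have hφi : Integrable fun x => φ x ^ p := by
    refine Continuous.integrable_of_hasCompactSupport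
      (hφ.continuous.rpow_const fun _ => Or.inr hp.symm.nonneg) ?_
    exact hc.comp_left (g := fun s : ℝ => s ^ p) (Real.zero_rpow hp.symm.ne_zero)
  have key := lintegral_pow_le_pow_lintegral_fderiv
    (volume : Measure (EuclideanSpace ℝ (Fin n))) hφ hc hp'
  have e1 : ∫⁻ x, ‖φ x‖ₑ ^ p = ENNReal.ofReal (∫ x, φ x ^ p) := by
    rw [ofReal_integral_eq_lintegral_ofReal hφi
      (Eventually.of_forall fun x => Real.rpow_nonneg (h0 x) _)]
    congr 1 with x
    rw [Real.enorm_eq_ofReal (h0 x), ENNReal.ofReal_rpow_of_nonneg (h0 x) hp.symm.nonneg]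
  have e2 : ∫⁻ x, ‖fderiv ℝ φ x‖ₑ = ENNReal.ofReal (∫ x, ‖gradient φ x‖) := by
    rw [ofReal_integral_eq_lintegral_ofReal hgi (Eventually.of_forall fun x => norm_nonneg _)]
    congr 1 with x
    rw [← ofReal_norm]
    simp [gradient]
  have hI : 0 ≤ ∫ x, ‖gradient φ x‖ := integral_nonneg fun _ => norm_nonneg _
  rw [e1, e2, ENNReal.ofReal_rpow_of_nonneg hI hp.symm.nonneg, ← ENNReal.ofReal_coe_nnreal,
    ← ENNReal.ofReal_mul (NNReal.coe_nonneg _)] at key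
  exact (ENNReal.ofReal_le_ofReal_iff (by positivity)).1 key

/-- Sobolev's inequality for the truncations of `g`, weighted so that only `C¹` functions occur. -/
lemma exists_integral_max_sub_sq_pow_le {n : ℕ} (hn : 2 ≤ n) :
    ∃ C : ℝ, 0 ≤ C ∧ ∀ (U K : Set (EuclideanSpace ℝ (Fin n))) (g : EuclideanSpace ℝ (Fin n) → ℝ),
      IsOpen U → IsCompact K → K ⊆ U → ContDiffOn ℝ 1 g U → (∀ x ∉ K, g x < 0) → ∀ t : ℝ, 0 ≤ t →
      (∫ x, max (g x - t) 0 ^ 2) ^ n ≤ C * (∫ x, max (g x - t) 0 * ‖gradient g x‖ ^ n) *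
        (∫ x, max (g x - t) 0) ^ (n - 1) * volume.real {x | 0 < max (g x - t) 0} := by
  obtain ⟨C, hC, hS⟩ := exists_integral_rpow_le_integral_norm_gradient_rpow hn
  have hn1 : (1 : ℝ) < n := by exact_mod_cast hn
  have hn0 : (n : ℝ) ≠ 0 := by positivity
  have hp := Real.HolderConjugate.conjExponent hn1
  set p := (n : ℝ).conjExponent
  have hp0 : p ≠ 0 := hp.symm.ne_zero
  have hpp : 0 < p := hp.symm.pos
  refine ⟨C ^ ((n : ℝ) - 1) * 2 ^ n, by positivity, ?_⟩
  intro U K g hU hK hKU hg h0 t ht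
  have hGc := continuous_max_sub hU hK.isClosed hKU hg h0 ht
  have hGs := hasCompactSupport_max_sub hK h0 ht
  have hφ := contDiff_max_sub_sq hU hK.isClosed hKU hg h0 ht
  have hφs : HasCompactSupport fun x => max (g x - t) 0 ^ 2 :=
    hGs.comp_left (g := fun s : ℝ => s ^ 2) (by simp)
  have hgrad : ∀ x, gradient (fun x => max (g x - t) 0 ^ 2) x =
      (2 * max (g x - t) 0) • gradient g x := fun x =>
    (hasGradientAt_max_sub_sq hU hK.isClosed hKU hg h0 ht x).gradient
  have hG0 : ∀ x, 0 ≤ max (g x - t) 0 := fun x => le_max_right _ _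
  have hGK : ∀ x ∉ K, max (g x - t) 0 = 0 := fun x hx => max_sub_eq_zero h0 ht hx
  set G : EuclideanSpace ℝ (Fin n) → ℝ := fun x => max (g x - t) 0
  change (∫ x, G x ^ 2) ^ n ≤ C ^ ((n : ℝ) - 1) * 2 ^ n * (∫ x, G x * ‖gradient g x‖ ^ n) *
        (∫ x, G x) ^ (n - 1) * volume.real {x | 0 < G x}
  have hG0 : ∀ x, 0 ≤ G x := hG0
  have hGK : ∀ x ∉ K, G x = 0 := hGK
  set A := {x | 0 < G x}
  have hA : MeasurableSet A := measurableSet_lt measurable_const hGc.measurable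
  have hAK : A ⊆ K := fun x hx => by
    by_contra h
    exact (ne_of_gt hx) (hGK x h)
  have hAfin : volume A ≠ ⊤ := ((measure_mono hAK).trans_lt hK.measure_lt_top).ne
  have hX0 : 0 ≤ ∫ x, G x * ‖gradient g x‖ ^ n :=
    integral_nonneg fun x => mul_nonneg (hG0 x) (by positivity)
  have hY0 : 0 ≤ ∫ x, G x := integral_nonneg hG0
  -- Sobolev's inequality for `G ^ 2`
  have S1 : ∫ x, (G x ^ 2) ^ p ≤ C * (2 * ∫ x, G x * ‖gradient g x‖) ^ p := by
    refine (hS _ hφ hφs fun x => by positivity).trans (le_of_eq ?_)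
    congr 2
    rw [← integral_const_mul]
    congr 1 with x
    rw [hgrad, norm_smul, Real.norm_of_nonneg (mul_nonneg zero_le_two (hG0 x)), mul_assoc]
  -- Hölder's inequality for the gradient
  have S2 : ∫ x, G x * ‖gradient g x‖ ≤
      (∫ x, G x * ‖gradient g x‖ ^ n) ^ (1 / (n : ℝ)) * (∫ x, G x) ^ (1 / p) := by
    have c1 : Continuous fun x => G x ^ (1 / (n : ℝ)) * ‖gradient g x‖ := by
      refine ContinuousOn.continuous_of_eq_zero hU hK.isClosed hKU ?_ fun x hx => ?_
      · exact (hGc.rpow_const fun _ => Or.inr (by positivity)).continuousOn.mul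
          (hg.continuousOn_gradient hU).norm
      · rw [hGK x hx, Real.zero_rpow (by positivity), zero_mul]
    have c2 : Continuous fun x => G x ^ (1 / p) :=
      hGc.rpow_const fun _ => Or.inr (by positivity)
    have s1 : HasCompactSupport fun x => G x ^ (1 / (n : ℝ)) * ‖gradient g x‖ :=
      HasCompactSupport.intro hK fun x hx => by
        rw [hGK x hx, Real.zero_rpow (by positivity), zero_mul]
    have s2 : HasCompactSupport fun x => G x ^ (1 / p) :=
      HasCompactSupport.intro hK fun x hx => by rw [hGK x hx, Real.zero_rpow (by positivity)]
    have hH := integral_mul_le_Lp_mul_Lq_of_nonneg (μ := volume) hp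
      (Eventually.of_forall fun x => mul_nonneg (Real.rpow_nonneg (hG0 x) _) (norm_nonneg _))
      (Eventually.of_forall fun x => Real.rpow_nonneg (hG0 x) _)
      (c1.memLp_of_hasCompactSupport s1) (c2.memLp_of_hasCompactSupport s2)
    convert hH using 1
    · congr 1 with x
      rw [mul_right_comm, ← Real.rpow_add_of_nonneg (hG0 x) (by positivity) (by positivity)]
      have : 1 / (n : ℝ) + 1 / p = 1 := by simpa [one_div] using hp.inv_add_inv_eq_one
      rw [this, Real.rpow_one]
    · congr 2
      · congr 1 with x
        rw [Real.mul_rpow (Real.rpow_nonneg (hG0 x) _) (norm_nonneg _), ← Real.rpow_mul (hG0 x),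
          one_div_mul_cancel hn0, Real.rpow_one, Real.rpow_natCast]
      · congr 1 with x
        rw [← Real.rpow_mul (hG0 x), one_div_mul_cancel hp0, Real.rpow_one]
  -- Hölder's inequality on the superlevel set
  have S3 : ∫ x, G x ^ 2 ≤
      (∫ x, (G x ^ 2) ^ p) ^ (1 / p) * volume.real A ^ (1 / (n : ℝ)) := by
    have hH := integral_mul_le_Lp_mul_Lq_of_nonneg (μ := volume) hp.symm
      (f := fun x => G x ^ 2) (g := A.indicator fun _ => (1 : ℝ))
      (Eventually.of_forall fun x => sq_nonneg _)
      (Eventually.of_forall fun x => indicator_nonneg (fun _ _ => zero_le_one) _)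
      (hφ.continuous.memLp_of_hasCompactSupport hφs)
      (memLp_indicator_const _ hA _ (Or.inr hAfin))
    convert hH using 1
    · congr 1 with x
      by_cases hx : x ∈ A
      · simp [hx]
      · have : G x = 0 := le_antisymm (not_lt.1 hx) (hG0 x)
        simp [this]
    · congr 2
      have : (fun x => A.indicator (fun _ => (1 : ℝ)) x ^ (n : ℝ)) =
          A.indicator fun _ => (1 : ℝ) := by
        ext x
        by_cases hx : x ∈ A <;> simp [hx, Real.zero_rpow hn0]
      rw [this, integral_indicator_const _ hA]
      simp
  set X := ∫ x, G x * ‖gradient g x‖ ^ n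
  set Y := ∫ x, G x
  set V := volume.real A
  have hV0 : 0 ≤ V := measureReal_nonneg
  have hZ0 : 0 ≤ ∫ x, G x * ‖gradient g x‖ :=
    integral_nonneg fun x => mul_nonneg (hG0 x) (norm_nonneg _)
  have hW0 : 0 ≤ ∫ x, (G x ^ 2) ^ p := integral_nonneg fun x => by positivity
  have hnp : 1 / p * n = (n : ℝ) - 1 := by
    have := hp.sub_one_mul_conj
    field_simp
    linarith
  have S : ∫ x, G x ^ 2 ≤
      C ^ (1 / p) * (2 * (X ^ (1 / (n : ℝ)) * Y ^ (1 / p))) * V ^ (1 / (n : ℝ)) := by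
    refine S3.trans ?_
    gcongr
    calc (∫ x, (G x ^ 2) ^ p) ^ (1 / p) ≤ (C * (2 * ∫ x, G x * ‖gradient g x‖) ^ p) ^ (1 / p) := by
          gcongr
      _ = C ^ (1 / p) * (2 * ∫ x, G x * ‖gradient g x‖) := by
          rw [Real.mul_rpow hC (by positivity), ← Real.rpow_mul (by positivity),
            mul_one_div_cancel hp0, Real.rpow_one]
      _ ≤ _ := by gcongr
  have hroot : ∀ a : ℝ, 0 ≤ a → (a ^ (1 / (n : ℝ))) ^ n = a := fun a ha => by
    rw [← Real.rpow_natCast, ← Real.rpow_mul ha, one_div_mul_cancel hn0, Real.rpow_one]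
  have hroot' : ∀ a : ℝ, 0 ≤ a → (a ^ (1 / p)) ^ n = a ^ ((n : ℝ) - 1) := fun a ha => by
    rw [← Real.rpow_natCast, ← Real.rpow_mul ha, hnp]
  have hYn : Y ^ ((n : ℝ) - 1) = Y ^ (n - 1) := by
    rw [← Real.rpow_natCast, Nat.cast_sub (by omega), Nat.cast_one]
  calc (∫ x, G x ^ 2) ^ n
      ≤ (C ^ (1 / p) * (2 * (X ^ (1 / (n : ℝ)) * Y ^ (1 / p))) * V ^ (1 / (n : ℝ))) ^ n :=
        pow_le_pow_left₀ (integral_nonneg fun x => by positivity) S n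
    _ = C ^ ((n : ℝ) - 1) * 2 ^ n * X * Y ^ (n - 1) * V := by
        simp only [mul_pow]
        rw [hroot X hX0, hroot V hV0, hroot' C hC, hroot' Y hY0, hYn]
        ring

/-- De Giorgi's iteration. -/
lemma eq_zero_of_iterate_le {n : ℕ} (hn : n ≠ 0) {a : ℝ → ℝ} {B : ℝ} (hB : 0 ≤ B)
    (ha : ∀ t, 0 ≤ a t) (hanti : Antitone a)
    (hstep : ∀ t δ : ℝ, 0 ≤ t → 0 < δ → a (t + δ) ^ n * δ ^ (n + 1) ≤ B * a t ^ (n + 1))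
    (hsmall : B * a 0 * (2 ^ (n + 1)) ^ (n + 2) ≤ 1) : a (1 / 2) = 0 := by
  set q : ℝ := 2 ^ (n + 1) with hq
  have hq1 : 1 < q := one_lt_pow₀ one_lt_two (by omega)
  have hq0 : 0 < q := by positivity
  have claim : ∀ k : ℕ, a (1 / 2 - (1 / 2) ^ (k + 1)) * q ^ k ≤ a 0 := by
    intro k
    induction k with
    | zero => norm_num
    | succ k ih =>
      have ht : (0 : ℝ) ≤ 1 / 2 - (1 / 2) ^ (k + 1) := by
        have : (1 / 2 : ℝ) ^ (k + 1) ≤ (1 / 2) ^ 1 :=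
          pow_le_pow_of_le_one (by norm_num) (by norm_num) (by omega)
        linarith
      have h := hstep _ ((1 / 2) ^ (k + 2)) ht (by positivity)
      have e : (1 / 2 : ℝ) - (1 / 2) ^ (k + 1) + (1 / 2) ^ (k + 2) =
          1 / 2 - (1 / 2) ^ (k + 1 + 1) := by ring
      rw [e] at h
      set b := a (1 / 2 - (1 / 2) ^ (k + 1 + 1))
      set c := a (1 / 2 - (1 / 2) ^ (k + 1))
      have hc : 0 ≤ c := ha _
      have hb : 0 ≤ b := ha _
      have hδ : ((1 / 2 : ℝ) ^ (k + 2)) ^ (n + 1) * q ^ (k + 2) = 1 := by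
        rw [hq, ← pow_mul, ← pow_mul, mul_comm (k + 2), ← mul_pow]
        norm_num
      refine le_of_pow_le_pow_left₀ hn (ha 0) ?_
      calc (b * q ^ (k + 1)) ^ n
          = (b ^ n * ((1 / 2 : ℝ) ^ (k + 2)) ^ (n + 1)) * q ^ (k + 2) * (q ^ (k + 1)) ^ n := by
            rw [mul_assoc (b ^ n), hδ, mul_one, mul_pow]
        _ ≤ (B * c ^ (n + 1)) * q ^ (k + 2) * (q ^ (k + 1)) ^ n := by gcongr
        _ = B * (c * q ^ k) ^ (n + 1) * q ^ (n + 2) := by ring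
        _ ≤ B * a 0 ^ (n + 1) * q ^ (n + 2) := by gcongr
        _ = (B * a 0 * q ^ (n + 2)) * a 0 ^ n := by ring
        _ ≤ 1 * a 0 ^ n := by gcongr; exact pow_nonneg (ha 0) n
        _ = a 0 ^ n := one_mul _
  have hle : ∀ k : ℕ, a (1 / 2) ≤ a 0 * (1 / q) ^ k := by
    intro k
    have h1 : a (1 / 2) ≤ a (1 / 2 - (1 / 2) ^ (k + 1)) :=
      hanti (by linarith [show (0 : ℝ) < (1 / 2) ^ (k + 1) by positivity])
    rw [one_div_pow, mul_one_div, le_div_iff₀ (by positivity)]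
    exact (mul_le_mul_of_nonneg_right h1 (by positivity)).trans (claim k)
  have hlim : Tendsto (fun k : ℕ => a 0 * (1 / q) ^ k) atTop (𝓝 (a 0 * 0)) :=
    (tendsto_pow_atTop_nhds_zero_of_lt_one (by positivity)
      ((div_lt_one hq0).2 hq1)).const_mul _
  rw [mul_zero] at hlim
  exact le_antisymm (ge_of_tendsto' hlim hle) (ha _)

/-- Functions whose truncations satisfy a Caccioppoli inequality are bounded by `1 / 2` if they are
small in `L²`. -/
lemma exists_forall_le_half_of_caccioppoli {n : ℕ} (hn : 2 ≤ n) :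
    ∃ θ : ℝ, 0 < θ ∧ ∀ (U K : Set (EuclideanSpace ℝ (Fin n))) (g : EuclideanSpace ℝ (Fin n) → ℝ)
      (κ : ℝ), IsOpen U → IsCompact K → K ⊆ U → ContDiffOn ℝ 1 g U → (∀ x ∉ K, g x < 0) →
      0 ≤ κ →
      (∀ t : ℝ, 0 ≤ t → ∫ x, max (g x - t) 0 * ‖gradient g x‖ ^ n ≤
        κ * ∫ x, max (g x - t) 0 ^ 2) →
      κ * ∫ x, max (g x) 0 ^ 2 ≤ θ → ∀ x, g x ≤ 1 / 2 := by
  obtain ⟨C, hC, hS⟩ := exists_integral_max_sub_sq_pow_le hn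
  set Q : ℝ := (2 ^ (n + 1)) ^ (n + 2)
  have hQ : 0 < Q := by positivity
  refine ⟨1 / ((C + 1) * Q), by positivity, ?_⟩
  intro U K g κ hU hK hKU hg h0 hκ hE hsmall
  have hc : ∀ t : ℝ, 0 ≤ t → Continuous fun x => max (g x - t) 0 := fun t ht =>
    continuous_max_sub hU hK.isClosed hKU hg h0 ht
  have hs : ∀ t : ℝ, 0 ≤ t → HasCompactSupport fun x => max (g x - t) 0 := fun t ht =>
    hasCompactSupport_max_sub hK h0 ht
  have hi1 : ∀ t : ℝ, 0 ≤ t → Integrable fun x => max (g x - t) 0 := fun t ht =>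
    (hc t ht).integrable_of_hasCompactSupport (hs t ht)
  have hs2 : ∀ t : ℝ, 0 ≤ t → HasCompactSupport fun x => max (g x - t) 0 ^ 2 := fun t ht =>
    (hs t ht).comp_left (g := fun s : ℝ => s ^ 2) (by simp)
  have hi2 : ∀ t : ℝ, 0 ≤ t → Integrable fun x => max (g x - t) 0 ^ 2 := fun t ht =>
    ((hc t ht).pow 2).integrable_of_hasCompactSupport (hs2 t ht)
  set a : ℝ → ℝ := fun t => ∫ x, max (g x - max t 0) 0 ^ 2 with ha
  have haeq : ∀ t : ℝ, 0 ≤ t → a t = ∫ x, max (g x - t) 0 ^ 2 := fun t ht => by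
    simp only [ha, max_eq_left ht]
  have ha0 : ∀ t, 0 ≤ a t := fun t => integral_nonneg fun x => sq_nonneg _
  have hanti : Antitone a := by
    intro s t hst
    refine integral_mono (hi2 _ (le_max_right _ _)) (hi2 _ (le_max_right _ _)) fun x => ?_
    have : max s 0 ≤ max t 0 := max_le_max_right 0 hst
    dsimp only
    gcongr
  have hstep : ∀ t δ : ℝ, 0 ≤ t → 0 < δ →
      a (t + δ) ^ n * δ ^ (n + 1) ≤ (C * κ) * a t ^ (n + 1) := by
    intro t δ ht hδ
    have htδ : 0 ≤ t + δ := by positivity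
    have hab : a (t + δ) ≤ a t := hanti (by linarith)
    have h1 := hS U K g hU hK hKU hg h0 (t + δ) htδ
    have h2 := hE (t + δ) htδ
    rw [← haeq _ htδ] at h1 h2
    have h3 : δ * ∫ x, max (g x - (t + δ)) 0 ≤ a t := by
      rw [haeq t ht, ← integral_const_mul]
      refine integral_mono ((hi1 _ htδ).const_mul _) (hi2 t ht) fun x => ?_
      dsimp only
      rcases le_total (g x - (t + δ)) 0 with h | h
      · rw [max_eq_right h, mul_zero]; positivity
      · rw [max_eq_left h, max_eq_left (by linarith)]
        nlinarith
    have h4 : δ ^ 2 * volume.real {x | 0 < max (g x - (t + δ)) 0} ≤ a t := by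
      rw [haeq t ht]
      refine le_trans ?_ (mul_meas_ge_le_integral_of_nonneg
        (Eventually.of_forall fun x => sq_nonneg _) (hi2 t ht) (δ ^ 2))
      refine mul_le_mul_of_nonneg_left (measureReal_mono ?_ ?_) (by positivity)
      · intro x hx
        have hx' : t + δ < g x := by simpa using hx
        show δ ^ 2 ≤ max (g x - t) 0 ^ 2
        rw [max_eq_left (by linarith)]
        gcongr
        linarith
      · exact ((hi2 t ht).measure_ge_lt_top (by positivity)).ne
    set V := volume.real {x | 0 < max (g x - (t + δ)) 0}
    set Y := ∫ x, max (g x - (t + δ)) 0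
    have hV : 0 ≤ V := measureReal_nonneg
    have hY : 0 ≤ Y := integral_nonneg fun x => le_max_right _ _
    obtain ⟨m, rfl⟩ := Nat.exists_eq_add_of_le' (show 1 ≤ n by omega)
    simp only [Nat.add_sub_cancel] at h1
    calc a (t + δ) ^ (m + 1) * δ ^ (m + 1 + 1)
        ≤ (C * (∫ x, max (g x - (t + δ)) 0 * ‖gradient g x‖ ^ (m + 1)) * Y ^ m * V) *
            δ ^ (m + 1 + 1) := by gcongr
      _ ≤ (C * (κ * a t) * Y ^ m * V) * δ ^ (m + 1 + 1) := by
          gcongr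
          exact h2.trans (by gcongr)
      _ = C * (κ * a t) * (δ * Y) ^ m * (δ ^ 2 * V) := by ring
      _ ≤ C * (κ * a t) * a t ^ m * a t := by
          have := ha0 t
          gcongr
      _ = C * κ * a t ^ (m + 1 + 1) := by ring
  have hzero : a (1 / 2) = 0 := by
    refine eq_zero_of_iterate_le (by omega) (mul_nonneg hC hκ) ha0 hanti hstep ?_
    have e : a 0 = ∫ x, max (g x) 0 ^ 2 := by rw [haeq 0 le_rfl]; simp
    rw [← e, le_div_iff₀ (by positivity)] at hsmall
    have : 0 ≤ κ * a 0 * Q := mul_nonneg (mul_nonneg hκ (ha0 0)) hQ.le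
    calc C * κ * a 0 * Q = C * (κ * a 0 * Q) := by ring
      _ ≤ (C + 1) * (κ * a 0 * Q) := by gcongr; linarith
      _ = κ * a 0 * ((C + 1) * Q) := by ring
      _ ≤ 1 := hsmall
  intro x
  by_contra! hx
  have hpos := ((hc (1 / 2) (by norm_num)).pow 2).integral_pos_of_hasCompactSupport_nonneg_nonzero
    (μ := volume) (hs2 (1 / 2) (by norm_num)) (fun x => sq_nonneg _) (x := x)
    (pow_ne_zero 2 (ne_of_gt (lt_max_of_lt_left (by linarith))))
  rw [haeq _ (by norm_num)] at hzero
  exact hpos.ne' hzero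

/-- The divergence of `x ↦ x - x₀` is `n`, in weak form. -/
lemma integral_inner_sub_gradient {n : ℕ} (x₀ : EuclideanSpace ℝ (Fin n))
    {φ : EuclideanSpace ℝ (Fin n) → ℝ} (hφ : ContDiff ℝ 1 φ) (hc : HasCompactSupport φ) :
    ∫ x, ⟪x - x₀, gradient φ x⟫_ℝ = -(n : ℝ) * ∫ x, φ x := by
  have hder : Continuous (fderiv ℝ φ) := hφ.continuous_fderiv one_ne_zero
  let e : Fin n → EuclideanSpace ℝ (Fin n) := fun i => EuclideanSpace.single i 1
  have hf : ∀ (i : Fin n) (x : EuclideanSpace ℝ (Fin n)),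
      HasFDerivAt (fun x : EuclideanSpace ℝ (Fin n) => x i - x₀ i)
        (EuclideanSpace.proj i : EuclideanSpace ℝ (Fin n) →L[ℝ] ℝ) x := fun i x =>
    (EuclideanSpace.proj i : EuclideanSpace ℝ (Fin n) →L[ℝ] ℝ).hasFDerivAt.sub_const _
  have hi1 : ∀ i, Integrable fun x => (x i - x₀ i) * fderiv ℝ φ x (e i) := fun i =>
    Continuous.integrable_of_hasCompactSupport (by fun_prop)
      ((hc.fderiv_apply ℝ (e i)).mul_left)
  have hi2 : ∀ i, Integrable fun x : EuclideanSpace ℝ (Fin n) => (x i - x₀ i) * φ x := fun i =>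
    Continuous.integrable_of_hasCompactSupport
      (by have := hφ.continuous; fun_prop) hc.mul_left
  have hφi : Integrable φ := hφ.continuous.integrable_of_hasCompactSupport hc
  have hone : ∀ (i : Fin n) (x : EuclideanSpace ℝ (Fin n)),
      fderiv ℝ (fun x : EuclideanSpace ℝ (Fin n) => x i - x₀ i) x (e i) = 1 := fun i x => by
    rw [(hf i x).fderiv]; simp [e]
  have hparts : ∀ i, ∫ x, (x i - x₀ i) * fderiv ℝ φ x (e i) = -∫ x, φ x := by
    intro i
    rw [integral_mul_fderiv_eq_neg_fderiv_mul_of_integrable (by simpa [hone] using hφi) (hi1 i)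
      (hi2 i) (fun x _ => (hf i x).differentiableAt)
      (fun x _ => (hφ.differentiable one_ne_zero).differentiableAt)]
    simp [hone]
  have hsum : ∀ x, ⟪x - x₀, gradient φ x⟫_ℝ = ∑ i, (x i - x₀ i) * fderiv ℝ φ x (e i) := by
    intro x
    have hz : x - x₀ = ∑ i, (x i - x₀ i) • e i := by
      have := (EuclideanSpace.basisFun (Fin n) ℝ).sum_repr (x - x₀)
      simpa [e] using this.symm
    rw [real_inner_comm, inner_gradient_left]
    conv_lhs => rw [hz]
    simp
  simp_rw [hsum]
  rw [integral_finsetSum _ fun i _ => hi1 i]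
  simp [hparts]

lemma hasGradientAt_const_mul_norm_sub_rpow {E : Type*} [NormedAddCommGroup E]
    [InnerProductSpace ℝ E] [CompleteSpace E] {p : ℝ} (hp : 1 < p) (k : ℝ) (x₀ x : E) :
    HasGradientAt (fun x => k * ‖x - x₀‖ ^ p) ((k * p * ‖x - x₀‖ ^ (p - 2)) • (x - x₀)) x := by
  rw [hasGradientAt_iff_hasFDerivAt]
  have h := ((hasFDerivAt_norm_rpow (x - x₀) hp).comp x
    ((hasFDerivAt_id x).sub_const x₀)).const_mul k
  refine h.congr_fderiv ?_
  ext v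
  simp
  ring

/-- The function `k ‖x‖ ^ (n / (n - 1))` has a linear `n`-Laplacian flux. -/
lemma norm_pow_mul_inner_of_conjExponent {E : Type*} [NormedAddCommGroup E] [InnerProductSpace ℝ E]
    {n : ℕ} (hn : 2 ≤ n) {k : ℝ} (hk : 0 ≤ k) (z w : E) :
    ‖(k * (n : ℝ).conjExponent * ‖z‖ ^ ((n : ℝ).conjExponent - 2)) • z‖ ^ (n - 2) *
      ⟪(k * (n : ℝ).conjExponent * ‖z‖ ^ ((n : ℝ).conjExponent - 2)) • z, w⟫_ℝ =
      (k * (n : ℝ).conjExponent) ^ (n - 1) * ⟪z, w⟫_ℝ := by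
  have hn1 : (1 : ℝ) < n := by exact_mod_cast hn
  have hp := Real.HolderConjugate.conjExponent hn1
  have hmul := hp.sub_one_mul_conj
  set p := (n : ℝ).conjExponent
  have hpp : 0 < p := hp.symm.pos
  obtain ⟨m, rfl⟩ := Nat.exists_eq_add_of_le' hn
  rcases eq_or_ne z 0 with rfl | hz
  · simp
  have hr : 0 < ‖z‖ := norm_pos_iff.2 hz
  have e1 : m + 2 - 2 = m := by omega
  have e2 : m + 2 - 1 = m + 1 := by omega
  rw [e1, e2, norm_smul, Real.norm_of_nonneg (by positivity), real_inner_smul_left]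
  have e3 : ‖z‖ ^ (p - 2) * ‖z‖ = ‖z‖ ^ (p - 1) := by
    rw [← Real.rpow_add_one hr.ne']; ring_nf
  have e4 : (‖z‖ ^ (p - 1)) ^ m * ‖z‖ ^ (p - 2) = 1 := by
    rw [← Real.rpow_natCast, ← Real.rpow_mul hr.le, ← Real.rpow_add hr]
    have : (p - 1) * m + (p - 2) = 0 := by
      push_cast at hmul; linarith
    rw [this, Real.rpow_zero]
  calc (k * p * ‖z‖ ^ (p - 2) * ‖z‖) ^ m * (k * p * ‖z‖ ^ (p - 2) * ⟪z, w⟫_ℝ)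
      = (k * p) ^ (m + 1) * ((‖z‖ ^ (p - 2) * ‖z‖) ^ m * ‖z‖ ^ (p - 2)) * ⟪z, w⟫_ℝ := by ring
    _ = (k * p) ^ (m + 1) * ⟪z, w⟫_ℝ := by rw [e3, e4, mul_one]

/-- Caccioppoli inequality for the difference `g` of a weak solution and the barrier
`k ‖x - x₀‖ ^ (n / (n - 1))`. -/
lemma IsWeakNSol.caccioppoli {n : ℕ} (hn : 2 ≤ n) {U V K : Set (EuclideanSpace ℝ (Fin n))}
    {u f g : EuclideanSpace ℝ (Fin n) → ℝ} {x₀ : EuclideanSpace ℝ (Fin n)} {k L t : ℝ}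
    (hsol : IsWeakNSol n U u f) (hV : IsOpen V) (hK : IsCompact K) (hKV : K ⊆ V) (hVU : V ⊆ U)
    (hu : ContDiffOn ℝ 1 u V) (hf : ContinuousOn f V) (hg : ContDiffOn ℝ 1 g V)
    (h0 : ∀ x ∉ K, g x < 0) (hk : 0 ≤ k) (hfL : ∀ x ∈ K, f x ≤ L)
    (hgrad : ∀ x ∈ K, gradient g x = gradient u x -
      (k * (n : ℝ).conjExponent * ‖x - x₀‖ ^ ((n : ℝ).conjExponent - 2)) • (x - x₀))
    (ht : 0 ≤ t) :
    ∫ x, max (g x - t) 0 * ‖gradient g x‖ ^ n ≤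
      (2 ^ (n - 1) * (L + n * (k * (n : ℝ).conjExponent) ^ (n - 1))) *
        ∫ x, max (g x - t) 0 ^ 2 := by
  have hGc := continuous_max_sub hV hK.isClosed hKV hg h0 ht
  have hGs := hasCompactSupport_max_sub hK h0 ht
  have hφ := contDiff_max_sub_sq hV hK.isClosed hKV hg h0 ht
  have hφs : HasCompactSupport fun x => max (g x - t) 0 ^ 2 :=
    hGs.comp_left (g := fun s : ℝ => s ^ 2) (by simp)
  have hgradφ : ∀ x, gradient (fun x => max (g x - t) 0 ^ 2) x =
      (2 * max (g x - t) 0) • gradient g x := fun x =>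
    (hasGradientAt_max_sub_sq hV hK.isClosed hKV hg h0 ht x).gradient
  have hG0 : ∀ x, 0 ≤ max (g x - t) 0 := fun x => le_max_right _ _
  have hGK : ∀ x ∉ K, max (g x - t) 0 = 0 := fun x hx => max_sub_eq_zero h0 ht hx
  set G : EuclideanSpace ℝ (Fin n) → ℝ := fun x => max (g x - t) 0
  change ∫ x, G x * ‖gradient g x‖ ^ n ≤ _ * ∫ x, G x ^ 2
  change ContDiff ℝ 1 fun x => G x ^ 2 at hφ
  change HasCompactSupport fun x => G x ^ 2 at hφs
  change ∀ x, gradient (fun x => G x ^ 2) x = (2 * G x) • gradient g x at hgradφ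
  change ∀ x, 0 ≤ G x at hG0
  change ∀ x ∉ K, G x = 0 at hGK
  set φ : EuclideanSpace ℝ (Fin n) → ℝ := fun x => G x ^ 2 with hφdef
  set c : ℝ := (k * (n : ℝ).conjExponent) ^ (n - 1)
  have hgφK : ∀ x ∉ K, gradient φ x = 0 := fun x hx => by rw [hgradφ, hGK x hx]; simp
  have hφK : ∀ x ∉ K, φ x = 0 := fun x hx => by simp [hφdef, hGK x hx]
  have integrable_of : ∀ F : EuclideanSpace ℝ (Fin n) → ℝ, ContinuousOn F V → (∀ x ∉ K, F x = 0) →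
      Integrable F := fun F hF hF0 =>
    (hF.continuous_of_eq_zero hV hK.isClosed hKV hF0).integrable_of_hasCompactSupport
      (HasCompactSupport.intro hK hF0)
  have hgφc : ContinuousOn (gradient φ) V := hφ.contDiffOn.continuousOn_gradient hV
  have hguc : ContinuousOn (gradient u) V := hu.continuousOn_gradient hV
  have hggc : ContinuousOn (gradient g) V := hg.continuousOn_gradient hV
  have I1 : Integrable fun x => G x * ‖gradient g x‖ ^ n :=
    integrable_of _ (hGc.continuousOn.mul (hggc.norm.pow n)) fun x hx => by simp [hGK x hx]
  have I2 : Integrable fun x => ‖gradient u x‖ ^ (n - 2) * ⟪gradient u x, gradient φ x⟫_ℝ :=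
    integrable_of _ ((hguc.norm.pow _).mul (hguc.inner hgφc)) fun x hx => by simp [hgφK x hx]
  have I3 : Integrable fun x => ⟪x - x₀, gradient φ x⟫_ℝ :=
    integrable_of _ ((continuousOn_id.sub continuousOn_const).inner hgφc)
      fun x hx => by simp [hgφK x hx]
  have I4 : Integrable fun x => f x * φ x :=
    integrable_of _ (hf.mul hφ.continuous.continuousOn) fun x hx => by simp [hφK x hx]
  have I5 : Integrable φ := integrable_of _ hφ.continuous.continuousOn hφK
  have hpt : ∀ x, 2 * (G x * ‖gradient g x‖ ^ n) ≤
      2 ^ (n - 1) * (‖gradient u x‖ ^ (n - 2) * ⟪gradient u x, gradient φ x⟫_ℝ -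
        c * ⟪x - x₀, gradient φ x⟫_ℝ) := by
    intro x
    by_cases hx : x ∈ K
    · have h := norm_sub_pow_le_inner hn (gradient u x)
        ((k * (n : ℝ).conjExponent * ‖x - x₀‖ ^ ((n : ℝ).conjExponent - 2)) • (x - x₀))
      rw [norm_pow_mul_inner_of_conjExponent hn hk, ← hgrad x hx] at h
      have h' := mul_le_mul_of_nonneg_left h (mul_nonneg zero_le_two (hG0 x))
      rw [hgradφ, real_inner_smul_right, real_inner_smul_right]
      linarith
    · rw [hGK x hx, hgφK x hx]; simp
  have hmain := integral_mono (I1.const_mul 2) ((I2.sub (I3.const_mul c)).const_mul (2 ^ (n - 1)))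
    hpt
  have htsupp : tsupport φ ⊆ U :=
    (closure_minimal (fun x hx => by by_contra h; exact hx (hφK x h)) hK.isClosed).trans
      (hKV.trans hVU)
  have hweak := hsol φ hφ hφs htsupp
  rw [setIntegral_eq_integral_of_forall_compl_eq_zero fun x hx => by
      simp [hgφK x fun h => hx (hVU (hKV h))],
    setIntegral_eq_integral_of_forall_compl_eq_zero fun x hx => by
      simp [hφK x fun h => hx (hVU (hKV h))]] at hweak
  have hfle : ∫ x, f x * φ x ≤ L * ∫ x, φ x := by
    rw [← integral_const_mul]
    refine integral_mono I4 (I5.const_mul L) fun x => ?_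
    dsimp only
    by_cases hx : x ∈ K
    · exact mul_le_mul_of_nonneg_right (hfL x hx) (sq_nonneg _)
    · simp [hφK x hx]
  simp only [Pi.sub_apply] at hmain
  rw [integral_const_mul, integral_const_mul, integral_sub I2 (I3.const_mul c),
    integral_const_mul, hweak, integral_inner_sub_gradient x₀ hφ hφs] at hmain
  have hpos : 0 ≤ ∫ x, G x * ‖gradient g x‖ ^ n :=
    integral_nonneg fun x => mul_nonneg (hG0 x) (by positivity)
  have : (2 : ℝ) ^ (n - 1) * ((∫ x, f x * φ x) - c * (-(n : ℝ) * ∫ x, φ x)) ≤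
      2 ^ (n - 1) * (L * (∫ x, φ x) - c * (-(n : ℝ) * ∫ x, φ x)) := by gcongr
  linarith

lemma conjExponent_natCast_le_two {n : ℕ} (hn : 2 ≤ n) : (n : ℝ).conjExponent ≤ 2 := by
  have hn2 : (2 : ℝ) ≤ n := by exact_mod_cast hn
  rw [Real.conjExponent, div_le_iff₀ (by linarith)]
  linarith

/-- `ε`-regularity: on a ball where `u` does not exceed its value at the centre by much, and where
the right-hand side is not too small, the mass of `exp u` is bounded below. -/
lemma exists_le_mul_setIntegral_exp {n : ℕ} (hn : 2 ≤ n) :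
    ∃ ε : ℝ, 0 < ε ∧ ∀ (U : Set (EuclideanSpace ℝ (Fin n))) (u f : EuclideanSpace ℝ (Fin n) → ℝ)
      (x₀ : EuclideanSpace ℝ (Fin n)) (σ L : ℝ), IsWeakNSol n U u f → 0 < σ →
      closedBall x₀ σ ⊆ U → ContDiffOn ℝ 1 u U → ContinuousOn f U →
      (∀ x ∈ closedBall x₀ σ, f x ≤ L) → (∀ x ∈ closedBall x₀ σ, u x ≤ u x₀ + n) →
      1 ≤ L * σ ^ n → ε ≤ L * ∫ x in ball x₀ σ, Real.exp (u x - u x₀) := by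
  obtain ⟨θ, hθ, hG⟩ := exists_forall_le_half_of_caccioppoli hn
  have hn1 : (1 : ℝ) < n := by exact_mod_cast hn
  have hp := Real.HolderConjugate.conjExponent hn1
  have hp2 := conjExponent_natCast_le_two hn
  set p := (n : ℝ).conjExponent with hpdef
  have hpp : 0 < p := hp.symm.pos
  set D : ℝ := 2 ^ (n - 1) * (1 + n * (4 * (n + 2) * p) ^ (n - 1)) with hD
  have hDpos : 0 < D := by positivity
  refine ⟨θ / (4 * D), by positivity, ?_⟩
  intro U u f x₀ σ L hsol hσ hσU hu hf hfL huM hL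
  have hLpos : 0 < L := by
    by_contra! h
    have : L * σ ^ n ≤ 0 := mul_nonpos_of_nonpos_of_nonneg h (by positivity)
    linarith
  set I := ∫ x in ball x₀ σ, Real.exp (u x - u x₀)
  set k : ℝ := 4 * (n + 2) * σ ^ (-p) with hk
  have hkpos : 0 < k := by positivity
  have hkc : (k * p) ^ (n - 1) = (4 * (n + 2) * p) ^ (n - 1) * (σ ^ n)⁻¹ := by
    have : (σ ^ (-p)) ^ (n - 1) = (σ ^ n)⁻¹ := by
      rw [← Real.rpow_natCast, ← Real.rpow_mul hσ.le, Nat.cast_sub (by omega), Nat.cast_one,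
        ← Real.rpow_natCast, ← Real.rpow_neg hσ.le]
      congr 1
      linarith [hp.sub_one_mul_conj]
    rw [← this, hk, ← mul_pow]
    ring
  have hbarrier : ∀ x, σ / 2 ≤ ‖x - x₀‖ → (n : ℝ) + 2 ≤ k * ‖x - x₀‖ ^ p := by
    intro x hx
    have h1 : σ ^ (-p) * (σ / 2) ^ p = (1 / 2) ^ p := by
      rw [Real.rpow_neg hσ.le, show σ / 2 = σ * (1 / 2) by ring,
        Real.mul_rpow hσ.le (by norm_num), inv_mul_cancel_left₀ (by positivity)]
    have h2 : (1 / 2 : ℝ) ^ (2 : ℝ) ≤ (1 / 2) ^ p :=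
      Real.rpow_le_rpow_of_exponent_ge (by norm_num) (by norm_num) hp2
    have h3 : (1 / 2 : ℝ) ^ (2 : ℝ) = 1 / 4 := by norm_num
    calc (n : ℝ) + 2 = 4 * (n + 2) * (1 / 4) := by ring
      _ ≤ 4 * (n + 2) * (1 / 2) ^ p := by rw [← h3]; gcongr
      _ = k * (σ / 2) ^ p := by rw [← h1, hk]; ring
      _ ≤ k * ‖x - x₀‖ ^ p := by gcongr
  classical
  set w : EuclideanSpace ℝ (Fin n) → ℝ := fun x => u x - (u x₀ + k * ‖x - x₀‖ ^ p - 1) with hw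
  set g : EuclideanSpace ℝ (Fin n) → ℝ := (ball x₀ σ).piecewise w fun _ => -1 with hg
  have hgw : EqOn g w (ball x₀ σ) := piecewise_eqOn _ _ _
  have huV : ContDiffOn ℝ 1 u (ball x₀ σ) := hu.mono (ball_subset_closedBall.trans hσU)
  have hgV : ContDiffOn ℝ 1 g (ball x₀ σ) := by
    refine ContDiffOn.congr ?_ hgw
    refine huV.sub (ContDiff.contDiffOn ?_)
    exact (contDiff_const.add (contDiff_const.mul
      ((contDiff_id.sub contDiff_const).norm_rpow hp.symm.lt))).sub contDiff_const
  have h0 : ∀ x ∉ closedBall x₀ (σ / 2), g x < 0 := by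
    intro x hx
    by_cases hxb : x ∈ ball x₀ σ
    · rw [hgw hxb]
      have h1 := hbarrier x (by
        rw [mem_closedBall, dist_eq_norm] at hx; linarith)
      have h2 := huM x (ball_subset_closedBall hxb)
      simp only [hw]; linarith
    · rw [hg, piecewise_eq_of_notMem _ _ _ hxb]; norm_num
  have hKV : closedBall x₀ (σ / 2) ⊆ ball x₀ σ := closedBall_subset_ball (by linarith)
  have hgrad : ∀ x ∈ closedBall x₀ (σ / 2), gradient g x = gradient u x -
      (k * p * ‖x - x₀‖ ^ (p - 2)) • (x - x₀) := by
    intro x hx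
    have hn := isOpen_ball.mem_nhds (hKV hx)
    have h1 : HasGradientAt u (gradient u x) x :=
      ((huV.contDiffAt hn).differentiableAt one_ne_zero).hasGradientAt
    have h2 := hasGradientAt_const_mul_norm_sub_rpow hp.symm.lt k x₀ x
    have h3 : HasGradientAt w (gradient u x - (k * p * ‖x - x₀‖ ^ (p - 2)) • (x - x₀)) x := by
      rw [hasGradientAt_iff_hasFDerivAt] at h1 h2 ⊢
      rw [map_sub]
      exact h1.sub ((h2.const_add (u x₀)).sub_const 1)
    exact (h3.congr_of_eventuallyEq (hgw.eventuallyEq_of_mem hn)).gradient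
  have hE : ∀ t : ℝ, 0 ≤ t → ∫ x, max (g x - t) 0 * ‖gradient g x‖ ^ n ≤
      (2 ^ (n - 1) * (L + n * (k * p) ^ (n - 1))) * ∫ x, max (g x - t) 0 ^ 2 := fun t ht =>
    hsol.caccioppoli hn isOpen_ball (isCompact_closedBall _ _) hKV
      (ball_subset_closedBall.trans hσU) huV (hf.mono (ball_subset_closedBall.trans hσU)) hgV h0
      hkpos.le (fun x hx => hfL x (ball_subset_closedBall (hKV hx))) hgrad ht
  set κ : ℝ := 2 ^ (n - 1) * (L + n * (k * p) ^ (n - 1)) with hκ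
  have hκD : κ ≤ D * L := by
    have : (σ ^ n)⁻¹ ≤ L := by
      rw [inv_eq_one_div, div_le_iff₀ (by positivity)]; exact hL
    calc κ = 2 ^ (n - 1) * (L + n * ((4 * (n + 2) * p) ^ (n - 1) * (σ ^ n)⁻¹)) := by rw [hκ, hkc]
      _ ≤ 2 ^ (n - 1) * (L + n * ((4 * (n + 2) * p) ^ (n - 1) * L)) := by gcongr
      _ = D * L := by rw [hD]; ring
  have hκ0 : 0 ≤ κ := by positivity
  have hmass : ∫ x, max (g x) 0 ^ 2 ≤ 4 * I := by
    have hzero : ∀ x ∉ ball x₀ σ, max (g x) 0 ^ 2 = 0 := fun x hx => by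
      rw [hg, piecewise_eq_of_notMem _ _ _ hx]; norm_num
    rw [← setIntegral_eq_integral_of_forall_compl_eq_zero hzero, ← integral_const_mul]
    have hexp : IntegrableOn (fun x => 4 * Real.exp (u x - u x₀)) (ball x₀ σ) := by
      refine IntegrableOn.mono_set ?_ ball_subset_closedBall
      refine ContinuousOn.integrableOn_compact (isCompact_closedBall _ _) ?_
      exact continuousOn_const.mul (Real.continuous_exp.comp_continuousOn
        ((hu.continuousOn.mono hσU).sub continuousOn_const))
    refine integral_mono_of_nonneg (Eventually.of_forall fun x => sq_nonneg _) hexp ?_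
    refine (ae_restrict_iff' measurableSet_ball).2 (Eventually.of_forall fun x hx => ?_)
    dsimp only
    have hgx : g x ≤ u x - u x₀ + 1 := by
      rw [hgw hx]
      have : 0 ≤ k * ‖x - x₀‖ ^ p := by positivity
      simp only [hw]; linarith
    have hle : max (g x) 0 ≤ 2 * Real.exp ((u x - u x₀) / 2) := by
      refine max_le ?_ (by positivity)
      linarith [Real.add_one_le_exp ((u x - u x₀) / 2)]
    calc max (g x) 0 ^ 2 ≤ (2 * Real.exp ((u x - u x₀) / 2)) ^ 2 := by gcongr
      _ = 4 * Real.exp (u x - u x₀) := by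
        rw [mul_pow, ← Real.exp_nat_mul]; push_cast; ring_nf
  by_contra! hlt
  have hI0 : 0 ≤ I := integral_nonneg fun x => (Real.exp_pos _).le
  have hsmall : κ * ∫ x, max (g x) 0 ^ 2 ≤ θ := by
    calc κ * ∫ x, max (g x) 0 ^ 2 ≤ (D * L) * (4 * I) := by gcongr
      _ = (L * I) * (4 * D) := by ring
      _ ≤ θ / (4 * D) * (4 * D) := by gcongr
      _ = θ := by field_simp
  have hfin := hG _ _ g κ isOpen_ball (isCompact_closedBall x₀ (σ / 2)) hKV hgV h0 hκ0 hE hsmall x₀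
  rw [hgw (mem_ball_self hσ)] at hfin
  simp only [hw, sub_self, norm_zero, Real.zero_rpow hpp.ne'] at hfin
  linarith

lemma rpow_le_two_rpow_abs_mul {a r : ℝ} (ha : 0 < a) (hr : 0 < r) (har : a ≤ 2 * r)
    (hra : r ≤ 2 * a) (s : ℝ) : r ^ s ≤ 2 ^ |s| * a ^ s := by
  rcases le_total 0 s with hs | hs
  · rw [abs_of_nonneg hs, ← Real.mul_rpow zero_le_two ha.le]
    gcongr
  · rw [abs_of_nonpos hs]
    calc r ^ s ≤ (2⁻¹ * a) ^ s :=
          Real.rpow_le_rpow_of_nonpos (by positivity) (by linarith) hs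
      _ = 2 ^ (-s) * a ^ s := by
          rw [Real.mul_rpow (by norm_num) ha.le, Real.inv_rpow zero_le_two, Real.rpow_neg zero_le_two]

/-- The bound at a point `y` around which the total mass is small, by choosing a suitable nearby
almost-maximum point of `u`. -/
lemma exists_mul_exp_le_of_setIntegral_lt {n : ℕ} (hn : 2 ≤ n) (s : ℝ) :
    ∃ ε : ℝ, 0 < ε ∧ ∀ (U : Set (EuclideanSpace ℝ (Fin n))) (u : EuclideanSpace ℝ (Fin n) → ℝ)
      (y : EuclideanSpace ℝ (Fin n)), (0 : EuclideanSpace ℝ (Fin n)) ∉ U → ContDiffOn ℝ 1 u U →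
      IsWeakNSol n U u (fun x => ‖x‖ ^ s * Real.exp (u x)) → y ≠ 0 →
      closedBall y (‖y‖ / 2) ⊆ U →
      ∫ x in closedBall y (‖y‖ / 2), ‖x‖ ^ s * Real.exp (u x) < ε →
      ‖y‖ ^ s * ‖y‖ ^ n * Real.exp (u y) ≤ 4 ^ n := by
  obtain ⟨ε, hε, hloc⟩ := exists_le_mul_setIntegral_exp hn
  set b : ℝ := 2 ^ |s| with hb
  have hb1 : 1 ≤ b := Real.one_le_rpow one_le_two (abs_nonneg s)
  have hb0 : 0 < b := by positivity
  have hen : 0 < Real.exp n := Real.exp_pos _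
  refine ⟨ε / (b ^ 2 * Real.exp n), by positivity, ?_⟩
  intro U u y h0U hu hsol hy hyU hsmall
  have hy0 : 0 < ‖y‖ := norm_pos_iff.2 hy
  set R := ‖y‖ / 2 with hR
  have hR0 : 0 < R := by positivity
  set f : EuclideanSpace ℝ (Fin n) → ℝ := fun x => ‖x‖ ^ s * Real.exp (u x) with hf
  have hfU : ContinuousOn f U := by
    refine ContinuousOn.mul ?_ (Real.continuous_exp.comp_continuousOn hu.continuousOn)
    refine continuous_norm.continuousOn.rpow_const fun x hx => Or.inl ?_
    exact norm_ne_zero_iff.2 fun h => h0U (h ▸ hx)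
  have hf0 : ∀ x, 0 ≤ f x := fun x => by positivity
  have hcomp : ∀ x ∈ closedBall y R, ‖y‖ ≤ 2 * ‖x‖ ∧ ‖x‖ ≤ 2 * ‖y‖ ∧ 0 < ‖x‖ := by
    intro x hx
    rw [mem_closedBall, dist_eq_norm] at hx
    have h1 := norm_sub_norm_le y x
    have h2 := norm_sub_norm_le x y
    rw [norm_sub_rev] at h1
    refine ⟨by linarith, by linarith, by linarith⟩
  obtain ⟨x₀, hx₀, hmax⟩ := (isCompact_closedBall y R).exists_isMaxOn
    (nonempty_closedBall.2 hR0.le) (f := fun x => Real.exp (u x) * (R - dist x y) ^ n)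
    (ContinuousOn.mul (Real.continuous_exp.comp_continuousOn (hu.continuousOn.mono hyU))
      (by fun_prop))
  have hmax : ∀ x ∈ closedBall y R, Real.exp (u x) * (R - dist x y) ^ n ≤
      Real.exp (u x₀) * (R - dist x₀ y) ^ n := hmax
  set m := R - dist x₀ y with hm
  have hm0 : 0 < m := by
    have h1 := hmax y (mem_closedBall_self hR0.le)
    rw [dist_self, sub_zero] at h1
    have h2 : 0 ≤ m := sub_nonneg.2 hx₀
    refine lt_of_le_of_ne h2 fun h => ?_
    rw [← h, zero_pow (by omega), mul_zero] at h1
    exact absurd h1 (not_le.2 (by positivity))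
  have hsub : closedBall x₀ (m / 2) ⊆ closedBall y R :=
    closedBall_subset_closedBall' (by linarith)
  have huM : ∀ x ∈ closedBall x₀ (m / 2), u x ≤ u x₀ + n := by
    intro x hx
    have h1 := hmax x (hsub hx)
    have h2 : m / 2 ≤ R - dist x y := by
      have := dist_triangle x x₀ y
      rw [mem_closedBall] at hx
      linarith
    have h3 : Real.exp (u x) * (m / 2) ^ n ≤ Real.exp (u x₀) * 2 ^ n * (m / 2) ^ n := by
      calc Real.exp (u x) * (m / 2) ^ n ≤ Real.exp (u x) * (R - dist x y) ^ n := by gcongr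
        _ ≤ Real.exp (u x₀) * m ^ n := h1
        _ = _ := by rw [mul_assoc, ← mul_pow]; ring_nf
    have h4 := le_of_mul_le_mul_right h3 (by positivity)
    have h5 : (2 : ℝ) ^ n ≤ Real.exp n := by
      rw [← Real.exp_one_pow]
      gcongr
      linarith [Real.add_one_le_exp (1 : ℝ)]
    rw [← Real.exp_le_exp, Real.exp_add]
    exact h4.trans (by gcongr)
  set L : ℝ := b * ‖y‖ ^ s * (Real.exp (u x₀) * Real.exp n) with hL
  have hL0 : 0 < L := by positivity
  have hfL : ∀ x ∈ closedBall x₀ (m / 2), f x ≤ L := by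
    intro x hx
    obtain ⟨h1, h2, h3⟩ := hcomp x (hsub hx)
    have h4 := rpow_le_two_rpow_abs_mul hy0 h3 h1 h2 s
    have h5 : Real.exp (u x) ≤ Real.exp (u x₀) * Real.exp n := by
      rw [← Real.exp_add]; exact Real.exp_le_exp.2 (huM x hx)
    simp only [hf, hL]
    gcongr
  have hLm : L * (m / 2) ^ n < 1 := by
    by_contra! hge
    have h1 := hloc U u f x₀ (m / 2) L hsol (by positivity) (hsub.trans hyU) hu hfU hfL huM hge
    have hint : IntegrableOn f (closedBall y R) :=
      (hfU.mono hyU).integrableOn_compact (isCompact_closedBall _ _)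
    have h2 : L * ∫ x in ball x₀ (m / 2), Real.exp (u x - u x₀) ≤
        b ^ 2 * Real.exp n * ∫ x in ball x₀ (m / 2), f x := by
      rw [← integral_const_mul, ← integral_const_mul]
      have hss : ball x₀ (m / 2) ⊆ closedBall y R := ball_subset_closedBall.trans hsub
      refine integral_mono_of_nonneg (Eventually.of_forall fun x => by positivity)
        ((hint.mono_set hss).const_mul _) ?_
      refine (ae_restrict_iff' measurableSet_ball).2 (Eventually.of_forall fun x hx => ?_)
      obtain ⟨h1, h2, h3⟩ := hcomp x (hss hx)
      have h4 := rpow_le_two_rpow_abs_mul h3 hy0 h2 h1 s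
      dsimp only [hf, hL]
      calc b * ‖y‖ ^ s * (Real.exp (u x₀) * Real.exp n) * Real.exp (u x - u x₀)
          = b * ‖y‖ ^ s * Real.exp n * Real.exp (u x) := by
            rw [Real.exp_sub]; field_simp
        _ ≤ b * (b * ‖x‖ ^ s) * Real.exp n * Real.exp (u x) := by gcongr
        _ = _ := by ring
    have h3 : ∫ x in ball x₀ (m / 2), f x ≤ ∫ x in closedBall y R, f x :=
      setIntegral_mono_set hint (Eventually.of_forall hf0)
        (ball_subset_closedBall.trans hsub).eventuallyLE
    rw [lt_div_iff₀ (by positivity)] at hsmall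
    have h4 : b ^ 2 * Real.exp n * ∫ x in ball x₀ (m / 2), f x ≤
        b ^ 2 * Real.exp n * ∫ x in closedBall y R, f x := by gcongr
    linarith
  have hyle := hmax y (mem_closedBall_self hR0.le)
  rw [dist_self, sub_zero] at hyle
  have hen1 : 1 ≤ Real.exp n := Real.one_le_exp (by positivity)
  calc ‖y‖ ^ s * ‖y‖ ^ n * Real.exp (u y)
      = ‖y‖ ^ s * 2 ^ n * (Real.exp (u y) * R ^ n) := by
        rw [hR, div_pow]; field_simp
    _ ≤ ‖y‖ ^ s * 2 ^ n * (Real.exp (u x₀) * m ^ n) := by gcongr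
    _ = 4 ^ n * (1 * ‖y‖ ^ s * (Real.exp (u x₀) * 1) * (m / 2) ^ n) := by
        rw [show (4 : ℝ) = 2 * 2 by norm_num, mul_pow, div_pow]; field_simp
    _ ≤ 4 ^ n * (L * (m / 2) ^ n) := by rw [hL]; gcongr
    _ ≤ 4 ^ n * 1 := by gcongr
    _ = 4 ^ n := mul_one _

/-- The mass of an integrable function on small balls tends to zero. -/
lemma exists_setIntegral_closedBall_lt {E : Type*} [NormedAddCommGroup E] [MeasurableSpace E]
    [OpensMeasurableSpace E] {μ : Measure E} [NullSingletonClass μ] {f : E → ℝ} {x₀ : E}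
    (hf : IntegrableOn f (closedBall x₀ 1) μ) {ε : ℝ} (hε : 0 < ε) :
    ∃ r : ℝ, 0 < r ∧ r ≤ 1 ∧ ∫ x in closedBall x₀ r, f x ∂μ < ε := by
  have hlim := tendsto_setIntegral_of_antitone (μ := μ) (f := f)
    (s := fun k : ℕ => closedBall x₀ (1 / ((k : ℝ) + 1))) (fun k => measurableSet_closedBall)
    (fun i j hij => closedBall_subset_closedBall (by gcongr)) ⟨0, by simpa using hf⟩
  have hinter : ⋂ k : ℕ, closedBall x₀ (1 / ((k : ℝ) + 1)) = {x₀} := by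
    refine Subset.antisymm (fun x hx => ?_) ?_
    · have h1 : dist x x₀ ≤ 0 := ge_of_tendsto' tendsto_one_div_add_atTop_nhds_zero_nat
        fun k => mem_closedBall.1 (mem_iInter.1 hx k)
      exact dist_le_zero.1 h1
    · rintro x rfl
      exact mem_iInter.2 fun k => mem_closedBall_self (by positivity)
  rw [hinter, setIntegral_measure_zero _ (measure_singleton x₀)] at hlim
  obtain ⟨k, hk⟩ := (hlim.eventually (gt_mem_nhds hε)).exists
  exact ⟨1 / ((k : ℝ) + 1), by positivity,
    (div_le_one (by positivity)).2 (by linarith [k.cast_nonneg (α := ℝ)]), hk⟩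

theorem upper_bound_near_singularity
    (n : ℕ) (hn : 2 ≤ n) (α : ℝ)
    (Ω : Set (EuclideanSpace ℝ (Fin n))) (hΩ : IsOpen Ω)
    (hball : closedBall (0 : EuclideanSpace ℝ (Fin n)) 1 ⊆ Ω)
    (u : EuclideanSpace ℝ (Fin n) → ℝ)
    (hu : ContDiffOn ℝ 1 u (Ω \ {0}))
    (hsol : IsWeakNSol n (Ω \ {0}) u (fun x => ‖x‖ ^ ((n : ℝ) * α) * Real.exp (u x)))
    (hint : IntegrableOn (fun x => ‖x‖ ^ ((n : ℝ) * α) * Real.exp (u x)) Ω) :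
    ∃ C : ℝ, 0 < C ∧
      ∀ x : EuclideanSpace ℝ (Fin n), 0 < ‖x‖ → ‖x‖ < 1 →
        u x ≤ C - (n : ℝ) * (α + 1) * Real.log ‖x‖ := by
  obtain ⟨ε, hε, hpoint⟩ := exists_mul_exp_le_of_setIntegral_lt hn ((n : ℝ) * α)
  have hnt : Nontrivial (EuclideanSpace ℝ (Fin n)) := by
    have : Nonempty (Fin n) := ⟨⟨0, by omega⟩⟩
    infer_instance
  obtain ⟨r, hr0, hr1, hr⟩ := exists_setIntegral_closedBall_lt (hint.mono_set hball) hε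
  -- near the origin
  have hnear : ∀ y : EuclideanSpace ℝ (Fin n), 0 < ‖y‖ → ‖y‖ ≤ r / 2 →
      u y + (n : ℝ) * (α + 1) * Real.log ‖y‖ ≤ n * Real.log 4 := by
    intro y hy hyr
    have hsub : closedBall y (‖y‖ / 2) ⊆ closedBall 0 r :=
      closedBall_subset_closedBall' (by rw [dist_zero_right]; linarith)
    have hsub1 : closedBall (0 : EuclideanSpace ℝ (Fin n)) r ⊆ Ω :=
      (closedBall_subset_closedBall hr1).trans hball
    have hU : closedBall y (‖y‖ / 2) ⊆ Ω \ {0} := by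
      refine fun x hx => ⟨hsub1 (hsub hx), ?_⟩
      rintro rfl
      rw [mem_closedBall, dist_zero_left] at hx
      linarith
    have h := hpoint (Ω \ {0}) u y (fun h => h.2 rfl) hu hsol (norm_pos_iff.1 hy) hU
      ((setIntegral_mono_set (hint.mono_set hsub1) (Eventually.of_forall fun x => by positivity)
        hsub.eventuallyLE).trans_lt hr)
    have hlog := Real.log_le_log (by positivity) h
    rw [Real.log_mul (by positivity) (by positivity), Real.log_mul (by positivity) (by positivity),
      Real.log_rpow hy, Real.log_pow, Real.log_pow, Real.log_exp] at hlog
    linarith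
  -- away from the origin
  have hcompact : IsCompact (closedBall (0 : EuclideanSpace ℝ (Fin n)) 1 \ ball 0 (r / 2)) :=
    (isCompact_closedBall _ _).diff isOpen_ball
  have hne : ∀ x ∈ closedBall (0 : EuclideanSpace ℝ (Fin n)) 1 \ ball 0 (r / 2), x ≠ 0 := by
    rintro x hx rfl
    exact hx.2 (mem_ball_self (by positivity))
  have hcont : ContinuousOn (fun x => u x + (n : ℝ) * (α + 1) * Real.log ‖x‖)
      (closedBall (0 : EuclideanSpace ℝ (Fin n)) 1 \ ball 0 (r / 2)) := by
    refine (hu.continuousOn.mono fun x hx => ⟨hball hx.1, hne x hx⟩).add ?_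
    exact continuousOn_const.mul
      (continuous_norm.continuousOn.log fun x hx => norm_ne_zero_iff.2 (hne x hx))
  obtain ⟨B, hB⟩ := hcompact.bddAbove_image hcont
  refine ⟨max (n * Real.log 4) B + 1, ?_, fun x hx0 hx1 => ?_⟩
  · have : 0 ≤ (n : ℝ) * Real.log 4 := mul_nonneg n.cast_nonneg (Real.log_nonneg (by norm_num))
    linarith [le_max_left ((n : ℝ) * Real.log 4) B]
  · rcases le_or_gt ‖x‖ (r / 2) with h | h
    · linarith [hnear x hx0 h, le_max_left ((n : ℝ) * Real.log 4) B]
    · have hx : x ∈ closedBall (0 : EuclideanSpace ℝ (Fin n)) 1 \ ball 0 (r / 2) :=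
        ⟨by simpa using hx1.le, by simpa using h.le⟩
      linarith [hB (mem_image_of_mem _ hx), le_max_right ((n : ℝ) * Real.log 4) B]
end

section
/- Let n ≥ 2 be an integer, α ∈ ℝ, and let Ω ⊆ ℝⁿ be an open set with 0 ∈ Ω. Let u ∈ C¹(Ω \ {0}) be a weak solution of −Δₙu = |x|^{nα} e^{u} on Ω \ {0} with ∫_Ω |x|^{nα} e^{u} dx < ∞. Then for every real q with 1 ≤ q < n and every compact set K ⊆ Ω, ∫_K (|u(x)|^q + |∇u(x)|^q) dx < ∞. -/
open MeasureTheory Metric Filter Topology Real Set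
open scoped InnerProductSpace

section Cutoff

lemma exists_abs_deriv_smoothTransition_le :
    ∃ C : ℝ, 0 < C ∧ ∀ t, |deriv Real.smoothTransition t| ≤ C := by
  have hc : Continuous (deriv Real.smoothTransition) :=
    (Real.smoothTransition.contDiff (n := 1)).continuous_deriv (by norm_num)
  obtain ⟨C, hC⟩ := (isCompact_Icc (a := (0 : ℝ)) (b := 1)).exists_bound_of_continuousOn
    hc.continuousOn
  refine ⟨max C 1, by positivity, fun t => ?_⟩
  rcases le_or_gt t 0 with h0 | h0
  · have : IsLocalMin Real.smoothTransition t := by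
      refine Filter.Eventually.of_forall fun s => ?_
      rw [Real.smoothTransition.zero_of_nonpos h0]
      exact Real.smoothTransition.nonneg s
    rw [this.deriv_eq_zero]
    simp
  rcases le_or_gt 1 t with h1 | h1
  · have : IsLocalMax Real.smoothTransition t := by
      refine Filter.Eventually.of_forall fun s => ?_
      rw [Real.smoothTransition.one_of_one_le h1]
      exact Real.smoothTransition.le_one s
    rw [this.deriv_eq_zero]
    simp
  · exact (hC t ⟨h0.le, h1.le⟩).trans (le_max_left _ _)

variable {E : Type*} [NormedAddCommGroup E]

/-- A logarithmic cutoff: it vanishes for `‖x‖ ≤ exp (-3L)` and equals `1` for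
`exp (-L) ≤ ‖x‖`. -/
noncomputable def logCutoff (L : ℝ) (x : E) : ℝ :=
  Real.smoothTransition (2 + Real.log (‖x‖ ^ 2 + Real.exp (-6 * L)) / (2 * L))

lemma logCutoff_nonneg (L : ℝ) (x : E) : 0 ≤ logCutoff L x := Real.smoothTransition.nonneg _

lemma logCutoff_le_one (L : ℝ) (x : E) : logCutoff L x ≤ 1 := Real.smoothTransition.le_one _

lemma logCutoff_eq_one {L : ℝ} (hL : 1 ≤ L) {x : E} (hx : Real.exp (-L) ≤ ‖x‖) :
    logCutoff L x = 1 := by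
  apply Real.smoothTransition.one_of_one_le
  have h1 : Real.exp (-2 * L) ≤ ‖x‖ ^ 2 + Real.exp (-6 * L) := by
    have : Real.exp (-2 * L) = Real.exp (-L) ^ 2 := by
      rw [← Real.exp_nat_mul]; congr 1; push_cast; ring
    rw [this]
    have := pow_le_pow_left₀ (Real.exp_pos _).le hx 2
    linarith [Real.exp_pos (-6 * L)]
  have h2 : -2 * L ≤ Real.log (‖x‖ ^ 2 + Real.exp (-6 * L)) := by
    rw [Real.le_log_iff_exp_le (by positivity)]; exact h1
  have : -1 ≤ Real.log (‖x‖ ^ 2 + Real.exp (-6 * L)) / (2 * L) := by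
    rw [le_div_iff₀ (by linarith)]; linarith
  linarith

lemma logCutoff_eq_zero {L : ℝ} (hL : 1 ≤ L) {x : E} (hx : ‖x‖ ≤ Real.exp (-3 * L)) :
    logCutoff L x = 0 := by
  apply Real.smoothTransition.zero_of_nonpos
  have h1 : ‖x‖ ^ 2 + Real.exp (-6 * L) ≤ Real.exp (-4 * L) := by
    have e1 : Real.exp (-6 * L) = Real.exp (-3 * L) ^ 2 := by
      rw [← Real.exp_nat_mul]; congr 1; push_cast; ring
    have e2 : Real.exp (-6 * L) = Real.exp (-4 * L) * Real.exp (-2 * L) := by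
      rw [← Real.exp_add]; congr 1; ring
    have e3 : Real.exp (-2 * L) ≤ 1 / 2 := by
      have h3 : 2 ≤ Real.exp (2 * L) := by linarith [Real.add_one_le_exp (2 * L)]
      rw [neg_mul, Real.exp_neg, one_div]
      exact inv_anti₀ (by norm_num) h3
    have := pow_le_pow_left₀ (norm_nonneg _) hx 2
    nlinarith [Real.exp_pos (-4 * L)]
  have h2 : Real.log (‖x‖ ^ 2 + Real.exp (-6 * L)) ≤ -4 * L := by
    rw [Real.log_le_iff_le_exp (by positivity)]; exact h1
  have : Real.log (‖x‖ ^ 2 + Real.exp (-6 * L)) / (2 * L) ≤ -2 := by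
    rw [div_le_iff₀ (by linarith)]; linarith
  linarith

lemma zero_notMem_tsupport_logCutoff {L : ℝ} (hL : 1 ≤ L) :
    (0 : E) ∉ tsupport (logCutoff L : E → ℝ) := by
  rw [notMem_tsupport_iff_eventuallyEq]
  filter_upwards [Metric.closedBall_mem_nhds (0 : E) (Real.exp_pos (-3 * L))] with x hx
  exact logCutoff_eq_zero hL (by simpa using hx)

variable [InnerProductSpace ℝ E]

lemma contDiff_logCutoff (L : ℝ) : ContDiff ℝ 1 (logCutoff L : E → ℝ) := by
  unfold logCutoff
  refine Real.smoothTransition.contDiff.comp ?_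
  refine contDiff_const.add (ContDiff.div_const ?_ _)
  refine ContDiff.log ((contDiff_norm_sq ℝ).add contDiff_const) fun x => ?_
  positivity

lemma fderiv_logCutoff_eq_zero {L : ℝ} (hL : 1 ≤ L) {x : E}
    (hx : ‖x‖ ≤ Real.exp (-3 * L) ∨ Real.exp (-L) ≤ ‖x‖) :
    fderiv ℝ (logCutoff L : E → ℝ) x = 0 := by
  rcases hx with hx | hx
  · have : IsLocalMin (logCutoff L : E → ℝ) x := by
      refine Filter.Eventually.of_forall fun s => ?_
      rw [logCutoff_eq_zero hL hx]
      exact logCutoff_nonneg L s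
    exact this.fderiv_eq_zero
  · have : IsLocalMax (logCutoff L : E → ℝ) x := by
      refine Filter.Eventually.of_forall fun s => ?_
      rw [logCutoff_eq_one hL hx]
      exact logCutoff_le_one L s
    exact this.fderiv_eq_zero

lemma exists_norm_fderiv_logCutoff_le :
    ∃ C : ℝ, 0 < C ∧ ∀ L : ℝ, 1 ≤ L → ∀ x : E,
      ‖fderiv ℝ (logCutoff L : E → ℝ) x‖ ≤ C / (L * ‖x‖) := by
  obtain ⟨C, hC0, hC⟩ := exists_abs_deriv_smoothTransition_le
  refine ⟨C, hC0, fun L hL x => ?_⟩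
  rcases eq_or_ne x 0 with rfl | hx
  · rw [fderiv_logCutoff_eq_zero hL (Or.inl (by simpa using (Real.exp_pos _).le))]
    simp
  have hx' : 0 < ‖x‖ := norm_pos_iff.2 hx
  set P := ‖x‖ ^ 2 + Real.exp (-6 * L)
  have hPpos : 0 < P := by positivity
  have h1 : HasFDerivAt (fun y : E => ‖y‖ ^ 2 + Real.exp (-6 * L)) (2 • innerSL ℝ x) x :=
    (hasStrictFDerivAt_norm_sq x).hasFDerivAt.add_const _
  have h2 : HasFDerivAt (fun y : E => 2 + Real.log (‖y‖ ^ 2 + Real.exp (-6 * L)) / (2 * L))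
      ((2 * L)⁻¹ • P⁻¹ • (2 • innerSL ℝ x)) x := by
    have := ((h1.log hPpos.ne').mul_const ((2 * L)⁻¹)).const_add 2
    simpa only [div_eq_mul_inv] using this
  have h3 := (((Real.smoothTransition.contDiff (n := 1)).differentiable
    (by norm_num)) (2 + Real.log P / (2 * L))).hasDerivAt.comp_hasFDerivAt x h2
  have h4 : HasFDerivAt (logCutoff L : E → ℝ) _ x := h3
  rw [h4.fderiv, norm_smul, norm_smul, norm_smul, ← Nat.cast_smul_eq_nsmul ℝ, norm_smul,
    innerSL_apply_norm]
  rw [Real.norm_eq_abs, Real.norm_eq_abs, Real.norm_eq_abs, abs_of_pos (inv_pos.2 hPpos),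
    abs_of_pos (by positivity : 0 < (2 * L)⁻¹)]
  have h5 : (2 * L)⁻¹ * (P⁻¹ * (‖((2 : ℕ) : ℝ)‖ * ‖x‖)) ≤ 1 / (L * ‖x‖) := by
    have e : (2 * L)⁻¹ * (P⁻¹ * (‖((2 : ℕ) : ℝ)‖ * ‖x‖)) = ‖x‖ / (L * P) := by
      rw [Real.norm_of_nonneg (by norm_num)]; push_cast; field_simp
    rw [e, div_le_div_iff₀ (by positivity) (by positivity)]
    have : 0 < Real.exp (-6 * L) := Real.exp_pos _
    nlinarith
  calc _ ≤ C * (1 / (L * ‖x‖)) := mul_le_mul (hC _) h5 (by positivity) hC0.le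
    _ = _ := by ring

end Cutoff

section Radial

/-- Extension by zero of the product of a cutoff with a function which is `C¹` near the support of
the cutoff. -/
lemma ContDiff.mul_of_tsupport_subset {E : Type*} [NormedAddCommGroup E] [NormedSpace ℝ E]
    {U : Set E} (hU : IsOpen U) {ψ F : E → ℝ} (hψ : ContDiff ℝ 1 ψ) (hs : tsupport ψ ⊆ U)
    (hF : ContDiffOn ℝ 1 F U) : ContDiff ℝ 1 fun x => ψ x * F x := by
  rw [contDiff_iff_contDiffAt]
  intro x
  by_cases hx : x ∈ tsupport ψ
  · exact hψ.contDiffAt.mul (hF.contDiffAt (hU.mem_nhds (hs hx)))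
  · refine contDiffAt_const (c := (0 : ℝ)) |>.congr_of_eventuallyEq ?_
    filter_upwards [notMem_tsupport_iff_eventuallyEq.1 hx] with y hy
    simp [hy]

lemma Continuous.mul_of_tsupport_subset {E : Type*} [TopologicalSpace E]
    {U : Set E} (hU : IsOpen U) {ψ F : E → ℝ} (hψ : Continuous ψ) (hs : tsupport ψ ⊆ U)
    (hF : ContinuousOn F U) : Continuous fun x => ψ x * F x := by
  rw [continuous_iff_continuousAt]
  intro x
  by_cases hx : x ∈ tsupport ψ
  · exact hψ.continuousAt.mul (hF.continuousAt (hU.mem_nhds (hs hx)))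
  · refine continuousAt_const (y := (0 : ℝ)) |>.congr ?_
    filter_upwards [notMem_tsupport_iff_eventuallyEq.1 hx] with y hy
    simp [hy]

lemma integrable_mul_of_tsupport_subset {E : Type*} [TopologicalSpace E] [MeasurableSpace E]
    [OpensMeasurableSpace E] {μ : Measure E} [IsFiniteMeasureOnCompacts μ]
    {U : Set E} (hU : IsOpen U) {ψ F : E → ℝ} (hψ : Continuous ψ) (hc : HasCompactSupport ψ)
    (hs : tsupport ψ ⊆ U) (hF : ContinuousOn F U) : Integrable (fun x => ψ x * F x) μ :=
  (hψ.mul_of_tsupport_subset hU hs hF).integrable_of_hasCompactSupport hc.mul_right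

/-- Exhaustion of a punctured set by the complements of the balls of radius `exp (-k)`. -/
lemma setLIntegral_diff_zero_le {E : Type*} [NormedAddCommGroup E] [MeasurableSpace E]
    {μ : Measure E} {F : E → ENNReal} {S : Set E} {C : ENNReal} (k₀ : ℕ)
    (h : ∀ k : ℕ, k₀ ≤ k → ∫⁻ x in S ∩ {x | Real.exp (-(k : ℝ)) ≤ ‖x‖}, F x ∂μ ≤ C) :
    ∫⁻ x in S \ {0}, F x ∂μ ≤ C := by
  have hU : S \ {0} = ⋃ k : ℕ, S ∩ {x | Real.exp (-(k : ℝ)) ≤ ‖x‖} := by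
    ext x
    simp only [Set.mem_sdiff, mem_singleton_iff, mem_iUnion, mem_inter_iff, mem_ofPred_eq,
      exists_and_left, and_congr_right_iff]
    intro _
    constructor
    · intro hx
      have hx' : 0 < ‖x‖ := norm_pos_iff.2 hx
      obtain ⟨k, hk⟩ := exists_nat_ge (-Real.log ‖x‖)
      exact ⟨k, by rw [← Real.le_log_iff_exp_le hx']; linarith⟩
    · rintro ⟨k, hk⟩ rfl
      rw [norm_zero] at hk
      exact absurd hk (not_le.2 (Real.exp_pos _))
  have hmono : Monotone fun k : ℕ => S ∩ {x : E | Real.exp (-(k : ℝ)) ≤ ‖x‖} := by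
    intro i j hij x hx
    have hx2 : Real.exp (-(i : ℝ)) ≤ ‖x‖ := hx.2
    have : (i : ℝ) ≤ j := by exact_mod_cast hij
    exact ⟨hx.1, mem_ofPred.2 (le_trans (Real.exp_le_exp.2 (by linarith)) hx2)⟩
  rw [hU, setLIntegral_iUnion_of_directed _ hmono.directed_le]
  refine iSup_le fun k => ?_
  exact (lintegral_mono_set (hmono (le_max_left k k₀))).trans (h _ (le_max_right k k₀))

variable {n : ℕ}

lemma integrableOn_norm_inv_ball (hn : 2 ≤ n) (r : ℝ) :
    IntegrableOn (fun x : EuclideanSpace ℝ (Fin n) => ‖x‖⁻¹) (ball 0 r) := by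
  have : Nonempty (Fin n) := ⟨⟨0, by omega⟩⟩
  have : Nontrivial (EuclideanSpace ℝ (Fin n)) := inferInstance
  rw [integrableOn_fun_norm_addHaar volume (f := fun y => y⁻¹)]
  have : IntegrableOn (fun y : ℝ => y ^ (n - 2)) (Ioo 0 r) :=
    ((continuous_pow (n - 2)).integrableOn_Icc (a := 0) (b := r)).mono_set Ioo_subset_Icc_self
  refine this.congr_fun (fun y hy => ?_) measurableSet_Ioo
  have h : n - 1 = (n - 2) + 1 := by omega
  have hy0 : y ≠ 0 := hy.1.ne'
  simp only [finrank_euclideanSpace, Fintype.card_fin, smul_eq_mul]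
  rw [h, pow_succ, mul_assoc, mul_inv_cancel₀ hy0, mul_one]

/-- The annulus `exp (-3L) ≤ ‖x‖ ≤ exp (-L)`. -/
def expAnnulus (n : ℕ) (L : ℝ) : Set (EuclideanSpace ℝ (Fin n)) :=
  {x | Real.exp (-3 * L) ≤ ‖x‖ ∧ ‖x‖ ≤ Real.exp (-L)}

lemma isCompact_expAnnulus (L : ℝ) : IsCompact (expAnnulus n L) := by
  refine Metric.isCompact_of_isClosed_isBounded ?_ ?_
  · exact (isClosed_le continuous_const continuous_norm).inter
      (isClosed_le continuous_norm continuous_const)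
  · refine (isBounded_iff_forall_norm_le).2 ⟨Real.exp (-L), fun x hx => hx.2⟩

lemma integrableOn_norm_pow_inv_expAnnulus (L : ℝ) :
    IntegrableOn (fun x : EuclideanSpace ℝ (Fin n) => (‖x‖ ^ n)⁻¹) (expAnnulus n L) := by
  refine ContinuousOn.integrableOn_compact (isCompact_expAnnulus L) ?_
  refine ContinuousOn.inv₀ (by fun_prop) fun x hx => ?_
  have : 0 < ‖x‖ := (Real.exp_pos _).trans_le hx.1
  positivity

lemma setIntegral_norm_pow_inv_expAnnulus (hn : 2 ≤ n) {L : ℝ} (hL : 1 ≤ L) :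
    ∫ x in expAnnulus n L, (‖x‖ ^ n)⁻¹ = 2 * n * omegaN n * L := by
  have : Nonempty (Fin n) := ⟨⟨0, by omega⟩⟩
  have : Nontrivial (EuclideanSpace ℝ (Fin n)) := inferInstance
  have h1 : ∫ x in expAnnulus n L, (‖x‖ ^ n)⁻¹ =
      ∫ x : EuclideanSpace ℝ (Fin n),
        (Icc (Real.exp (-3 * L)) (Real.exp (-L))).indicator (fun y => (y ^ n)⁻¹) ‖x‖ := by
    rw [← integral_indicator (isCompact_expAnnulus L).measurableSet]
    rfl
  rw [h1, integral_fun_norm_addHaar]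
  have h2 : ∫ y in Ioi (0 : ℝ), y ^ (Module.finrank ℝ (EuclideanSpace ℝ (Fin n)) - 1) •
      (Icc (Real.exp (-3 * L)) (Real.exp (-L))).indicator (fun y => (y ^ n)⁻¹) y = 2 * L := by
    have h3 : ∀ y ∈ Ioi (0 : ℝ), y ^ (Module.finrank ℝ (EuclideanSpace ℝ (Fin n)) - 1) •
        (Icc (Real.exp (-3 * L)) (Real.exp (-L))).indicator (fun y => (y ^ n)⁻¹) y =
        (Icc (Real.exp (-3 * L)) (Real.exp (-L))).indicator (fun y => y⁻¹) y := by
      intro y hy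
      by_cases hy' : y ∈ Icc (Real.exp (-3 * L)) (Real.exp (-L))
      · rw [indicator_of_mem hy', indicator_of_mem hy']
        have hy0 : y ≠ 0 := (mem_Ioi.1 hy).ne'
        simp only [finrank_euclideanSpace, Fintype.card_fin, smul_eq_mul]
        obtain ⟨m, rfl⟩ : ∃ m, n = m + 1 := ⟨n - 1, by omega⟩
        rw [Nat.add_sub_cancel]
        field_simp
        rw [pow_succ]
      · rw [indicator_of_notMem hy', indicator_of_notMem hy', smul_zero]
    have hsub : Icc (Real.exp (-3 * L)) (Real.exp (-L)) ⊆ Ioi 0 :=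
      fun y hy => (Real.exp_pos _).trans_le hy.1
    rw [setIntegral_congr_fun measurableSet_Ioi h3, setIntegral_indicator measurableSet_Icc,
      inter_eq_self_of_subset_right hsub,
      integral_Icc_eq_integral_Ioc, ← intervalIntegral.integral_of_le
        (Real.exp_le_exp.2 (by linarith)), integral_inv_of_pos (Real.exp_pos _) (Real.exp_pos _),
      Real.log_div (Real.exp_pos _).ne' (Real.exp_pos _).ne', Real.log_exp, Real.log_exp]
    ring
  rw [h2, finrank_euclideanSpace, Fintype.card_fin]
  simp only [omegaN, nsmul_eq_mul, smul_eq_mul, Measure.real]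
  ring

end Radial

section Caccioppoli

lemma nat_mul_pow_mul_le {n : ℕ} (hn : 1 ≤ n) {X Y : ℝ} (hX : 0 ≤ X) (hY : 0 ≤ Y) :
    n * (X ^ (n - 1) * Y) ≤ X ^ n / 2 + n * (2 * n) ^ (n - 1) * Y ^ n := by
  obtain ⟨m, rfl⟩ : ∃ m, n = m + 1 := ⟨n - 1, by omega⟩
  simp only [Nat.add_sub_cancel]
  have hm : (0 : ℝ) < ((m + 1 : ℕ) : ℝ) := by positivity
  rcases le_total (2 * ((m + 1 : ℕ) : ℝ) * Y) X with h | h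
  · have h1 : ((m + 1 : ℕ) : ℝ) * (X ^ m * Y) ≤ X ^ (m + 1) / 2 := by
      rw [pow_succ]
      have := mul_le_mul_of_nonneg_left h (pow_nonneg hX m)
      linarith
    have h2 : 0 ≤ ((m + 1 : ℕ) : ℝ) * (2 * ((m + 1 : ℕ) : ℝ)) ^ m * Y ^ (m + 1) := by positivity
    linarith
  · have h1 : X ^ m ≤ (2 * ((m + 1 : ℕ) : ℝ)) ^ m * Y ^ m := by
      rw [← mul_pow]; exact pow_le_pow_left₀ hX h m
    have h2 : 0 ≤ X ^ (m + 1) / 2 := by positivity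
    have h3 := mul_le_mul_of_nonneg_left (mul_le_mul_of_nonneg_right h1 hY) hm.le
    rw [pow_succ Y]
    linarith

variable {n : ℕ}

lemma norm_gradient_eq (u : EuclideanSpace ℝ (Fin n) → ℝ) (x : EuclideanSpace ℝ (Fin n)) :
    ‖gradient u x‖ = ‖fderiv ℝ u x‖ := by
  rw [gradient, LinearIsometryEquiv.norm_map]

lemma fderiv_apply_gradient (u : EuclideanSpace ℝ (Fin n) → ℝ) (x : EuclideanSpace ℝ (Fin n)) :
    fderiv ℝ u x (gradient u x) = ‖gradient u x‖ ^ 2 := by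
  rw [← real_inner_self_eq_norm_sq, ← InnerProductSpace.toDual_apply_apply (𝕜 := ℝ), gradient,
    LinearIsometryEquiv.apply_symm_apply]

lemma real_inner_gradient_right (φ : EuclideanSpace ℝ (Fin n) → ℝ)
    (x v : EuclideanSpace ℝ (Fin n)) :
    ⟪v, gradient φ x⟫_ℝ = fderiv ℝ φ x v := by
  rw [real_inner_comm, ← InnerProductSpace.toDual_apply_apply (𝕜 := ℝ), gradient,
    LinearIsometryEquiv.apply_symm_apply]

lemma ContDiffOn.continuousOn_gradient_s8 {U : Set (EuclideanSpace ℝ (Fin n))} (hU : IsOpen U)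
    {u : EuclideanSpace ℝ (Fin n) → ℝ} (hu : ContDiffOn ℝ 1 u U) :
    ContinuousOn (gradient u) U :=
  (InnerProductSpace.toDual ℝ _).symm.continuous.comp_continuousOn
    (hu.continuousOn_fderiv_of_isOpen hU le_rfl)

/-- Caccioppoli inequality for a general increasing nonlinearity `T`. -/
lemma IsWeakNSol.caccioppoli_s8 (hn : 2 ≤ n) {U : Set (EuclideanSpace ℝ (Fin n))} (hU : IsOpen U)
    {u f : EuclideanSpace ℝ (Fin n) → ℝ} (hu : ContDiffOn ℝ 1 u U)
    (hsol : IsWeakNSol n U u f) {T T' : ℝ → ℝ} (hT : ∀ t, HasDerivAt T (T' t) t)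
    (hT' : Continuous T') (hT'pos : ∀ t, 0 < T' t) (hT0 : ∀ t, 0 ≤ T t)
    {η : EuclideanSpace ℝ (Fin n) → ℝ} (hη : ContDiff ℝ 1 η) (hηc : HasCompactSupport η)
    (hηU : tsupport η ⊆ U) (hη0 : ∀ x, 0 ≤ η x) :
    IntegrableOn (fun x => η x ^ n * (‖gradient u x‖ ^ n * T' (u x))) U ∧
    ∫ x in U, η x ^ n * (‖gradient u x‖ ^ n * T' (u x)) ≤
      2 * (∫ x in U, f x * (η x ^ n * T (u x))) +
      2 * (n * (2 * n) ^ (n - 1)) *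
        ∫ x in U, ‖fderiv ℝ η x‖ ^ n * (T (u x) ^ n / T' (u x) ^ (n - 1)) := by
  have hTc : Continuous T := continuous_iff_continuousAt.2 fun t => (hT t).continuousAt
  have hT1 : ContDiff ℝ 1 T := by
    rw [contDiff_one_iff_deriv]
    refine ⟨fun t => (hT t).differentiableAt, ?_⟩
    rwa [show deriv T = T' from funext fun t => (hT t).deriv]
  have huc : ContinuousOn u U := hu.continuousOn
  have hgc : ContinuousOn (gradient u) U := hu.continuousOn_gradient_s8 hU
  have hpow : ∀ k : ℕ, k ≠ 0 → tsupport (fun x => η x ^ k) ⊆ tsupport η := fun k hk =>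
    closure_mono fun x hx => by
      simp only [Function.mem_support, ne_eq] at hx ⊢
      exact fun h => hx (by rw [h, zero_pow hk])
  have hpowc : ∀ k : ℕ, k ≠ 0 → HasCompactSupport (fun x => η x ^ k) := fun k hk =>
    hηc.mono' ((subset_tsupport _).trans (hpow k hk))
  have hdη : Continuous (fderiv ℝ η) := hη.continuous_fderiv (by norm_num)
  have hds : tsupport (fun x => ‖fderiv ℝ η x‖ ^ n) ⊆ tsupport η := by
    refine (closure_mono fun x hx => ?_).trans (tsupport_fderiv_subset ℝ)
    simp only [Function.mem_support, ne_eq] at hx ⊢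
    exact fun h => hx (by rw [h, norm_zero, zero_pow (by omega)])
  have hA : Integrable (fun x => η x ^ n * (‖gradient u x‖ ^ n * T' (u x))) :=
    integrable_mul_of_tsupport_subset hU (hη.continuous.pow n) (hpowc n (by omega))
      ((hpow n (by omega)).trans hηU) ((hgc.norm.pow n).mul (hT'.comp_continuousOn huc))
  have hB : Integrable fun x => ‖fderiv ℝ η x‖ ^ n * (T (u x) ^ n / T' (u x) ^ (n - 1)) :=
    integrable_mul_of_tsupport_subset hU (hdη.norm.pow n)
      (hηc.mono' ((subset_tsupport _).trans hds)) (hds.trans hηU)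
      (((hTc.comp_continuousOn huc).pow n).div ((hT'.comp_continuousOn huc).pow (n - 1))
        fun x _ => (pow_pos (hT'pos _) _).ne')
  have hR : Integrable fun x => η x ^ (n - 1) *
      (n * T (u x) * ‖gradient u x‖ ^ (n - 2) * fderiv ℝ η x (gradient u x)) :=
    integrable_mul_of_tsupport_subset hU (hη.continuous.pow _) (hpowc _ (by omega))
      ((hpow _ (by omega)).trans hηU)
      (((continuousOn_const.mul (hTc.comp_continuousOn huc)).mul (hgc.norm.pow _)).mul
        (hdη.continuousOn.clm_apply hgc))
  set φ : EuclideanSpace ℝ (Fin n) → ℝ := fun x => η x ^ n * T (u x)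
  have hφ1 : ContDiff ℝ 1 φ := (hη.pow n).mul_of_tsupport_subset hU
    ((hpow n (by omega)).trans hηU) (hT1.comp_contDiffOn hu)
  have hφs : tsupport φ ⊆ tsupport η :=
    (closure_mono (Function.support_mul_subset_left _ _)).trans (hpow n (by omega))
  have key := hsol φ hφ1 (hηc.mono' ((subset_tsupport _).trans hφs)) (hφs.trans hηU)
  have hI : ∀ x ∈ U, ‖gradient u x‖ ^ (n - 2) * ⟪gradient u x, gradient φ x⟫_ℝ =
      η x ^ n * (‖gradient u x‖ ^ n * T' (u x)) + η x ^ (n - 1) *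
      (n * T (u x) * ‖gradient u x‖ ^ (n - 2) * fderiv ℝ η x (gradient u x)) := by
    intro x hx
    have hux : HasFDerivAt u (fderiv ℝ u x) x :=
      ((hu.contDiffAt (hU.mem_nhds hx)).differentiableAt (by norm_num)).hasFDerivAt
    have hηx : HasFDerivAt η (fderiv ℝ η x) x :=
      ((hη.differentiable (by norm_num)) x).hasFDerivAt
    have h1 := (hηx.pow n).mul ((hT (u x)).comp_hasFDerivAt x hux)
    have h2 : HasFDerivAt φ _ x := h1
    rw [real_inner_gradient_right, h2.fderiv]
    simp only [add_apply, smul_apply, smul_eq_mul, nsmul_eq_mul, Function.comp_apply,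
      fderiv_apply_gradient]
    obtain ⟨m, rfl⟩ : ∃ m, n = m + 2 := ⟨n - 2, by omega⟩
    simp only [Nat.add_sub_cancel, show m + 2 - 1 = m + 1 by omega]
    ring
  have hpt : ∀ x ∈ U, η x ^ n * (‖gradient u x‖ ^ n * T' (u x)) / 2 ≤
      ‖gradient u x‖ ^ (n - 2) * ⟪gradient u x, gradient φ x⟫_ℝ +
      (n * (2 * n) ^ (n - 1)) *
        (‖fderiv ℝ η x‖ ^ n * (T (u x) ^ n / T' (u x) ^ (n - 1))) := by
    intro x hx
    rw [hI x hx]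
    have hτ := hT'pos (u x)
    have hop : -(‖fderiv ℝ η x‖ * ‖gradient u x‖) ≤ fderiv ℝ η x (gradient u x) :=
      neg_le_of_abs_le ((fderiv ℝ η x).le_opNorm _)
    have hY := nat_mul_pow_mul_le (n := n) (by omega)
      (X := ‖gradient u x‖ * η x) (Y := ‖fderiv ℝ η x‖ * (T (u x) / T' (u x)))
      (mul_nonneg (norm_nonneg _) (hη0 x))
      (mul_nonneg (norm_nonneg _) (div_nonneg (hT0 _) hτ.le))
    have hY' := mul_le_mul_of_nonneg_left hY hτ.le
    have hc : 0 ≤ n * T (u x) * ‖gradient u x‖ ^ (n - 2) * η x ^ (n - 1) := by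
      have := hT0 (u x)
      have := hη0 x
      positivity
    have hop' := mul_le_mul_of_nonneg_left hop hc
    obtain ⟨m, rfl⟩ : ∃ m, n = m + 2 := ⟨n - 2, by omega⟩
    simp only [Nat.add_sub_cancel, show m + 2 - 1 = m + 1 by omega] at *
    have e1 : T' (u x) * (((m + 2 : ℕ) : ℝ) * ((‖gradient u x‖ * η x) ^ (m + 1) *
        (‖fderiv ℝ η x‖ * (T (u x) / T' (u x))))) =
        ((m + 2 : ℕ) : ℝ) * T (u x) * ‖gradient u x‖ ^ m * η x ^ (m + 1) *
          (‖fderiv ℝ η x‖ * ‖gradient u x‖) := by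
      field_simp
      ring
    have e2 : T' (u x) * (‖fderiv ℝ η x‖ * (T (u x) / T' (u x))) ^ (m + 2) =
        ‖fderiv ℝ η x‖ ^ (m + 2) * (T (u x) ^ (m + 2) / T' (u x) ^ (m + 1)) := by
      rw [mul_pow, div_pow]
      field_simp
      ring
    have e3 : T' (u x) * (((‖gradient u x‖ * η x) ^ (m + 2)) / 2 +
        ((m + 2 : ℕ) : ℝ) * (2 * ((m + 2 : ℕ) : ℝ)) ^ (m + 1) *
        (‖fderiv ℝ η x‖ * (T (u x) / T' (u x))) ^ (m + 2)) =
        η x ^ (m + 2) * (‖gradient u x‖ ^ (m + 2) * T' (u x)) / 2 +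
        ((m + 2 : ℕ) : ℝ) * (2 * ((m + 2 : ℕ) : ℝ)) ^ (m + 1) *
        (T' (u x) * (‖fderiv ℝ η x‖ * (T (u x) / T' (u x))) ^ (m + 2)) := by
      ring
    rw [e1, e3, e2] at hY'
    linarith
  have hII : IntegrableOn
      (fun x => ‖gradient u x‖ ^ (n - 2) * ⟪gradient u x, gradient φ x⟫_ℝ) U :=
    (hA.add hR).integrableOn.congr_fun (fun x hx => (hI x hx).symm) hU.measurableSet
  refine ⟨hA.integrableOn, ?_⟩
  have hmono := setIntegral_mono_on (hA.integrableOn.div_const 2)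
    (hII.add (hB.integrableOn.const_mul _)) hU.measurableSet hpt
  rw [integral_div] at hmono
  simp only [Pi.add_apply] at hmono
  rw [integral_add hII (hB.integrableOn.const_mul _), integral_const_mul, key] at hmono
  linarith

end Caccioppoli

section TestFunction

/-- The function `t ↦ log (1 + exp (-δ t))`. -/
noncomputable def softplus (δ t : ℝ) : ℝ := Real.log (1 + Real.exp (-(δ * t)))

lemma softplus_pos (δ t : ℝ) : 0 < softplus δ t :=
  Real.log_pos (by linarith [Real.exp_pos (-(δ * t))])

lemma contDiff_softplus (δ : ℝ) : ContDiff ℝ 1 (softplus δ) := by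
  unfold softplus
  exact ContDiff.log (by fun_prop) fun t => by positivity

lemma hasDerivAt_softplus (δ t : ℝ) :
    HasDerivAt (softplus δ) (-δ / (1 + Real.exp (δ * t))) t := by
  have h : HasDerivAt (fun s : ℝ => 1 + Real.exp (-(δ * s))) (Real.exp (-(δ * t)) * -(δ * 1)) t :=
    (((hasDerivAt_id t).const_mul δ).neg.exp).const_add 1
  refine (h.log (by positivity)).congr_deriv ?_
  rw [Real.exp_neg]
  have := Real.exp_pos (δ * t)
  field_simp
  ring

lemma abs_le_softplus_add_exp {δ : ℝ} (hδ : 0 < δ) (t : ℝ) :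
    |t| ≤ (softplus δ t + Real.exp (δ * t)) / δ := by
  rw [le_div_iff₀ hδ]
  have h1 : -(δ * t) ≤ softplus δ t := by
    rw [softplus, Real.le_log_iff_exp_le (by positivity)]
    linarith
  have h2 := Real.add_one_le_exp (δ * t)
  have h3 := softplus_pos δ t
  have h4 := Real.exp_pos (δ * t)
  rcases abs_cases t with ⟨h, _⟩ | ⟨h, _⟩ <;> rw [h] <;> nlinarith

/-- The derivative of `t ↦ (1 + softplus δ t)⁻ᵐ`. -/
noncomputable def softplusWeight (m : ℕ) (δ t : ℝ) : ℝ :=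
  m * δ / ((1 + softplus δ t) ^ (m + 1) * (1 + Real.exp (δ * t)))

lemma softplusWeight_pos {m : ℕ} (hm : 1 ≤ m) {δ : ℝ} (hδ : 0 < δ) (t : ℝ) :
    0 < softplusWeight m δ t := by
  have := softplus_pos δ t
  have : (0 : ℝ) < m := by exact_mod_cast hm
  unfold softplusWeight
  positivity

lemma continuous_softplusWeight (m : ℕ) (δ : ℝ) : Continuous (softplusWeight m δ) := by
  have h := (contDiff_softplus δ).continuous
  unfold softplusWeight
  refine continuous_const.div (by fun_prop) fun t => ?_
  have := softplus_pos δ t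
  positivity

lemma hasDerivAt_inv_one_add_softplus_pow (m : ℕ) (δ t : ℝ) :
    HasDerivAt (fun t => ((1 + softplus δ t) ^ m)⁻¹) (softplusWeight m δ t) t := by
  have hs := softplus_pos δ t
  have h := (((hasDerivAt_softplus δ t).const_add 1).fun_pow m).fun_inv (by positivity)
  refine h.congr_deriv ?_
  unfold softplusWeight
  rcases m with _ | k
  · simp
  · have : 0 < 1 + softplus δ t := by positivity
    simp only [Nat.add_sub_cancel]
    field_simp
    ring

lemma hasDerivAt_inv_one_add_exp_neg_div (L t : ℝ) :
    HasDerivAt (fun t => (1 + Real.exp (-(t / L)))⁻¹)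
      (1 / L * Real.exp (-(t / L)) / (1 + Real.exp (-(t / L))) ^ 2) t := by
  have h : HasDerivAt (fun s : ℝ => 1 + Real.exp (-(s / L))) (Real.exp (-(t / L)) * -(1 / L)) t :=
    (((hasDerivAt_id t).div_const L).neg.exp).const_add 1
  exact (h.fun_inv (by positivity)).congr_deriv (by ring)

/-- A bounded increasing function whose derivative controls both the left tail uniformly in `L`, and
the right tail at scale `L`. -/
noncomputable def testFun (m : ℕ) (δ L t : ℝ) : ℝ :=
  ((1 + softplus δ t) ^ m)⁻¹ + (1 + Real.exp (-(t / L)))⁻¹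

/-- The derivative of `testFun`. -/
noncomputable def testDeriv (m : ℕ) (δ L t : ℝ) : ℝ :=
  softplusWeight m δ t + 1 / L * Real.exp (-(t / L)) / (1 + Real.exp (-(t / L))) ^ 2

lemma hasDerivAt_testFun (m : ℕ) (δ L t : ℝ) :
    HasDerivAt (testFun m δ L) (testDeriv m δ L t) t :=
  (hasDerivAt_inv_one_add_softplus_pow m δ t).add (hasDerivAt_inv_one_add_exp_neg_div L t)

lemma continuous_testDeriv (m : ℕ) (δ L : ℝ) : Continuous (testDeriv m δ L) := by
  unfold testDeriv
  refine (continuous_softplusWeight m δ).add (Continuous.div (by fun_prop) (by fun_prop) ?_)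
  intro t; positivity

lemma softplusWeight_le_testDeriv (m : ℕ) (δ : ℝ) {L : ℝ} (hL : 1 ≤ L) (t : ℝ) :
    softplusWeight m δ t ≤ testDeriv m δ L t := by
  unfold testDeriv
  have : 0 < L := by linarith
  have : 0 ≤ 1 / L * Real.exp (-(t / L)) / (1 + Real.exp (-(t / L))) ^ 2 := by positivity
  linarith

lemma testFun_nonneg (m : ℕ) (δ L t : ℝ) : 0 ≤ testFun m δ L t := by
  have := softplus_pos δ t
  unfold testFun; positivity

lemma testFun_le_two (m : ℕ) (δ L t : ℝ) : testFun m δ L t ≤ 2 := by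
  have h1 : ((1 + softplus δ t) ^ m)⁻¹ ≤ 1 :=
    inv_le_one_of_one_le₀ (one_le_pow₀ (by linarith [softplus_pos δ t]))
  have h2 : (1 + Real.exp (-(t / L)))⁻¹ ≤ 1 :=
    inv_le_one_of_one_le₀ (by linarith [Real.exp_pos (-(t / L))])
  unfold testFun; linarith

lemma testFun_pow_div_le_left {m : ℕ} (hm : 1 ≤ m) {δ : ℝ} (hδ : 0 < δ) {L : ℝ} (hL : 1 ≤ L)
    (t : ℝ) :
    testFun m δ L t ^ (m + 1) / testDeriv m δ L t ^ m ≤ 2 ^ (m + 1) / softplusWeight m δ t ^ m := by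
  have h1 := softplusWeight_pos hm hδ t
  have h2 := softplusWeight_le_testDeriv m δ hL t
  have h3 := testFun_nonneg m δ L t
  have h4 := testFun_le_two m δ L t
  gcongr

lemma testFun_pow_div_le_right {m : ℕ} (hm : 1 ≤ m) {δ : ℝ} (hδ : 0 < δ) {L : ℝ} (hL : 1 ≤ L)
    (t : ℝ) :
    testFun m δ L t ^ (m + 1) / testDeriv m δ L t ^ m ≤
      3 ^ (m + 1) * ((2 / δ) ^ m + 1) * (L ^ m * (1 + Real.exp (t / L)) ^ m) := by
  have hD1 := softplusWeight_pos hm hδ t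
  have hL0 : 0 < L := by linarith
  have hs := softplus_pos δ t
  have hm1 : (1 : ℝ) ≤ m := by exact_mod_cast hm
  set D2 := 1 / L * Real.exp (-(t / L)) / (1 + Real.exp (-(t / L))) ^ 2 with hD2
  have hD2pos : 0 < D2 := by positivity
  set T1 := ((1 + softplus δ t) ^ m)⁻¹ with hT1
  set T2 := (1 + Real.exp (-(t / L)))⁻¹ with hT2
  set E := L ^ m * (1 + Real.exp (t / L)) ^ m with hE
  have hT1pos : 0 < T1 := by positivity
  have hT2pos : 0 < T2 := by positivity
  have hD : testDeriv m δ L t = softplusWeight m δ t + D2 := rfl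
  have hT : testFun m δ L t = T1 + T2 := rfl
  have hDpos : 0 < testDeriv m δ L t := by rw [hD]; positivity
  have hT2le : T2 ≤ 1 := inv_le_one_of_one_le₀ (by linarith [Real.exp_pos (-(t / L))])
  have hT1le : T1 ≤ 1 := inv_le_one_of_one_le₀ (one_le_pow₀ (by linarith))
  have hE1 : 1 ≤ E := one_le_mul_of_one_le_of_one_le (one_le_pow₀ hL)
    (one_le_pow₀ (by linarith [Real.exp_pos (t / L)]))
  have hT2D : T2 ^ (m + 1) ≤ E * testDeriv m δ L t ^ m := by
    have h1 : T2 = L * (1 + Real.exp (t / L)) * D2 := by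
      rw [hT2, hD2, Real.exp_neg]
      have := Real.exp_pos (t / L)
      field_simp
      ring
    calc T2 ^ (m + 1) ≤ T2 ^ m := pow_le_pow_of_le_one hT2pos.le hT2le (Nat.le_succ m)
      _ = E * D2 ^ m := by rw [h1, hE, mul_pow, mul_pow]
      _ ≤ E * testDeriv m δ L t ^ m := by
        gcongr
        rw [hD]; linarith
  rw [div_le_iff₀ (by positivity)]
  rcases le_total t 0 with ht | ht
  · have hT1D : T1 ^ (m + 1) ≤ (2 / δ) ^ m * testDeriv m δ L t ^ m := by
      have h1 : T1 ^ (m + 1) =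
          ((1 + Real.exp (δ * t)) / (m * δ)) ^ m * softplusWeight m δ t ^ m := by
        rw [hT1, softplusWeight, ← mul_pow, inv_pow, ← pow_mul, mul_comm m (m + 1), pow_mul,
          ← inv_pow]
        congr 1
        have : 0 < 1 + Real.exp (δ * t) := by positivity
        field_simp
      have h2 : Real.exp (δ * t) ≤ 1 := Real.exp_le_one_iff.2 (by nlinarith)
      rw [h1]
      gcongr
      · linarith
      · nlinarith
      · rw [hD]; linarith
    have h0 : 0 ≤ (2 / δ) ^ m := by positivity
    calc testFun m δ L t ^ (m + 1) ≤ 2 ^ m * (T1 ^ (m + 1) + T2 ^ (m + 1)) := by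
          rw [hT]; exact add_pow_le hT1pos.le hT2pos.le (m + 1)
      _ ≤ 2 ^ m * ((2 / δ) ^ m * testDeriv m δ L t ^ m + E * testDeriv m δ L t ^ m) := by gcongr
      _ = 2 ^ m * ((2 / δ) ^ m + E) * testDeriv m δ L t ^ m := by ring
      _ ≤ 3 ^ (m + 1) * (((2 / δ) ^ m + 1) * E) * testDeriv m δ L t ^ m := by
        have h3 : (2 : ℝ) ^ m ≤ 3 ^ (m + 1) :=
          (pow_le_pow_left₀ (by norm_num) (by norm_num) m).trans
            (pow_le_pow_right₀ (by norm_num) (Nat.le_succ m))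
        gcongr
        nlinarith
      _ = _ := by ring
  · have h1 : (1 : ℝ) ≤ 2 * T2 := by
      rw [hT2, ← div_eq_mul_inv, le_div_iff₀ (by positivity)]
      have : Real.exp (-(t / L)) ≤ 1 :=
        Real.exp_le_one_iff.2 (by have := div_nonneg ht hL0.le; linarith)
      linarith
    have h0 : 0 ≤ (2 / δ) ^ m := by positivity
    calc testFun m δ L t ^ (m + 1) ≤ (3 * T2) ^ (m + 1) := by
          rw [hT]; gcongr; linarith
      _ = 3 ^ (m + 1) * 1 * T2 ^ (m + 1) := by ring
      _ ≤ 3 ^ (m + 1) * ((2 / δ) ^ m + 1) * (E * testDeriv m δ L t ^ m) := by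
        gcongr; linarith
      _ = _ := by ring

end TestFunction

section Energy

lemma fderiv_contDiffBump_eq_zero {E : Type*} [NormedAddCommGroup E] [InnerProductSpace ℝ E]
    [HasContDiffBump E] (χ : ContDiffBump (0 : E)) {x : E} (hx : ‖x‖ < χ.rIn ∨ χ.rOut < ‖x‖) :
    fderiv ℝ χ x = 0 := by
  rcases hx with hx | hx
  · have h : (χ : E → ℝ) =ᶠ[𝓝 x] fun _ => 1 := χ.eventuallyEq_one_of_mem_ball (by simpa using hx)
    rw [h.fderiv_eq, fderiv_fun_const]; rfl
  · have h : (χ : E → ℝ) =ᶠ[𝓝 x] fun _ => 0 := by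
      filter_upwards [(isOpen_lt continuous_const continuous_norm).mem_nhds hx] with y hy
      have hy' : χ.rOut < ‖y‖ := hy
      exact χ.zero_of_le_dist (by simpa using hy'.le)
    rw [h.fderiv_eq, fderiv_fun_const]; rfl

section Bump

variable {E : Type*} [NormedAddCommGroup E] [InnerProductSpace ℝ E] [FiniteDimensional ℝ E]
  (χ : ContDiffBump (0 : E)) {L : ℝ}

lemma contDiff_bump_mul_logCutoff (L : ℝ) : ContDiff ℝ 1 fun x : E => χ x * logCutoff L x :=
  χ.contDiff.mul (contDiff_logCutoff L)

lemma hasCompactSupport_bump_mul_logCutoff (L : ℝ) :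
    HasCompactSupport fun x : E => χ x * logCutoff L x :=
  χ.hasCompactSupport.mul_right

lemma tsupport_bump_mul_logCutoff_subset (hL : 1 ≤ L) :
    tsupport (fun x : E => χ x * logCutoff L x) ⊆ closedBall 0 χ.rOut \ {0} := by
  intro x hx
  refine ⟨?_, ?_⟩
  · rw [← χ.tsupport_eq]
    exact tsupport_mul_subset_left hx
  · rintro rfl
    exact zero_notMem_tsupport_logCutoff hL (tsupport_mul_subset_right hx)

lemma bump_mul_logCutoff_nonneg (L : ℝ) (x : E) : 0 ≤ χ x * logCutoff L x :=
  mul_nonneg χ.nonneg (logCutoff_nonneg L x)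

lemma bump_mul_logCutoff_le_one (L : ℝ) (x : E) : χ x * logCutoff L x ≤ 1 :=
  mul_le_one₀ χ.le_one (logCutoff_nonneg L x) (logCutoff_le_one L x)

lemma norm_fderiv_bump_mul_logCutoff_le (L : ℝ) (x : E) :
    ‖fderiv ℝ (fun x : E => χ x * logCutoff L x) x‖ ≤
      ‖fderiv ℝ χ x‖ + ‖fderiv ℝ (logCutoff L : E → ℝ) x‖ := by
  rw [fderiv_fun_mul (χ.contDiff.differentiable one_ne_zero x)
    ((contDiff_logCutoff L).differentiable one_ne_zero x), add_comm]
  refine (norm_add_le _ _).trans (add_le_add ?_ ?_) <;> rw [norm_smul, Real.norm_eq_abs]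
  · rw [abs_of_nonneg (logCutoff_nonneg L x)]
    exact mul_le_of_le_one_left (norm_nonneg _) (logCutoff_le_one L x)
  · rw [abs_of_nonneg χ.nonneg]
    exact mul_le_of_le_one_left (norm_nonneg _) χ.le_one

end Bump

variable {n : ℕ}

lemma exp_mul_div_le_of_mem_expAnnulus {L : ℝ} (hL : 1 ≤ L) {m : ℕ} (hm : (m : ℝ) ≤ L) (α t : ℝ)
    {x : EuclideanSpace ℝ (Fin n)} (hx : x ∈ expAnnulus n L) :
    Real.exp (t / L) ^ m ≤ Real.exp (3 * m * n * |α + 1|) *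
      (1 + ‖x‖ ^ n * (‖x‖ ^ ((n : ℝ) * α) * Real.exp t)) := by
  have hx0 : 0 < ‖x‖ := (Real.exp_pos _).trans_le hx.1
  have hL0 : 0 < L := by linarith
  set l := Real.log ‖x‖
  have hl1 : -3 * L ≤ l := (Real.le_log_iff_exp_le hx0).2 hx.1
  have hl2 : l ≤ -L := (Real.log_le_iff_le_exp hx0).2 hx.2
  set y := t + n * (α + 1) * l with hy
  have e1 : ‖x‖ ^ n * (‖x‖ ^ ((n : ℝ) * α) * Real.exp t) = Real.exp y := by
    rw [← Real.rpow_natCast, Real.rpow_def_of_pos hx0, Real.rpow_def_of_pos hx0, ← Real.exp_add,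
      ← Real.exp_add]
    congr 1; rw [hy]; ring
  have e2 : m * (y / L) ≤ max 0 y := by
    rcases le_total y 0 with h | h
    · exact (mul_nonpos_of_nonneg_of_nonpos (by positivity)
        (div_nonpos_of_nonpos_of_nonneg h hL0.le)).trans (le_max_left _ _)
    · refine le_trans ?_ (le_max_right _ _)
      rw [← mul_div_assoc, div_le_iff₀ hL0]
      nlinarith
  have e3 : Real.exp (max 0 y) ≤ 1 + Real.exp y := by
    rcases max_choice 0 y with h | h <;> rw [h]
    · rw [Real.exp_zero]; linarith [Real.exp_pos y]
    · linarith
  have e4 : m * (t / L) ≤ 3 * m * n * |α + 1| + m * (y / L) := by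
    have h1 : m * (t / L) = m * (y / L) + m * n * ((α + 1) * (-l / L)) := by
      rw [hy]; field_simp; ring
    have h2 : (α + 1) * (-l / L) ≤ |α + 1| * 3 := by
      refine (mul_le_mul_of_nonneg_right (le_abs_self _) (div_nonneg (by linarith) hL0.le)).trans ?_
      refine mul_le_mul_of_nonneg_left ?_ (abs_nonneg _)
      rw [div_le_iff₀ hL0]; linarith
    have h3 : (m : ℝ) * n * ((α + 1) * (-l / L)) ≤ m * n * (|α + 1| * 3) :=
      mul_le_mul_of_nonneg_left h2 (by positivity)
    linarith
  rw [e1, ← Real.exp_nat_mul]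
  calc Real.exp (m * (t / L)) ≤ Real.exp (3 * m * n * |α + 1| + max 0 y) :=
        Real.exp_le_exp.2 (by linarith)
    _ = Real.exp (3 * m * n * |α + 1|) * Real.exp (max 0 y) := Real.exp_add _ _
    _ ≤ _ := mul_le_mul_of_nonneg_left e3 (Real.exp_pos _).le

lemma exists_logCutoff_mul_testFun_le (hn : 2 ≤ n) (α : ℝ) {δ : ℝ} (hδ : 0 < δ) :
    ∃ C : ℝ, 0 < C ∧ ∀ L : ℝ, (n : ℝ) ≤ L → ∀ x ∈ expAnnulus n L, ∀ t : ℝ,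
      ‖fderiv ℝ (logCutoff L : EuclideanSpace ℝ (Fin n) → ℝ) x‖ ^ n *
        (testFun (n - 1) δ L t ^ n / testDeriv (n - 1) δ L t ^ (n - 1)) ≤
      C / L * ((‖x‖ ^ n)⁻¹ + ‖x‖ ^ ((n : ℝ) * α) * Real.exp t) := by
  obtain ⟨m, rfl⟩ : ∃ m, n = m + 1 := ⟨n - 1, by omega⟩
  obtain ⟨C, hC, hlc⟩ := exists_norm_fderiv_logCutoff_le (E := EuclideanSpace ℝ (Fin (m + 1)))
  set A := Real.exp (3 * m * (m + 1 : ℕ) * |α + 1|)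
  have hA0 : 0 < A := Real.exp_pos _
  set B : ℝ := 3 ^ (m + 1) * ((2 / δ) ^ m + 1)
  have hB0 : 0 < B := by positivity
  refine ⟨C ^ (m + 1) * B * 2 ^ (m - 1) * (1 + A), by positivity, fun L hL x hx t => ?_⟩
  simp only [Nat.add_sub_cancel]
  push_cast at hL
  have hL1 : 1 ≤ L := by have : (0 : ℝ) ≤ m := by positivity
                         linarith
  have hL0 : 0 < L := by linarith
  have hx0 : 0 < ‖x‖ := (Real.exp_pos _).trans_le hx.1
  have h1 := testFun_pow_div_le_right (m := m) (by omega) hδ hL1 t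
  have h2 := exp_mul_div_le_of_mem_expAnnulus hL1 (m := m) (by linarith) α t hx
  have h3 : (1 + Real.exp (t / L)) ^ m ≤ 2 ^ (m - 1) * (1 ^ m + Real.exp (t / L) ^ m) :=
    add_pow_le zero_le_one (Real.exp_pos _).le m
  set f := ‖x‖ ^ (((m + 1 : ℕ) : ℝ) * α) * Real.exp t
  have hf0 : 0 < f := by positivity
  have h4 : (1 + Real.exp (t / L)) ^ m ≤
      2 ^ (m - 1) * ((1 + A) * (1 + ‖x‖ ^ (m + 1) * f)) := by
    refine h3.trans (mul_le_mul_of_nonneg_left ?_ (by positivity))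
    rw [one_pow]
    have : 0 ≤ ‖x‖ ^ (m + 1) * f := by positivity
    linarith
  have h5 := hlc L hL1 x
  calc _ ≤ (C / (L * ‖x‖)) ^ (m + 1) * (B * (L ^ m * (2 ^ (m - 1) *
        ((1 + A) * (1 + ‖x‖ ^ (m + 1) * f))))) := by
        gcongr
        · exact div_nonneg (pow_nonneg (testFun_nonneg _ _ _ _) _) (pow_nonneg
            ((softplusWeight_pos (by omega) hδ t).le.trans
              (softplusWeight_le_testDeriv m δ hL1 t)) _)
        · refine h1.trans ?_
          gcongr
    _ = _ := by
        rw [div_pow, mul_pow]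
        field_simp
        rw [pow_succ]

end Energy

section EnergyBound

variable {n : ℕ}

lemma exists_integral_norm_gradient_pow_mul_softplusWeight_le (hn : 2 ≤ n) {α : ℝ}
    {Ω : Set (EuclideanSpace ℝ (Fin n))} (hΩ : IsOpen Ω)
    {u : EuclideanSpace ℝ (Fin n) → ℝ} (hu : ContDiffOn ℝ 1 u (Ω \ {0}))
    (hsol : IsWeakNSol n (Ω \ {0}) u (fun x => ‖x‖ ^ ((n : ℝ) * α) * Real.exp (u x)))
    (hint : IntegrableOn (fun x => ‖x‖ ^ ((n : ℝ) * α) * Real.exp (u x)) Ω)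
    {δ : ℝ} (hδ : 0 < δ) (χ : ContDiffBump (0 : EuclideanSpace ℝ (Fin n)))
    (hχ : closedBall 0 χ.rOut ⊆ Ω) :
    ∃ C : ℝ, ∀ L : ℝ, (n : ℝ) ≤ L → Real.exp (-L) < χ.rIn →
      ∫⁻ x in ball (0 : EuclideanSpace ℝ (Fin n)) χ.rIn ∩ {x | Real.exp (-L) ≤ ‖x‖},
        ENNReal.ofReal (‖gradient u x‖ ^ n * softplusWeight (n - 1) δ (u x)) ≤
          ENNReal.ofReal C := by
  set U : Set (EuclideanSpace ℝ (Fin n)) := Ω \ {0}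
  have hU : IsOpen U := hΩ.sdiff isClosed_singleton
  set f : EuclideanSpace ℝ (Fin n) → ℝ := fun x => ‖x‖ ^ ((n : ℝ) * α) * Real.exp (u x)
  have hf0 : ∀ x, 0 ≤ f x := fun x => by positivity
  have hfU : IntegrableOn f U := hint.mono_set Set.sdiff_subset
  have hn1 : 1 ≤ n - 1 := by omega
  obtain ⟨C₁, hC₁, hann⟩ := exists_logCutoff_mul_testFun_le hn α hδ
  set S : Set (EuclideanSpace ℝ (Fin n)) := closedBall 0 χ.rOut \ ball 0 χ.rIn
  have hScomp : IsCompact S := (isCompact_closedBall 0 χ.rOut).diff isOpen_ball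
  have hSU : S ⊆ U := fun x hx => ⟨hχ hx.1, fun h => hx.2 (by
    rw [mem_singleton_iff.1 h]; exact mem_ball_self χ.rIn_pos)⟩
  have hWpos : ∀ t, 0 < softplusWeight (n - 1) δ t := softplusWeight_pos hn1 hδ
  obtain ⟨M, hM⟩ := hScomp.exists_bound_of_continuousOn
    (f := fun x => ‖fderiv ℝ χ x‖ ^ n * (2 ^ n / softplusWeight (n - 1) δ (u x) ^ (n - 1))) (by
      refine ContinuousOn.mul
        (((χ.contDiff (n := 1)).continuous_fderiv one_ne_zero).norm.pow n).continuousOn ?_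
      refine ContinuousOn.div continuousOn_const ?_ fun x _ => (pow_pos (hWpos _) _).ne'
      exact ((continuous_softplusWeight (n - 1) δ).comp_continuousOn
        (hu.continuousOn.mono hSU)).pow _)
  refine ⟨2 * (2 * ∫ x in U, f x) + 2 * (n * (2 * n) ^ (n - 1)) *
    (M * volume.real S + C₁ * (2 * n * omegaN n + ∫ x in U, f x)), fun L hnL hLr => ?_⟩
  have hL : 1 ≤ L := le_trans (by exact_mod_cast (by omega : 1 ≤ n)) hnL
  have hL0 : 0 < L := by linarith
  set η : EuclideanSpace ℝ (Fin n) → ℝ := fun x => χ x * logCutoff L x with hη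
  have hη0 : ∀ x, 0 ≤ η x := bump_mul_logCutoff_nonneg χ L
  have hη1 : ∀ x, η x ≤ 1 := bump_mul_logCutoff_le_one χ L
  have hηU : tsupport η ⊆ U := (tsupport_bump_mul_logCutoff_subset χ hL).trans
    (Set.sdiff_subset_sdiff_left hχ)
  have hDpos : ∀ t, 0 < testDeriv (n - 1) δ L t := fun t =>
    (hWpos t).trans_le (softplusWeight_le_testDeriv _ _ hL t)
  obtain ⟨hI, hle⟩ := hsol.caccioppoli_s8 hn hU hu (hasDerivAt_testFun (n - 1) δ L)
    (continuous_testDeriv _ _ _) hDpos (testFun_nonneg _ _ _)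
    (contDiff_bump_mul_logCutoff χ L) (hasCompactSupport_bump_mul_logCutoff χ L) hηU hη0
  have hsource : ∫ x in U, f x * (η x ^ n * testFun (n - 1) δ L (u x)) ≤ 2 * ∫ x in U, f x := by
    rw [← integral_const_mul]
    refine integral_mono_of_nonneg (Filter.Eventually.of_forall fun x => ?_) (hfU.const_mul 2)
      (Filter.Eventually.of_forall fun x => ?_)
    · exact mul_nonneg (hf0 x) (mul_nonneg (pow_nonneg (hη0 x) _) (testFun_nonneg _ _ _ _))
    · have h1 : η x ^ n * testFun (n - 1) δ L (u x) ≤ 1 * 2 :=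
        mul_le_mul (pow_le_one₀ (hη0 x) (hη1 x)) (testFun_le_two _ _ _ _) (testFun_nonneg _ _ _ _)
          zero_le_one
      have := mul_le_mul_of_nonneg_left h1 (hf0 x)
      simp only
      linarith
  have hAU : expAnnulus n L ⊆ U := fun x hx => ⟨hχ (by
      have h1 := hx.2
      have h2 := χ.rIn_lt_rOut
      simpa using by linarith), fun h => by
        have h1 := hx.1
        rw [mem_singleton_iff.1 h, norm_zero] at h1
        exact absurd h1 (not_le.2 (Real.exp_pos _))⟩
  have hAm : MeasurableSet (expAnnulus n L) := (isCompact_expAnnulus L).measurableSet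
  have hSm : MeasurableSet S := hScomp.measurableSet
  have hgrad : ∫ x in U, ‖fderiv ℝ η x‖ ^ n *
      (testFun (n - 1) δ L (u x) ^ n / testDeriv (n - 1) δ L (u x) ^ (n - 1)) ≤
      M * volume.real S + C₁ * (2 * n * omegaN n + ∫ x in U, f x) := by
    have hG0 : ∀ x, 0 ≤ testFun (n - 1) δ L (u x) ^ n / testDeriv (n - 1) δ L (u x) ^ (n - 1) :=
      fun x => div_nonneg (pow_nonneg (testFun_nonneg _ _ _ _) _) (pow_nonneg (hDpos _).le _)
    have hi1 : IntegrableOn (fun _ : EuclideanSpace ℝ (Fin n) => M) S :=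
      integrableOn_const hScomp.measure_lt_top.ne
    have hi2 : IntegrableOn (fun x : EuclideanSpace ℝ (Fin n) =>
        C₁ / L * ((‖x‖ ^ n)⁻¹ + f x)) (expAnnulus n L) :=
      ((integrableOn_norm_pow_inv_expAnnulus L).add (hfU.mono_set hAU)).const_mul _
    have hj1 := (integrable_indicator_iff hSm).2 hi1
    have hj2 := (integrable_indicator_iff hAm).2 hi2
    have hpos : ∀ x ∈ expAnnulus n L, 0 ≤ C₁ / L * ((‖x‖ ^ n)⁻¹ + f x) := fun x _ => by
      have := hf0 x; positivity
    calc _ ≤ ∫ x in U, (S.indicator (fun _ => M) x +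
          (expAnnulus n L).indicator (fun x => C₁ / L * ((‖x‖ ^ n)⁻¹ + f x)) x) := by
          refine integral_mono_of_nonneg (Filter.Eventually.of_forall fun x =>
            mul_nonneg (by positivity) (hG0 x)) (hj1.add hj2).integrableOn
            (Filter.Eventually.of_forall fun x => ?_)
          have hb2 : 0 ≤ (expAnnulus n L).indicator (fun x => C₁ / L * ((‖x‖ ^ n)⁻¹ + f x)) x :=
            indicator_nonneg hpos x
          have hb1 : ∀ y ∈ S, 0 ≤ M := fun y hy => (norm_nonneg _).trans (hM y hy)
          have hb1' : 0 ≤ S.indicator (fun _ => M) x := indicator_nonneg hb1 x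
          simp only
          rcases le_total (Real.exp (-L)) ‖x‖ with hx | hx
          · have hd : fderiv ℝ η x = logCutoff L x • fderiv ℝ χ x := by
              rw [hη, fderiv_fun_mul (χ.contDiff.differentiable one_ne_zero x)
                ((contDiff_logCutoff L).differentiable one_ne_zero x),
                fderiv_logCutoff_eq_zero hL (Or.inr hx), smul_zero, zero_add]
            by_cases hxS : x ∈ S
            · rw [indicator_of_mem hxS]
              have h1 := (le_abs_self _).trans (hM x hxS)
              have h2 := testFun_pow_div_le_left hn1 hδ hL (u x)
              rw [Nat.sub_add_cancel (by omega : 1 ≤ n)] at h2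
              have h3 : ‖fderiv ℝ η x‖ ≤ ‖fderiv ℝ χ x‖ := by
                rw [hd, norm_smul, Real.norm_eq_abs, abs_of_nonneg (logCutoff_nonneg L x)]
                exact mul_le_of_le_one_left (norm_nonneg _) (logCutoff_le_one L x)
              have h4 := mul_le_mul (pow_le_pow_left₀ (norm_nonneg _) h3 n) h2 (hG0 x)
                (by positivity)
              linarith
            · have : fderiv ℝ χ x = 0 := by
                refine fderiv_contDiffBump_eq_zero χ ?_
                by_contra! hcon
                exact hxS ⟨by simpa using hcon.2, by simpa using hcon.1⟩
              rw [hd, this, smul_zero, norm_zero, zero_pow (by omega), zero_mul]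
              exact add_nonneg hb1' hb2
          · have hd : fderiv ℝ η x = χ x • fderiv ℝ (logCutoff L) x := by
              rw [hη, fderiv_fun_mul (χ.contDiff.differentiable one_ne_zero x)
                ((contDiff_logCutoff L).differentiable one_ne_zero x),
                fderiv_contDiffBump_eq_zero χ (Or.inl (hx.trans_lt hLr)), smul_zero, add_zero]
            by_cases hxA : x ∈ expAnnulus n L
            · rw [indicator_of_mem hxA]
              have h3 : ‖fderiv ℝ η x‖ ≤
                  ‖fderiv ℝ (logCutoff L : EuclideanSpace ℝ (Fin n) → ℝ) x‖ := by
                rw [hd, norm_smul, Real.norm_eq_abs, abs_of_nonneg χ.nonneg]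
                exact mul_le_of_le_one_left (norm_nonneg _) χ.le_one
              have h4 := mul_le_mul_of_nonneg_right (pow_le_pow_left₀ (norm_nonneg _) h3 n) (hG0 x)
              have h5 := hann L hnL x hxA (u x)
              have h6 : C₁ / L * ((‖x‖ ^ n)⁻¹ + ‖x‖ ^ ((n : ℝ) * α) * Real.exp (u x)) =
                C₁ / L * ((‖x‖ ^ n)⁻¹ + f x) := rfl
              linarith
            · have : fderiv ℝ (logCutoff L : EuclideanSpace ℝ (Fin n) → ℝ) x = 0 := by
                refine fderiv_logCutoff_eq_zero hL (Or.inl ?_)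
                by_contra! hcon
                exact hxA ⟨hcon.le, hx⟩
              rw [hd, this, smul_zero, norm_zero, zero_pow (by omega), zero_mul]
              exact add_nonneg hb1' hb2
      _ = M * volume.real S + C₁ / L * (2 * n * omegaN n * L + ∫ x in expAnnulus n L, f x) := by
          rw [integral_add hj1.integrableOn hj2.integrableOn, setIntegral_indicator hSm,
            setIntegral_indicator hAm, inter_eq_right.2 hSU, inter_eq_right.2 hAU,
            setIntegral_const, integral_const_mul, integral_add
              (integrableOn_norm_pow_inv_expAnnulus L) (hfU.mono_set hAU),
            setIntegral_norm_pow_inv_expAnnulus hn hL, smul_eq_mul, mul_comm M]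
      _ = M * volume.real S + C₁ * (2 * n * omegaN n + (∫ x in expAnnulus n L, f x) / L) := by
          field_simp
      _ ≤ _ := by
          have h1 : ∫ x in expAnnulus n L, f x ≤ ∫ x in U, f x :=
            setIntegral_mono_set hfU (Filter.Eventually.of_forall hf0) hAU.eventuallyLE
          have h0 : 0 ≤ ∫ x in expAnnulus n L, f x := integral_nonneg hf0
          have h2 : (∫ x in expAnnulus n L, f x) / L ≤ ∫ x in U, f x := (div_le_self h0 hL).trans h1
          gcongr
  have hnn : ∀ x, 0 ≤ η x ^ n * (‖gradient u x‖ ^ n * testDeriv (n - 1) δ L (u x)) := fun x =>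
    mul_nonneg (pow_nonneg (hη0 x) _) (mul_nonneg (by positivity) (hDpos _).le)
  calc _ ≤ ∫⁻ x in U, ENNReal.ofReal
        (η x ^ n * (‖gradient u x‖ ^ n * testDeriv (n - 1) δ L (u x))) := by
        refine (setLIntegral_mono' (measurableSet_ball.inter
          (isClosed_le continuous_const continuous_norm).measurableSet) fun x hx => ?_).trans
          (lintegral_mono_set fun x hx => ?_)
        · have h1 : η x = 1 := by
            rw [hη]
            simp only
            rw [logCutoff_eq_one hL hx.2, χ.one_of_mem_closedBall (ball_subset_closedBall hx.1),
              one_mul]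
          rw [h1, one_pow, one_mul]
          exact ENNReal.ofReal_le_ofReal (mul_le_mul_of_nonneg_left
            (softplusWeight_le_testDeriv _ _ hL _) (by positivity))
        · refine ⟨hχ (closedBall_subset_closedBall χ.rIn_lt_rOut.le
            (ball_subset_closedBall hx.1)), fun h => ?_⟩
          have h1 : Real.exp (-L) ≤ ‖x‖ := hx.2
          rw [mem_singleton_iff.1 h, norm_zero] at h1
          exact absurd h1 (not_le.2 (Real.exp_pos _))
    _ = ENNReal.ofReal (∫ x in U, η x ^ n * (‖gradient u x‖ ^ n * testDeriv (n - 1) δ L (u x))) :=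
        (ofReal_integral_eq_lintegral_ofReal hI (Filter.Eventually.of_forall hnn)).symm
    _ ≤ _ := by
        refine ENNReal.ofReal_le_ofReal (hle.trans ?_)
        gcongr

/-- Near the origin, the energy of `u` weighted by `softplusWeight` is finite. -/
lemma lintegral_norm_gradient_pow_mul_softplusWeight_lt_top (hn : 2 ≤ n) {α : ℝ}
    {Ω : Set (EuclideanSpace ℝ (Fin n))} (hΩ : IsOpen Ω)
    {u : EuclideanSpace ℝ (Fin n) → ℝ} (hu : ContDiffOn ℝ 1 u (Ω \ {0}))
    (hsol : IsWeakNSol n (Ω \ {0}) u (fun x => ‖x‖ ^ ((n : ℝ) * α) * Real.exp (u x)))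
    (hint : IntegrableOn (fun x => ‖x‖ ^ ((n : ℝ) * α) * Real.exp (u x)) Ω)
    {δ : ℝ} (hδ : 0 < δ) {r : ℝ} (hr : 0 < r) (hrΩ : closedBall 0 (2 * r) ⊆ Ω) :
    ∫⁻ x in ball (0 : EuclideanSpace ℝ (Fin n)) r \ {0},
      ENNReal.ofReal (‖gradient u x‖ ^ n * softplusWeight (n - 1) δ (u x)) < ⊤ := by
  let χ : ContDiffBump (0 : EuclideanSpace ℝ (Fin n)) := ⟨r, 2 * r, hr, by linarith⟩
  obtain ⟨C, hC⟩ := exists_integral_norm_gradient_pow_mul_softplusWeight_le hn hΩ hu hsol hint hδ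
    χ hrΩ
  have hlim : Tendsto (fun k : ℕ => Real.exp (-(k : ℝ))) atTop (𝓝 0) :=
    Real.tendsto_exp_neg_atTop_nhds_zero.comp tendsto_natCast_atTop_atTop
  obtain ⟨k₀, hk₀⟩ := eventually_atTop.1 (hlim.eventually (gt_mem_nhds hr))
  refine (setLIntegral_diff_zero_le (max n k₀) fun k hk => hC k ?_ ?_).trans_lt
    ENNReal.ofReal_lt_top
  · exact_mod_cast (le_max_left _ _).trans hk
  · exact hk₀ k ((le_max_right _ _).trans hk)

end EnergyBound

section Sobolev

variable {n : ℕ}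

lemma finrank_holderConjugate (hn : 2 ≤ n) :
    Real.HolderConjugate (Module.finrank ℝ (EuclideanSpace ℝ (Fin n)))
      (Real.conjExponent n) := by
  rw [finrank_euclideanSpace_fin]
  exact Real.HolderConjugate.conjExponent (by exact_mod_cast (by omega : 1 < n))

/-- Gagliardo-Nirenberg-Sobolev inequality for bounded functions which are `C¹` off the origin. -/
lemma lintegral_bump_mul_pow_le (hn : 2 ≤ n) {R B : ℝ}
    {F : EuclideanSpace ℝ (Fin n) → ℝ} (hF : ContDiffOn ℝ 1 F (ball 0 R \ {0}))
    (hB : ∀ x ∈ ball (0 : EuclideanSpace ℝ (Fin n)) R \ {0}, |F x| ≤ B)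
    (χ : ContDiffBump (0 : EuclideanSpace ℝ (Fin n))) (hχ : χ.rOut < R) :
    ∫⁻ x, ‖χ x * F x‖ₑ ^ Real.conjExponent n ≤
      lintegralPowLePowLIntegralFDerivConst (volume : Measure (EuclideanSpace ℝ (Fin n)))
        (Real.conjExponent n) *
      (∫⁻ x in ball 0 R \ {0}, ENNReal.ofReal (χ x * ‖fderiv ℝ F x‖ + |F x| * ‖fderiv ℝ χ x‖)) ^
        Real.conjExponent n := by
  have hconj := finrank_holderConjugate hn
  set p := Real.conjExponent n
  set S := lintegralPowLePowLIntegralFDerivConst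
    (volume : Measure (EuclideanSpace ℝ (Fin n))) p with hS
  set U : Set (EuclideanSpace ℝ (Fin n)) := ball 0 R \ {0}
  have hU : IsOpen U := isOpen_ball.sdiff isClosed_singleton
  set A := ∫⁻ x in U, ENNReal.ofReal (χ x * ‖fderiv ℝ F x‖ + |F x| * ‖fderiv ℝ χ x‖)
  have hp0 : 0 < p := hconj.symm.pos
  have : Nonempty (Fin n) := ⟨⟨0, by omega⟩⟩
  obtain ⟨C, hC, hlc⟩ := exists_norm_fderiv_logCutoff_le (E := EuclideanSpace ℝ (Fin n))
  set I := ∫⁻ x in U, ENNReal.ofReal (|B| * C * ‖x‖⁻¹)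
  have hIfin : I ≠ ⊤ :=
    (((integrableOn_norm_inv_ball hn R).mono_set
      (Set.sdiff_subset : U ⊆ ball 0 R)).const_mul _).lintegral_lt_top.ne
  have key : ∀ k : ℕ, 1 ≤ k → ∫⁻ x in univ ∩ {x | Real.exp (-(k : ℝ)) ≤ ‖x‖},
      ‖χ x * F x‖ₑ ^ p ≤ S * (A + (k : ENNReal)⁻¹ * I) ^ p := by
    intro k hk
    have hk1 : (1 : ℝ) ≤ k := by exact_mod_cast hk
    have hk0 : (0 : ℝ) < k := by linarith
    set η : EuclideanSpace ℝ (Fin n) → ℝ := fun x => χ x * logCutoff k x with hη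
    have hηU : tsupport η ⊆ U := (tsupport_bump_mul_logCutoff_subset χ hk1).trans
      (Set.sdiff_subset_sdiff_left (closedBall_subset_ball hχ))
    have hh : ContDiff ℝ 1 fun x => η x * F x :=
      (contDiff_bump_mul_logCutoff χ _).mul_of_tsupport_subset hU hηU hF
    have hhc : HasCompactSupport fun x => η x * F x :=
      (hasCompactSupport_bump_mul_logCutoff χ _).mul_right
    have hgrad : ∫⁻ x, ‖fderiv ℝ (fun x => η x * F x) x‖ₑ ≤ A + (k : ENNReal)⁻¹ * I := by
      calc _ ≤ ∫⁻ x, U.indicator (fun x =>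
              ENNReal.ofReal (χ x * ‖fderiv ℝ F x‖ + |F x| * ‖fderiv ℝ χ x‖) +
              (k : ENNReal)⁻¹ * ENNReal.ofReal (|B| * C * ‖x‖⁻¹)) x := by
            refine lintegral_mono fun x => ?_
            by_cases hx : x ∈ U
            · rw [indicator_of_mem hx]
              have h1 : ‖fderiv ℝ (fun x => η x * F x) x‖ ≤
                  (χ x * ‖fderiv ℝ F x‖ + |F x| * ‖fderiv ℝ χ x‖) +
                    (k : ℝ)⁻¹ * (|B| * C * ‖x‖⁻¹) := by
                have hd1 : DifferentiableAt ℝ η x :=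
                  (contDiff_bump_mul_logCutoff χ _).differentiable one_ne_zero x
                have hd2 : DifferentiableAt ℝ F x :=
                  (hF.contDiffAt (hU.mem_nhds hx)).differentiableAt one_ne_zero
                rw [fderiv_fun_mul hd1 hd2]
                refine (norm_add_le _ _).trans ?_
                rw [norm_smul, norm_smul, Real.norm_eq_abs, Real.norm_eq_abs,
                  abs_of_nonneg (bump_mul_logCutoff_nonneg χ _ x)]
                have e1 : η x ≤ χ x := mul_le_of_le_one_right χ.nonneg (logCutoff_le_one _ x)
                have e2 := norm_fderiv_bump_mul_logCutoff_le χ k x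
                have e3 := hlc k hk1 x
                have e4 := hB x hx
                have e5 : |F x| * ‖fderiv ℝ η x‖ ≤ |F x| * ‖fderiv ℝ χ x‖ +
                    |B| * (C / (k * ‖x‖)) := by
                  refine (mul_le_mul_of_nonneg_left (e2.trans (add_le_add_right e3 _))
                    (abs_nonneg _)).trans ?_
                  rw [mul_add]
                  refine add_le_add_right (mul_le_mul_of_nonneg_right
                    (e4.trans (le_abs_self B)) (by positivity)) _
                have e6 : (k : ℝ)⁻¹ * (|B| * C * ‖x‖⁻¹) = |B| * (C / (k * ‖x‖)) := by
                  rw [div_eq_mul_inv, mul_inv]; ring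
                have e7 := mul_le_mul_of_nonneg_right e1 (norm_nonneg (fderiv ℝ F x))
                rw [e6]
                linarith
              rw [← ofReal_norm]
              refine (ENNReal.ofReal_le_ofReal h1).trans (ENNReal.ofReal_add_le.trans_eq ?_)
              rw [ENNReal.ofReal_mul (by positivity), ENNReal.ofReal_inv_of_pos hk0,
                ENNReal.ofReal_natCast]
            · have hs : x ∉ tsupport fun x => η x * F x := fun h =>
                hx (hηU (tsupport_mul_subset_left h))
              have : fderiv ℝ (fun x => η x * F x) x = 0 := by
                by_contra hne
                exact hs (support_fderiv_subset ℝ hne)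
              rw [← ofReal_norm, this, norm_zero, ENNReal.ofReal_zero]
              exact zero_le
        _ = A + (k : ENNReal)⁻¹ * I := by
            rw [lintegral_indicator hU.measurableSet, lintegral_add_right _ (by fun_prop),
              lintegral_const_mul _ (by fun_prop)]
    calc _ ≤ ∫⁻ x, ‖η x * F x‖ₑ ^ p := by
          refine (setLIntegral_mono' (MeasurableSet.univ.inter
            (isClosed_le continuous_const continuous_norm).measurableSet) fun x hx => ?_).trans
            (setLIntegral_le_lintegral _ _)
          rw [hη]
          simp only
          rw [logCutoff_eq_one hk1 hx.2, mul_one]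
      _ ≤ S * (∫⁻ x, ‖fderiv ℝ (fun x => η x * F x) x‖ₑ) ^ p :=
          lintegral_pow_le_pow_lintegral_fderiv volume hh hhc hconj
      _ ≤ _ := by gcongr
  have hlim : Tendsto (fun k : ℕ => (S : ENNReal) * (A + (k : ENNReal)⁻¹ * I) ^ p) atTop
      (𝓝 (S * A ^ p)) := by
    refine ENNReal.Tendsto.const_mul ?_ (Or.inr ENNReal.coe_ne_top)
    refine (ENNReal.continuous_rpow_const.tendsto _).comp ?_
    have h1 : Tendsto (fun k : ℕ => (k : ENNReal)⁻¹ * I) atTop (𝓝 (0 * I)) :=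
      ENNReal.Tendsto.mul_const ENNReal.tendsto_inv_nat_nhds_zero (Or.inr hIfin)
    simpa using tendsto_const_nhds.add h1
  have hfinal : ∫⁻ x in univ \ {0}, ‖χ x * F x‖ₑ ^ p ≤ S * A ^ p := by
    refine setLIntegral_diff_zero_le 1 fun k hk => ?_
    refine ge_of_tendsto hlim ?_
    filter_upwards [eventually_ge_atTop k] with j hj
    refine (lintegral_mono_set ?_).trans (key j (hk.trans hj))
    refine inter_subset_inter_right _ fun x hx => ?_
    have h1 : Real.exp (-(k : ℝ)) ≤ ‖x‖ := hx
    have h2 : Real.exp (-(j : ℝ)) ≤ Real.exp (-(k : ℝ)) :=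
      Real.exp_le_exp.2 (neg_le_neg (by exact_mod_cast hj))
    exact h2.trans h1
  rwa [setLIntegral_congr (t := univ) (by
    exact sdiff_null_ae_eq_self (measure_singleton 0)), setLIntegral_univ] at hfinal

end Sobolev

section Moments

/-- A bounded approximation of `(1 + s) ^ p` for `0 ≤ s`. -/
noncomputable def truncPow (p : ℕ) (N s : ℝ) : ℝ := ((1 + s) * N / (N + s)) ^ p

lemma hasDerivAt_truncPow (p : ℕ) {N s : ℝ} (hN : 1 ≤ N) (hs : 0 ≤ s) :
    HasDerivAt (truncPow p N) (p * truncPow p N s * ((N - 1) / ((N + s) * (1 + s)))) s := by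
  have h0 : 0 < N + s := by linarith
  have h := ((((hasDerivAt_id' s).const_add 1).mul_const N).fun_div ((hasDerivAt_id' s).const_add N)
    h0.ne').fun_pow p
  refine h.congr_deriv ?_
  unfold truncPow
  have h1 : 0 < 1 + s := by linarith
  have h2 : 0 < N := by linarith
  rcases p with _ | p
  · simp
  · rw [Nat.add_sub_cancel, pow_succ _ p]
    field_simp
    ring

lemma truncPow_nonneg (p : ℕ) {N s : ℝ} (hN : 1 ≤ N) (hs : 0 ≤ s) : 0 ≤ truncPow p N s := by
  unfold truncPow
  have : 0 < N := by linarith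
  positivity

lemma truncPow_le_pow (p : ℕ) {N s : ℝ} (hN : 1 ≤ N) (hs : 0 ≤ s) :
    truncPow p N s ≤ (1 + s) ^ p := by
  unfold truncPow
  have h0 : 0 < N := by linarith
  refine pow_le_pow_left₀ (by positivity) ?_ p
  rw [div_le_iff₀ (by linarith)]
  nlinarith

lemma truncPow_le_pow_trunc (p : ℕ) {N s : ℝ} (hN : 1 ≤ N) (hs : 0 ≤ s) :
    truncPow p N s ≤ N ^ p := by
  unfold truncPow
  have h0 : 0 < N := by linarith
  refine pow_le_pow_left₀ (by positivity) ?_ p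
  rw [div_le_iff₀ (by linarith)]
  nlinarith

lemma tendsto_truncPow (p : ℕ) (s : ℝ) :
    Tendsto (fun N : ℕ => truncPow p (N + 1 : ℝ) s) atTop (𝓝 ((1 + s) ^ p)) := by
  have h1 : Tendsto (fun N : ℕ => (N : ℝ) + 1) atTop atTop :=
    tendsto_natCast_atTop_atTop.atTop_add tendsto_const_nhds
  have h2 : Tendsto (fun y : ℝ => (1 + s) * (1 - s / (y + s))) atTop (𝓝 ((1 + s) * (1 - 0))) :=
    ((tendsto_const_nhds.div_atTop
      (tendsto_id.atTop_add tendsto_const_nhds)).const_sub 1).const_mul _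
  have h3 : Tendsto (fun y : ℝ => ((1 + s) * y / (y + s)) ^ p) atTop (𝓝 ((1 + s) ^ p)) := by
    rw [sub_zero, mul_one] at h2
    refine (h2.congr' ?_).pow p
    filter_upwards [eventually_gt_atTop (-s)] with y hy
    have : 0 < y + s := by linarith
    field_simp
    ring
  exact h3.comp h1

variable {n : ℕ}

lemma norm_fderiv_truncPow_comp_le (p : ℕ) {N : ℝ} (hN : 1 ≤ N)
    {w : EuclideanSpace ℝ (Fin n) → ℝ} {x : EuclideanSpace ℝ (Fin n)} (hw0 : 0 ≤ w x)
    (hw : DifferentiableAt ℝ w x) :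
    ‖fderiv ℝ (fun x => truncPow p N (w x)) x‖ ≤
      p * truncPow p N (w x) * (‖fderiv ℝ w x‖ / (1 + w x)) := by
  have h := ((hasDerivAt_truncPow p hN hw0).comp_hasFDerivAt x hw.hasFDerivAt).fderiv
  have hZ := truncPow_nonneg p hN hw0
  have h1 : 0 < 1 + w x := by linarith
  have h2 : 0 < N + w x := by linarith
  have h3 : fderiv ℝ (fun x => truncPow p N (w x)) x = _ := h
  rw [h3, norm_smul, Real.norm_eq_abs, abs_of_nonneg
    (mul_nonneg (by positivity) (div_nonneg (by linarith) (by positivity)))]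
  have h4 : (N - 1) / ((N + w x) * (1 + w x)) ≤ 1 / (1 + w x) := by
    rw [div_le_div_iff₀ (by positivity) h1]
    nlinarith
  calc _ ≤ p * truncPow p N (w x) * (1 / (1 + w x)) * ‖fderiv ℝ w x‖ := by gcongr
    _ = _ := by ring

lemma contDiffOn_truncPow_comp (p : ℕ) {N : ℝ} (hN : 1 ≤ N)
    {w : EuclideanSpace ℝ (Fin n) → ℝ} (hw0 : ∀ x, 0 ≤ w x) {U : Set (EuclideanSpace ℝ (Fin n))}
    (hw : ContDiffOn ℝ 1 w U) : ContDiffOn ℝ 1 (fun x => truncPow p N (w x)) U := by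
  unfold truncPow
  refine ContDiffOn.pow (ContDiffOn.div ((contDiffOn_const.add hw).mul contDiffOn_const)
    (contDiffOn_const.add hw) fun x _ => ?_) p
  have := hw0 x
  exact (by linarith : 0 < N + w x).ne'

lemma ENNReal.le_two_mul_of_le_half_add {X c : ENNReal} (hX : X ≠ ⊤) (h : X ≤ X / 2 + c) :
    X ≤ 2 * c := by
  have h1 : X / 2 ≤ c := by
    have h2 : X / 2 + X / 2 ≤ X / 2 + c := by rwa [ENNReal.add_halves]
    exact (ENNReal.add_le_add_iff_left (ENNReal.div_ne_top hX two_ne_zero)).1 h2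
  calc X = 2 * (X / 2) := (ENNReal.mul_div_cancel two_ne_zero ENNReal.ofNat_ne_top).symm
    _ ≤ 2 * c := by gcongr

/-- If the logarithmic gradient of `1 + w` has small `Lⁿ` norm, then `(1 + w) ^ p` is integrable. -/
lemma integrableOn_one_add_pow_of_small (hn : 2 ≤ n) {R : ℝ} {w : EuclideanSpace ℝ (Fin n) → ℝ}
    (hw : ContDiffOn ℝ 1 w (ball 0 R \ {0})) (hw0 : ∀ x, 0 ≤ w x) (p : ℕ)
    (χ : ContDiffBump (0 : EuclideanSpace ℝ (Fin n))) (hχ : χ.rOut < R)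
    (hsmall : (lintegralPowLePowLIntegralFDerivConst
        (volume : Measure (EuclideanSpace ℝ (Fin n))) (Real.conjExponent n) : ENNReal) ^
          (1 / Real.conjExponent n) * p *
      (∫⁻ x in ball 0 R \ {0}, ENNReal.ofReal (‖fderiv ℝ w x‖ / (1 + w x)) ^ (n : ℝ)) ^
        (1 / (n : ℝ)) ≤ 1 / 2) :
    IntegrableOn (fun x => (1 + w x) ^ p) (ball 0 χ.rIn) := by
  set U : Set (EuclideanSpace ℝ (Fin n)) := ball 0 R \ {0}
  have hU : IsOpen U := isOpen_ball.sdiff isClosed_singleton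
  have hconj : Real.HolderConjugate (n : ℝ) (Real.conjExponent n) :=
    Real.HolderConjugate.conjExponent (by exact_mod_cast (by omega : 1 < n))
  set s := Real.conjExponent n
  have hs0 : 0 < s := hconj.symm.pos
  have hs1 : 1 < s := hconj.symm.lt
  set S := (lintegralPowLePowLIntegralFDerivConst
        (volume : Measure (EuclideanSpace ℝ (Fin n))) s : ENNReal) ^ (1 / s) with hS
  have hSfin : S ≠ ⊤ := ENNReal.rpow_ne_top_of_nonneg (by positivity) ENNReal.coe_ne_top
  set a : EuclideanSpace ℝ (Fin n) → ENNReal :=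
    fun x => ENNReal.ofReal (‖fderiv ℝ w x‖ / (1 + w x)) with ha
  set Λ := (∫⁻ x in U, a x ^ (n : ℝ)) ^ (1 / (n : ℝ)) with hΛ
  set D := ∫⁻ x in U, ENNReal.ofReal ((1 + w x) ^ p * ‖fderiv ℝ χ x‖)
  have hwc : ContinuousOn w U := hw.continuousOn
  have hDc : ContinuousOn (fun x => (1 + w x) ^ p * ‖fderiv ℝ χ x‖) U :=
    ((continuousOn_const.add hwc).pow p).mul
      ((χ.contDiff (n := 1)).continuous_fderiv one_ne_zero).norm.continuousOn
  have hDfin : D ≠ ⊤ := by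
    set K : Set (EuclideanSpace ℝ (Fin n)) := closedBall 0 χ.rOut \ ball 0 χ.rIn
    have hKc : IsCompact K := (isCompact_closedBall 0 χ.rOut).diff isOpen_ball
    have hKU : K ⊆ U := fun x hx => ⟨closedBall_subset_ball hχ hx.1, fun h => hx.2 (by
      rw [mem_singleton_iff.1 h]; exact mem_ball_self χ.rIn_pos)⟩
    have hle : D ≤ ∫⁻ x in K, ENNReal.ofReal ((1 + w x) ^ p * ‖fderiv ℝ χ x‖) := by
      rw [← lintegral_indicator hKc.measurableSet]
      refine (setLIntegral_le_lintegral _ _).trans' (lintegral_mono fun x => ?_)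
      by_cases hx : x ∈ K
      · rw [indicator_of_mem hx]
      · have : fderiv ℝ χ x = 0 := by
          refine fderiv_contDiffBump_eq_zero χ ?_
          by_contra! hcon
          exact hx ⟨by simpa using hcon.2, by simpa using hcon.1⟩
        rw [this, norm_zero, mul_zero, ENNReal.ofReal_zero]
        exact zero_le
    exact (hle.trans_lt ((hDc.mono hKU).integrableOn_compact hKc).lintegral_lt_top).ne
  have ham : AEMeasurable a (volume.restrict U) := by
    refine (ContinuousOn.aemeasurable ?_ hU.measurableSet).ennreal_ofReal
    refine ContinuousOn.div (hw.continuousOn_fderiv_of_isOpen hU le_rfl).norm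
      (continuousOn_const.add hwc) fun x _ => ?_
    have := hw0 x
    exact (by linarith : 0 < 1 + w x).ne'
  have hbound : ∀ N : ℝ, 1 ≤ N →
      ∫⁻ x, ‖χ x * truncPow p N (w x)‖ₑ ^ s ≤ (2 * (S * D)) ^ s := by
    intro N hN
    have hZ : ContDiffOn ℝ 1 (fun x => truncPow p N (w x)) U := contDiffOn_truncPow_comp p hN hw0 hw
    have hZ0 : ∀ x, 0 ≤ truncPow p N (w x) := fun x => truncPow_nonneg p hN (hw0 x)
    set J := ∫⁻ x, ‖χ x * truncPow p N (w x)‖ₑ ^ s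
    have hJfin : J ≠ ⊤ := by
      have hle : J ≤ ∫⁻ _ in closedBall (0 : EuclideanSpace ℝ (Fin n)) χ.rOut,
          ENNReal.ofReal (N ^ p) ^ s := by
        rw [← lintegral_indicator isClosed_closedBall.measurableSet]
        refine lintegral_mono fun x => ?_
        by_cases hx : x ∈ closedBall (0 : EuclideanSpace ℝ (Fin n)) χ.rOut
        · rw [indicator_of_mem hx, Real.enorm_eq_ofReal (mul_nonneg χ.nonneg (hZ0 x))]
          refine ENNReal.rpow_le_rpow (ENNReal.ofReal_le_ofReal ?_) hs0.le
          exact (mul_le_of_le_one_left (hZ0 x) χ.le_one).trans (truncPow_le_pow_trunc p hN (hw0 x))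
        · have : χ x = 0 := χ.zero_of_le_dist (by
            simpa using (not_le.1 fun h => hx (by simpa using h)).le)
          rw [this, zero_mul, enorm_zero, ENNReal.zero_rpow_of_pos hs0]
          exact zero_le
      refine (hle.trans_lt ?_).ne
      rw [setLIntegral_const]
      exact ENNReal.mul_lt_top (ENNReal.rpow_lt_top_of_nonneg hs0.le ENNReal.ofReal_ne_top)
        measure_closedBall_lt_top
    have hsob := lintegral_bump_mul_pow_le hn hZ (B := N ^ p) (fun x _ => by
      rw [abs_of_nonneg (hZ0 x)]; exact truncPow_le_pow_trunc p hN (hw0 x)) χ hχ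
    have hgm : AEMeasurable (fun x => ‖χ x * truncPow p N (w x)‖ₑ) (volume.restrict U) :=
      (ContinuousOn.aemeasurable (χ.continuous.continuousOn.mul hZ.continuousOn)
        hU.measurableSet).enorm
    have hRHS : ∫⁻ x in U, ENNReal.ofReal (χ x * ‖fderiv ℝ (fun x => truncPow p N (w x)) x‖ +
        |truncPow p N (w x)| * ‖fderiv ℝ χ x‖) ≤ p * (Λ * J ^ (1 / s)) + D := by
      calc _ ≤ ∫⁻ x in U, (p * (a x * ‖χ x * truncPow p N (w x)‖ₑ) +
            ENNReal.ofReal ((1 + w x) ^ p * ‖fderiv ℝ χ x‖)) := by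
            refine setLIntegral_mono' hU.measurableSet fun x hx => ?_
            have h1 := norm_fderiv_truncPow_comp_le p hN (hw0 x)
              ((hw.contDiffAt (hU.mem_nhds hx)).differentiableAt one_ne_zero)
            have h2 := mul_le_mul_of_nonneg_left h1 (χ.nonneg (x := x))
            have h3 := mul_le_mul_of_nonneg_right (truncPow_le_pow p hN (hw0 x))
              (norm_nonneg (fderiv ℝ χ x))
            have h4 : 0 ≤ ‖fderiv ℝ w x‖ / (1 + w x) :=
              div_nonneg (norm_nonneg _) (by linarith [hw0 x])
            rw [abs_of_nonneg (hZ0 x), Real.enorm_eq_ofReal (mul_nonneg χ.nonneg (hZ0 x)), ha,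
              ← ENNReal.ofReal_mul h4, ← ENNReal.ofReal_natCast,
              ← ENNReal.ofReal_mul (by positivity)]
            refine (ENNReal.ofReal_le_ofReal (add_le_add (h2.trans_eq ?_) h3)).trans
              ENNReal.ofReal_add_le
            ring
        _ = p * (∫⁻ x in U, a x * ‖χ x * truncPow p N (w x)‖ₑ) + D := by
            have hagm : AEMeasurable (fun x => a x * ‖χ x * truncPow p N (w x)‖ₑ)
                (volume.restrict U) := ham.mul hgm
            rw [lintegral_add_left' (hagm.const_mul _), lintegral_const_mul'' _ hagm]
        _ ≤ p * (Λ * J ^ (1 / s)) + D := by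
            gcongr
            refine (ENNReal.lintegral_mul_le_Lp_mul_Lq (volume.restrict U) hconj ham hgm).trans ?_
            rw [hΛ]
            gcongr
            exact setLIntegral_le_lintegral _ _
    have hJs : J ^ (1 / s) ≠ ⊤ := ENNReal.rpow_ne_top_of_nonneg (by positivity) hJfin
    have hX : J ^ (1 / s) ≤ J ^ (1 / s) / 2 + S * D := by
      have h1 : J ^ (1 / s) ≤ S * (p * (Λ * J ^ (1 / s)) + D) := by
        refine (ENNReal.rpow_le_rpow hsob (by positivity)).trans ?_
        rw [ENNReal.mul_rpow_of_nonneg _ _ (by positivity), ← ENNReal.rpow_mul,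
          mul_one_div_cancel hs0.ne', ENNReal.rpow_one]
        gcongr
      calc J ^ (1 / s) ≤ S * (p * (Λ * J ^ (1 / s)) + D) := h1
        _ = S * p * Λ * J ^ (1 / s) + S * D := by ring
        _ ≤ 1 / 2 * J ^ (1 / s) + S * D := by gcongr
        _ = J ^ (1 / s) / 2 + S * D := by rw [one_div, ENNReal.div_eq_inv_mul]
    have h2 := ENNReal.le_two_mul_of_le_half_add hJs hX
    calc J = (J ^ (1 / s)) ^ s := by
          rw [← ENNReal.rpow_mul, one_div_mul_cancel hs0.ne', ENNReal.rpow_one]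
      _ ≤ _ := ENNReal.rpow_le_rpow h2 hs0.le
  set V : Set (EuclideanSpace ℝ (Fin n)) := ball 0 χ.rIn \ {0}
  have hVo : IsOpen V := isOpen_ball.sdiff isClosed_singleton
  have hVU : V ⊆ U := Set.sdiff_subset_sdiff_left (ball_subset_ball (χ.rIn_lt_rOut.trans hχ).le)
  have hcont : ContinuousOn (fun x => (1 + w x) ^ p) V :=
    (continuousOn_const.add (hwc.mono hVU)).pow p
  have hfatou : ∫⁻ x in V, ENNReal.ofReal ((1 + w x) ^ p) ^ s ≤ (2 * (S * D)) ^ s := by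
    calc _ = ∫⁻ x in V, liminf (fun N : ℕ =>
          ENNReal.ofReal (truncPow p (N + 1 : ℝ) (w x)) ^ s) atTop := by
          refine lintegral_congr fun x => (Tendsto.liminf_eq ?_).symm
          exact (ENNReal.continuous_rpow_const.tendsto _).comp
            (ENNReal.tendsto_ofReal (tendsto_truncPow p (w x)))
      _ ≤ liminf (fun N : ℕ => ∫⁻ x in V, ENNReal.ofReal (truncPow p (N + 1 : ℝ) (w x)) ^ s)
          atTop := by
          refine lintegral_liminf_le' fun N => ?_
          exact ((contDiffOn_truncPow_comp p (by linarith [(Nat.cast_nonneg N : (0 : ℝ) ≤ N)]) hw0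
            (hw.mono hVU)).continuousOn.aemeasurable
              hVo.measurableSet).ennreal_ofReal.pow_const s
      _ ≤ _ := by
          refine Filter.liminf_le_of_le (by isBoundedDefault) fun b hb => ?_
          obtain ⟨N, hN⟩ := hb.exists
          have hN1 : (1 : ℝ) ≤ N + 1 := by linarith [(Nat.cast_nonneg N : (0 : ℝ) ≤ N)]
          refine hN.trans ((?_ : _ ≤ _).trans (hbound (N + 1) hN1))
          refine (setLIntegral_mono' hVo.measurableSet fun x hx => ?_).trans
            (setLIntegral_le_lintegral V _)
          rw [χ.one_of_mem_closedBall (ball_subset_closedBall hx.1), one_mul,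
            Real.enorm_eq_ofReal (truncPow_nonneg p hN1 (hw0 x))]
  have hVint : IntegrableOn (fun x => (1 + w x) ^ p) V := by
    refine ⟨hcont.aestronglyMeasurable hVo.measurableSet, ?_⟩
    rw [hasFiniteIntegral_iff_ofReal (Filter.Eventually.of_forall fun x =>
      pow_nonneg (by linarith [hw0 x]) p)]
    refine lt_of_le_of_lt ?_ (hfatou.trans_lt (ENNReal.rpow_lt_top_of_nonneg hs0.le
      (ENNReal.mul_ne_top ENNReal.ofNat_ne_top (ENNReal.mul_ne_top hSfin hDfin))))
    refine lintegral_mono fun x => ?_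
    have h1 : (1 : ENNReal) ≤ ENNReal.ofReal ((1 + w x) ^ p) := by
      rw [ENNReal.one_le_ofReal]
      exact one_le_pow₀ (by linarith [hw0 x])
    calc _ = ENNReal.ofReal ((1 + w x) ^ p) ^ (1 : ℝ) := (ENNReal.rpow_one _).symm
      _ ≤ _ := ENNReal.rpow_le_rpow_of_exponent_le h1 hs1.le
  have : Nonempty (Fin n) := ⟨⟨0, by omega⟩⟩
  exact hVint.congr_set_ae (sdiff_null_ae_eq_self (measure_singleton 0)).symm

lemma exists_integrableOn_one_add_pow (hn : 2 ≤ n) {R : ℝ} (hR : 0 < R)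
    {w : EuclideanSpace ℝ (Fin n) → ℝ}
    (hw : ContDiffOn ℝ 1 w (ball 0 R \ {0})) (hw0 : ∀ x, 0 ≤ w x)
    (hfin : ∫⁻ x in ball 0 R \ {0}, ENNReal.ofReal (‖fderiv ℝ w x‖ / (1 + w x)) ^ (n : ℝ) ≠ ⊤)
    (p : ℕ) : ∃ r > 0, IntegrableOn (fun x => (1 + w x) ^ p) (ball 0 r) := by
  have hvol : Tendsto (fun r : ℝ => volume (ball (0 : EuclideanSpace ℝ (Fin n)) r)) (𝓝[>] 0)
      (𝓝 0) := by
    have h1 : Tendsto (fun r : ℝ => ENNReal.ofReal (r ^ n) *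
        volume (ball (0 : EuclideanSpace ℝ (Fin n)) 1)) (𝓝[>] 0) (𝓝 0) := by
      have h2 : Tendsto (fun r : ℝ => ENNReal.ofReal (r ^ n)) (𝓝[>] 0) (𝓝 0) := by
        have h3 := ((ENNReal.continuous_ofReal.comp (continuous_pow n)).tendsto 0).mono_left
          (nhdsWithin_le_nhds (s := Ioi (0 : ℝ)))
        simpa [zero_pow (by omega : n ≠ 0), Function.comp_def] using h3
      simpa using ENNReal.Tendsto.mul_const h2 (Or.inr measure_ball_lt_top.ne)
    refine h1.congr' ?_
    filter_upwards [self_mem_nhdsWithin] with r hr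
    rw [Measure.addHaar_ball_of_pos _ _ hr, finrank_euclideanSpace_fin]
  have hint : Tendsto (fun r : ℝ => ∫⁻ x in ball (0 : EuclideanSpace ℝ (Fin n)) r,
      ENNReal.ofReal (‖fderiv ℝ w x‖ / (1 + w x)) ^ (n : ℝ) ∂(volume.restrict (ball 0 R \ {0})))
      (𝓝[>] 0) (𝓝 0) :=
    tendsto_setLIntegral_zero hfin (tendsto_of_tendsto_of_tendsto_of_le_of_le tendsto_const_nhds
      hvol (fun _ => zero_le) fun _ => Measure.restrict_apply_le _ _)
  have hn0 : (0 : ℝ) < 1 / n := by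
    have : (0 : ℝ) < n := by exact_mod_cast (by omega : 0 < n)
    positivity
  set c : ENNReal := (lintegralPowLePowLIntegralFDerivConst
    (volume : Measure (EuclideanSpace ℝ (Fin n))) (Real.conjExponent n) : ENNReal) ^
      (1 / Real.conjExponent n) * p with hc
  have hcfin : c ≠ ⊤ := by
    have h1 := (finrank_holderConjugate hn).symm.pos
    exact ENNReal.mul_ne_top (ENNReal.rpow_ne_top_of_nonneg (by positivity) ENNReal.coe_ne_top)
      (ENNReal.natCast_ne_top p)
  have hlim : Tendsto (fun r : ℝ => c * (∫⁻ x in ball (0 : EuclideanSpace ℝ (Fin n)) r,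
      ENNReal.ofReal (‖fderiv ℝ w x‖ / (1 + w x)) ^ (n : ℝ) ∂(volume.restrict (ball 0 R \ {0}))) ^
        (1 / (n : ℝ))) (𝓝[>] 0) (𝓝 0) := by
    have h1 := (ENNReal.continuous_rpow_const (y := 1 / (n : ℝ))).tendsto 0 |>.comp hint
    rw [ENNReal.zero_rpow_of_pos hn0] at h1
    simpa using ENNReal.Tendsto.const_mul h1 (Or.inr hcfin)
  have hhalf : (0 : ENNReal) < 1 / 2 := by simp
  obtain ⟨ρ, ⟨hρ, hρR⟩, hρ0⟩ := (((hlim.eventually (gt_mem_nhds hhalf)).and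
    (nhdsWithin_le_nhds (gt_mem_nhds hR))).and self_mem_nhdsWithin).exists
  have hρ0' : 0 < ρ := hρ0
  let χ : ContDiffBump (0 : EuclideanSpace ℝ (Fin n)) :=
    ⟨ρ / 3, ρ / 2, by positivity, by linarith⟩
  refine ⟨ρ / 3, by positivity, integrableOn_one_add_pow_of_small hn (R := ρ)
    (hw.mono (Set.sdiff_subset_sdiff_left (ball_subset_ball hρR.le))) hw0 p χ
    (half_lt_self hρ0') ?_⟩
  have hset : ball (0 : EuclideanSpace ℝ (Fin n)) ρ ∩ (ball 0 R \ {0}) = ball 0 ρ \ {0} := by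
    rw [← Set.inter_sdiff_assoc, inter_eq_left.2 (ball_subset_ball hρR.le)]
  rw [Measure.restrict_restrict measurableSet_ball, hset] at hρ
  exact hρ.le

end Moments

section LocalRegularity

variable {n : ℕ}

lemma exp_mul_le_of_norm_le_one (α : ℝ) {θ t : ℝ} (hθ0 : 0 ≤ θ) (hθ : θ * (2 * (1 + n * |α|)) ≤ 1)
    {x : EuclideanSpace ℝ (Fin n)} (hx0 : x ≠ 0) (hx : ‖x‖ ≤ 1) :
    Real.exp (θ * t) ≤ 1 + ‖x‖ ^ ((n : ℝ) * α) * Real.exp t + ‖x‖⁻¹ := by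
  have hx' : 0 < ‖x‖ := norm_pos_iff.2 hx0
  set l := Real.log ‖x‖ with hl
  have hl0 : l ≤ 0 := Real.log_nonpos hx'.le hx
  have e1 : ‖x‖ ^ ((n : ℝ) * α) * Real.exp t = Real.exp (l * (n * α) + t) := by
    rw [Real.rpow_def_of_pos hx', Real.exp_add]
  have e2 : ‖x‖⁻¹ = Real.exp (-l) := by rw [Real.exp_neg, hl, Real.exp_log hx']
  have hp1 := Real.exp_pos (l * (n * α) + t)
  have hp2 := Real.exp_pos (-l)
  rw [e1, e2]
  rcases le_total t 0 with ht | ht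
  · have : Real.exp (θ * t) ≤ 1 := Real.exp_le_one_iff.2 (mul_nonpos_of_nonneg_of_nonpos hθ0 ht)
    linarith
  rcases le_total (θ * t) (-l) with h | h
  · have := Real.exp_le_exp.2 h
    linarith
  · have hβ : 0 ≤ n * |α| := by positivity
    have h1 : -(l * (n * α)) ≤ n * |α| * (θ * t) := by
      have h2 : -l * (n * α) ≤ -l * (n * |α|) :=
        mul_le_mul_of_nonneg_left (mul_le_mul_of_nonneg_left (le_abs_self α) (Nat.cast_nonneg n))
          (by linarith)
      have h3 : -l * (n * |α|) ≤ θ * t * (n * |α|) := mul_le_mul_of_nonneg_right h hβ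
      linarith
    have h4 : θ * (2 * (1 + n * |α|)) * t ≤ 1 * t := mul_le_mul_of_nonneg_right hθ ht
    have h5 : 0 ≤ θ * t := mul_nonneg hθ0 ht
    have h6 : θ * t ≤ l * (n * α) + t := by nlinarith
    have := Real.exp_le_exp.2 h6
    linarith

lemma norm_fderiv_softplus_comp {u : EuclideanSpace ℝ (Fin n) → ℝ} {x : EuclideanSpace ℝ (Fin n)}
    (hu : DifferentiableAt ℝ u x) {δ : ℝ} (hδ : 0 ≤ δ) :
    ‖fderiv ℝ (fun x => softplus δ (u x)) x‖ =
      δ / (1 + Real.exp (δ * u x)) * ‖gradient u x‖ := by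
  have h : fderiv ℝ (fun x => softplus δ (u x)) x = _ :=
    ((hasDerivAt_softplus δ (u x)).comp_hasFDerivAt x hu.hasFDerivAt).fderiv
  rw [h, norm_smul, norm_gradient_eq, neg_div, norm_neg, Real.norm_eq_abs,
    abs_of_nonneg (by positivity)]

lemma norm_fderiv_softplus_comp_div_pow_le (hn : 2 ≤ n) {u : EuclideanSpace ℝ (Fin n) → ℝ}
    {x : EuclideanSpace ℝ (Fin n)} (hu : DifferentiableAt ℝ u x) {δ : ℝ} (hδ : 0 ≤ δ)
    (hδ1 : δ ≤ 1) :
    (‖fderiv ℝ (fun x => softplus δ (u x)) x‖ / (1 + softplus δ (u x))) ^ n ≤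
      ‖gradient u x‖ ^ n * softplusWeight (n - 1) δ (u x) := by
  obtain ⟨m, rfl⟩ : ∃ m, n = m + 1 := ⟨n - 1, by omega⟩
  have hm : (1 : ℝ) ≤ m := by exact_mod_cast (by omega : 1 ≤ m)
  have hs := softplus_pos δ (u x)
  have he := Real.exp_pos (δ * u x)
  rw [norm_fderiv_softplus_comp hu hδ, softplusWeight, Nat.add_sub_cancel, div_pow,
    mul_pow, div_pow]
  have h1 : δ ^ (m + 1) / (1 + Real.exp (δ * u x)) ^ (m + 1) ≤
      m * δ / (1 + Real.exp (δ * u x)) := by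
    have e1 : δ ^ (m + 1) ≤ δ := pow_le_of_le_one hδ hδ1 (Nat.succ_ne_zero m)
    have e2 : 1 + Real.exp (δ * u x) ≤ (1 + Real.exp (δ * u x)) ^ (m + 1) :=
      le_self_pow₀ (by linarith) (Nat.succ_ne_zero m)
    have e3 : δ ≤ m * δ := by nlinarith
    gcongr
    exact e1.trans e3
  calc _ ≤ m * δ / (1 + Real.exp (δ * u x)) * ‖gradient u x‖ ^ (m + 1) /
        (1 + softplus δ (u x)) ^ (m + 1) := by gcongr
    _ = _ := by
      field_simp

lemma Real.rpow_mul_rpow_le_add {a b q s : ℝ} {n : ℕ} (ha : 0 ≤ a) (hb : 0 ≤ b) (hq : 0 < q)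
    (hqn : q < n) (hs : s = q * n / (n - q)) : b ^ q * a ^ q ≤ a ^ n + b ^ s := by
  have hn : (0 : ℝ) < n := hq.trans hqn
  have hnq : 0 < n - q := by linarith
  have hconj : Real.HolderConjugate ((n : ℝ) / q) (n / (n - q)) := by
    rw [Real.holderConjugate_iff]
    refine ⟨(one_lt_div hq).2 hqn, ?_⟩
    field_simp
    ring
  have h := Real.young_inequality_of_nonneg (Real.rpow_nonneg ha q) (Real.rpow_nonneg hb q) hconj
  rw [← Real.rpow_mul ha, ← Real.rpow_mul hb, mul_div_cancel₀ _ hq.ne', Real.rpow_natCast,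
    ← mul_div_assoc, ← hs] at h
  have h1 : a ^ n / (n / q) ≤ a ^ n := div_le_self (by positivity) hconj.lt.le
  have h2 : b ^ s / (n / (n - q)) ≤ b ^ s := div_le_self (by positivity) hconj.symm.lt.le
  rw [mul_comm]
  linarith

lemma Real.mul_rpow_le_pow_add_pow {a b s : ℝ} {M : ℕ} (ha : 1 ≤ a) (hb : 1 ≤ b) (hs : 0 ≤ s)
    (hM : 2 * s ≤ M) : (a * b) ^ s ≤ a ^ M + b ^ M := by
  wlog h : a ≤ b generalizing a b
  · rw [mul_comm, add_comm]
    exact this hb ha (le_of_not_ge h)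
  have hb0 : 0 ≤ b := by linarith
  calc (a * b) ^ s ≤ (b ^ (2 : ℝ)) ^ s := by
        refine Real.rpow_le_rpow (by positivity) ?_ hs
        rw [Real.rpow_two, sq]
        exact mul_le_mul_of_nonneg_right h hb0
    _ = b ^ (2 * s) := (Real.rpow_mul hb0 _ _).symm
    _ ≤ b ^ (M : ℝ) := Real.rpow_le_rpow_of_exponent_le hb hM
    _ = b ^ M := Real.rpow_natCast _ _
    _ ≤ a ^ M + b ^ M := le_add_of_nonneg_left (by positivity)

lemma exists_integrableOn_ball (hn : 2 ≤ n) {α : ℝ}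
    {Ω : Set (EuclideanSpace ℝ (Fin n))} (hΩ : IsOpen Ω) (h0 : 0 ∈ Ω)
    {u : EuclideanSpace ℝ (Fin n) → ℝ} (hu : ContDiffOn ℝ 1 u (Ω \ {0}))
    (hsol : IsWeakNSol n (Ω \ {0}) u (fun x => ‖x‖ ^ ((n : ℝ) * α) * Real.exp (u x)))
    (hint : IntegrableOn (fun x => ‖x‖ ^ ((n : ℝ) * α) * Real.exp (u x)) Ω)
    {q : ℝ} (hq : 1 ≤ q) (hqn : q < n) :
    ∃ r > 0, IntegrableOn (fun x => |u x| ^ q + ‖gradient u x‖ ^ q) (ball 0 r) := by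
  have : Nonempty (Fin n) := ⟨⟨0, by omega⟩⟩
  obtain ⟨ε, hε, hεΩ⟩ := Metric.isOpen_iff.1 hΩ 0 h0
  set R := min 1 (ε / 4)
  have hR0 : 0 < R := by positivity
  have hR1 : R ≤ 1 := min_le_left _ _
  have hRΩ : closedBall 0 (2 * R) ⊆ Ω := (closedBall_subset_ball (by
    have : R ≤ ε / 4 := min_le_right _ _
    linarith)).trans hεΩ
  have hsub : ball (0 : EuclideanSpace ℝ (Fin n)) R \ {0} ⊆ Ω \ {0} :=
    Set.sdiff_subset_sdiff_left
      ((ball_subset_closedBall.trans (closedBall_subset_closedBall (by linarith))).trans hRΩ)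
  have hU : IsOpen (ball (0 : EuclideanSpace ℝ (Fin n)) R \ {0}) :=
    isOpen_ball.sdiff isClosed_singleton
  have huR := hu.mono hsub
  have hgradc := (hu.continuousOn_gradient_s8 (hΩ.sdiff isClosed_singleton)).mono hsub
  have hq0 : 0 < q := by linarith
  have hnq : 0 < n - q := by linarith
  obtain ⟨s, hs⟩ : ∃ s, s = q * n / (n - q) := ⟨_, rfl⟩
  have hqs : q ≤ s := by
    rw [hs, le_div_iff₀ hnq]
    nlinarith
  have hs0 : 0 < s := by linarith
  obtain ⟨M, hM⟩ := exists_nat_ge (2 * s)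
  have hM1 : (1 : ℝ) ≤ M := by linarith
  have hM0 : (0 : ℝ) < M := by linarith
  set θ : ℝ := (2 * (1 + n * |α|))⁻¹
  have hθ0 : 0 < θ := by positivity
  have hθ1 : θ ≤ 1 := inv_le_one_of_one_le₀ (by
    have : (0 : ℝ) ≤ n * |α| := by positivity
    linarith)
  set δ := θ / M with hδ
  have hδ0 : 0 < δ := by positivity
  have hδ1 : δ ≤ 1 := (div_le_self hθ0.le hM1).trans hθ1
  have hw : ContDiffOn ℝ 1 (fun x => softplus δ (u x)) (ball 0 R \ {0}) :=
    (contDiff_softplus δ).comp_contDiffOn huR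
  have hdiff : ∀ x ∈ ball (0 : EuclideanSpace ℝ (Fin n)) R \ {0}, DifferentiableAt ℝ u x :=
    fun x hx => (huR.contDiffAt (hU.mem_nhds hx)).differentiableAt one_ne_zero
  have henergy : ∫⁻ x in ball 0 R \ {0}, ENNReal.ofReal
      ((‖fderiv ℝ (fun x => softplus δ (u x)) x‖ / (1 + softplus δ (u x))) ^ n) < ⊤ := by
    refine lt_of_le_of_lt (setLIntegral_mono' hU.measurableSet fun x hx => ?_)
      (lintegral_norm_gradient_pow_mul_softplusWeight_lt_top hn hΩ hu hsol hint hδ0 hR0 hRΩ)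
    exact ENNReal.ofReal_le_ofReal
      (norm_fderiv_softplus_comp_div_pow_le hn (hdiff x hx) hδ0.le hδ1)
  have hwpos : ∀ x, 0 ≤ softplus δ (u x) := fun x => (softplus_pos δ (u x)).le
  have hlog0 : ∀ x, 0 ≤ ‖fderiv ℝ (fun x => softplus δ (u x)) x‖ / (1 + softplus δ (u x)) :=
    fun x => div_nonneg (norm_nonneg _) (by linarith [hwpos x])
  obtain ⟨r, hr0, hr⟩ := exists_integrableOn_one_add_pow hn hR0 hw hwpos (by
    convert henergy.ne using 4 with x
    rw [ENNReal.rpow_natCast, ENNReal.ofReal_pow (hlog0 x)]) M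
  have hlogint : IntegrableOn
      (fun x => (‖fderiv ℝ (fun x => softplus δ (u x)) x‖ / (1 + softplus δ (u x))) ^ n)
      (ball 0 R \ {0}) := by
    refine ⟨ContinuousOn.aestronglyMeasurable ?_ hU.measurableSet, ?_⟩
    · refine ((hw.continuousOn_fderiv_of_isOpen hU le_rfl).norm.div
        (continuousOn_const.add hw.continuousOn) fun x _ => ?_).pow n
      exact (by linarith [hwpos x] : 0 < 1 + softplus δ (u x)).ne'
    · rwa [hasFiniteIntegral_iff_ofReal (Filter.Eventually.of_forall fun x =>
        pow_nonneg (hlog0 x) n)]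
  have hexpint : IntegrableOn (fun x => (1 + Real.exp (δ * u x)) ^ M) (ball 0 R \ {0}) := by
    have hmaj : IntegrableOn (fun x => 2 ^ (M - 1) * (1 + (1 +
        ‖x‖ ^ ((n : ℝ) * α) * Real.exp (u x) + ‖x‖⁻¹))) (ball 0 R \ {0}) := by
      have hone : IntegrableOn (fun _ : EuclideanSpace ℝ (Fin n) => (1 : ℝ)) (ball 0 R \ {0}) :=
        integrableOn_const ((measure_mono Set.sdiff_subset).trans_lt measure_ball_lt_top).ne
      exact (hone.add ((hone.add (hint.mono_set (hsub.trans Set.sdiff_subset))).add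
        ((integrableOn_norm_inv_ball hn R).mono_set Set.sdiff_subset))).const_mul _
    refine hmaj.mono' (ContinuousOn.aestronglyMeasurable ((continuousOn_const.add
      (Real.continuous_exp.comp_continuousOn (continuousOn_const.mul huR.continuousOn))).pow M)
      hU.measurableSet) ?_
    refine (ae_restrict_iff' hU.measurableSet).2 (Filter.Eventually.of_forall fun x hx => ?_)
    have hx1 : ‖x‖ ≤ 1 := by
      have : ‖x‖ < R := by simpa using hx.1
      linarith
    rw [Real.norm_of_nonneg (by positivity)]
    refine (add_pow_le zero_le_one (Real.exp_pos _).le M).trans ?_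
    rw [one_pow, ← Real.exp_nat_mul, ← mul_assoc, hδ, mul_div_cancel₀ _ hM0.ne']
    have := exp_mul_le_of_norm_le_one α (t := u x) hθ0.le (inv_mul_cancel₀ (by positivity)).le
      hx.2 hx1
    gcongr
  set r' := min r R
  have hr'0 : 0 < r' := lt_min hr0 hR0
  refine ⟨r', hr'0, IntegrableOn.congr_set_ae ?_
    (sdiff_null_ae_eq_self (measure_singleton (0 : EuclideanSpace ℝ (Fin n)))).symm⟩
  have hVsub : ball (0 : EuclideanSpace ℝ (Fin n)) r' \ {0} ⊆ ball 0 R \ {0} :=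
    Set.sdiff_subset_sdiff_left (ball_subset_ball (min_le_right _ _))
  have hV : IsOpen (ball (0 : EuclideanSpace ℝ (Fin n)) r' \ {0}) :=
    isOpen_ball.sdiff isClosed_singleton
  have hmaj : IntegrableOn (fun x => δ⁻¹ ^ q *
      ((‖fderiv ℝ (fun x => softplus δ (u x)) x‖ / (1 + softplus δ (u x))) ^ n +
        2 * ((1 + Real.exp (δ * u x)) ^ M + (1 + softplus δ (u x)) ^ M)))
      (ball 0 r' \ {0}) :=
    ((hlogint.mono_set hVsub).add (((hexpint.mono_set hVsub).add (hr.mono_set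
      (Set.sdiff_subset.trans (ball_subset_ball (min_le_left _ _))))).const_mul 2)).const_mul _
  refine hmaj.mono' (ContinuousOn.aestronglyMeasurable ?_ hV.measurableSet) ?_
  · exact ((huR.continuousOn.mono hVsub).abs.rpow_const fun _ _ => Or.inr hq0.le).add
      ((hgradc.mono hVsub).norm.rpow_const fun _ _ => Or.inr hq0.le)
  refine (ae_restrict_iff' hV.measurableSet).2 (Filter.Eventually.of_forall fun x hx => ?_)
  have hd := norm_fderiv_softplus_comp (hdiff x (hVsub hx)) hδ0.le
  have hl0 := hlog0 x
  have hw0 := hwpos x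
  have he0 := Real.exp_pos (δ * u x)
  set g := ‖fderiv ℝ (fun x => softplus δ (u x)) x‖
  set W := 1 + softplus δ (u x)
  set e := 1 + Real.exp (δ * u x)
  have hW1 : 1 ≤ W := by linarith
  have he1 : 1 ≤ e := by linarith
  have hW0 : 0 < W := by linarith
  have he00 : 0 < e := by linarith
  have hgrad : ‖gradient u x‖ = δ⁻¹ * (e * W * (g / W)) := by
    rw [hd]
    field_simp
  have hpow : (e * W) ^ s ≤ e ^ M + W ^ M := Real.mul_rpow_le_pow_add_pow he1 hW1 hs0.le hM
  have h1 : ‖gradient u x‖ ^ q ≤ δ⁻¹ ^ q * ((g / W) ^ n + (e * W) ^ s) := by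
    rw [hgrad, Real.mul_rpow (by positivity) (by positivity), Real.mul_rpow (by positivity) hl0]
    gcongr
    exact Real.rpow_mul_rpow_le_add hl0 (by positivity) hq0 hqn hs
  have h2 : |u x| ^ q ≤ δ⁻¹ ^ q * (e * W) ^ s := by
    have h3 : |u x| ≤ δ⁻¹ * (e * W) := by
      refine (abs_le_softplus_add_exp hδ0 (u x)).trans ?_
      rw [div_eq_inv_mul]
      gcongr
      nlinarith
    calc |u x| ^ q ≤ (δ⁻¹ * (e * W)) ^ q := Real.rpow_le_rpow (abs_nonneg _) h3 hq0.le
      _ = δ⁻¹ ^ q * (e * W) ^ q := Real.mul_rpow (by positivity) (by positivity)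
      _ ≤ _ := by
        gcongr
        exact one_le_mul_of_one_le_of_one_le he1 hW1
  rw [Real.norm_of_nonneg (by positivity)]
  calc |u x| ^ q + ‖gradient u x‖ ^ q ≤
        δ⁻¹ ^ q * (e * W) ^ s + δ⁻¹ ^ q * ((g / W) ^ n + (e * W) ^ s) := add_le_add h2 h1
    _ = δ⁻¹ ^ q * ((g / W) ^ n + 2 * (e * W) ^ s) := by ring
    _ ≤ _ := by gcongr

end LocalRegularity

theorem local_W1q_regularity
    (n : ℕ) (hn : 2 ≤ n) (α : ℝ)
    (Ω : Set (EuclideanSpace ℝ (Fin n))) (hΩ : IsOpen Ω)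
    (h0 : (0 : EuclideanSpace ℝ (Fin n)) ∈ Ω)
    (u : EuclideanSpace ℝ (Fin n) → ℝ)
    (hu : ContDiffOn ℝ 1 u (Ω \ {0}))
    (hsol : IsWeakNSol n (Ω \ {0}) u (fun x => ‖x‖ ^ ((n : ℝ) * α) * Real.exp (u x)))
    (hint : IntegrableOn (fun x => ‖x‖ ^ ((n : ℝ) * α) * Real.exp (u x)) Ω) :
    ∀ q : ℝ, 1 ≤ q → q < n →
      ∀ K : Set (EuclideanSpace ℝ (Fin n)), K ⊆ Ω → IsCompact K →
        IntegrableOn (fun x => |u x| ^ q + ‖gradient u x‖ ^ q) K := by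
  intro q hq hqn K hKΩ hK
  have hq0 : 0 ≤ q := by linarith
  obtain ⟨r, hr, hball⟩ := exists_integrableOn_ball hn hΩ h0 hu hsol hint hq hqn
  have hsub : K \ ball 0 r ⊆ Ω \ {0} := fun x hx => ⟨hKΩ hx.1, fun h => hx.2 (by
    rw [mem_singleton_iff.1 h]; exact mem_ball_self hr)⟩
  have hcont : ContinuousOn (fun x => |u x| ^ q + ‖gradient u x‖ ^ q) (K \ ball 0 r) :=
    ((hu.continuousOn.mono hsub).abs.rpow_const fun _ _ => Or.inr hq0).add
      (((hu.continuousOn_gradient_s8 (hΩ.sdiff isClosed_singleton)).mono hsub).norm.rpow_const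
        fun _ _ => Or.inr hq0)
  refine (hball.union (hcont.integrableOn_compact (hK.diff isOpen_ball))).mono_set fun x hx => ?_
  by_cases h : x ∈ ball (0 : EuclideanSpace ℝ (Fin n)) r
  · exact Or.inl h
  · exact Or.inr ⟨hx, h⟩
end
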